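/- (Mean field limit.) Assume the interaction kernel K satisfies (HK1)-(HK2) with constant L. Let f^in be a probability density on ℝ^d with ∫|z| f^in(z) dz < ∞. Then: (i) the Cauchy problem for the mean field PDE ∂_t f + div_z(f 𝒦f) = 0 with f(0) = f^in has a unique weak solution f ∈ C(ℝ; L¹(ℝ^d)); (ii) if for each N ≥ 1 one chooses 𝔍(N) ∈ (ℝ^d)^N such that dist_{MK,1}(μ_{𝔍(N)}, f^in·Leb) → 0 as N → ∞, then for every t ∈ ℝ one has dist_{MK,1}(μ_{T_t 𝔍(N)}, f(t,·)·Leb) ≤ e^{2L|t|} dist_{MK,1}(μ_{𝔍(N)}, f^in·Leb) → 0, and in particular μ_{T_t 𝔍(N)} converges to f(t,·)·Leb in the weak topology of probability measures (∫φ dμ_{T_t 𝔍(N)} → ∫φ f(t,z)dz for every bounded continuous φ). -/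

import Mathlib

open MeasureTheory Real Filter Topology
open scoped ENNReal NNReal

noncomputable section

/-- The empirical measure of an `N`-tuple of points in `ℝ^d`. -/
def empiricalMeasure {d N : ℕ} (z : Fin N → EuclideanSpace ℝ (Fin d)) :
    Measure (EuclideanSpace ℝ (Fin d)) :=
  (N : ℝ≥0∞)⁻¹ • ∑ j : Fin N, Measure.dirac (z j)

/-- The measure with density `g` with respect to Lebesgue measure on `ℝ^d`. -/
def densMeasure {d : ℕ} (g : EuclideanSpace ℝ (Fin d) → ℝ) :
    Measure (EuclideanSpace ℝ (Fin d)) :=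
  volume.withDensity (fun z => ENNReal.ofReal (g z))

/-- The set of couplings of two Borel measures on `ℝ^d`. -/
def couplings {d : ℕ} (μ ν : Measure (EuclideanSpace ℝ (Fin d))) :
    Set (Measure (EuclideanSpace ℝ (Fin d) × EuclideanSpace ℝ (Fin d))) :=
  {γ | γ.map Prod.fst = μ ∧ γ.map Prod.snd = ν}

/-- The Monge-Kantorovich distance with exponent 1 (with values in `ℝ≥0∞`). -/
def distMK1 {d : ℕ} (μ ν : Measure (EuclideanSpace ℝ (Fin d))) : ℝ≥0∞ :=
  ⨅ γ ∈ couplings μ ν, ∫⁻ p, edist p.1 p.2 ∂γ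

/-- `f` is a weak solution of the mean field PDE `∂ₜ f + div_z (f 𝒦f) = 0`:
for every `φ ∈ C¹_b(ℝ^d)`,
`d/dt ∫ φ(z) f(t,z) dz = ∫ ∇φ(z)·(𝒦 f(t))(z) f(t,z) dz`. -/
def IsWeakMeanFieldSol {d : ℕ}
    (K : EuclideanSpace ℝ (Fin d) × EuclideanSpace ℝ (Fin d) → EuclideanSpace ℝ (Fin d))
    (f : ℝ → EuclideanSpace ℝ (Fin d) → ℝ) : Prop :=
  ∀ φ : EuclideanSpace ℝ (Fin d) → ℝ, ContDiff ℝ 1 φ →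
    (∃ C : ℝ, ∀ z, |φ z| ≤ C) → (∃ C : ℝ, ∀ z, ‖fderiv ℝ φ z‖ ≤ C) →
    ∀ t : ℝ,
      HasDerivAt (fun s => ∫ z, φ z * f s z)
        (∫ z, fderiv ℝ φ z (∫ z', f t z' • K (z, z')) * f t z) t

/-- `f` is a solution of the Cauchy problem for the mean field PDE in the class
`C(ℝ; L¹(ℝ^d))` with initial data `fin`. -/
def IsL1MeanFieldSol {d : ℕ}
    (K : EuclideanSpace ℝ (Fin d) × EuclideanSpace ℝ (Fin d) → EuclideanSpace ℝ (Fin d))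
    (fin : EuclideanSpace ℝ (Fin d) → ℝ)
    (f : ℝ → EuclideanSpace ℝ (Fin d) → ℝ) : Prop :=
  (∀ t : ℝ, Integrable (f t)) ∧
  (∀ t₀ : ℝ, Tendsto (fun t => ∫ z, |f t z - f t₀ z|) (𝓝 t₀) (𝓝 0)) ∧
  (f 0 =ᵐ[(volume : Measure (EuclideanSpace ℝ (Fin d)))] fin) ∧
  IsWeakMeanFieldSol K f

set_option linter.unusedSectionVars false

section GlobalODE

variable {X : Type*} [NormedAddCommGroup X] [NormedSpace ℝ X]

lemma exists_local_solution_of_lipschitz [CompleteSpace X] {F : ℝ → X → X} {k : ℝ≥0}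
    (hF : ∀ x, Continuous fun t => F t x) (hk : ∀ t, LipschitzWith k (F t)) (t₀ : ℝ) (x₀ : X) :
    ∃ α : ℝ → X, α t₀ = x₀ ∧
      ∀ t ∈ Set.Ioo (t₀ - 1 / (2 * (k + 1))) (t₀ + 1 / (2 * (k + 1))),
        HasDerivAt α (F t (α t)) t := by
  set h : ℝ := 1 / (2 * ((k : ℝ) + 1)) with hh
  have hk0 : (0 : ℝ) ≤ k := k.2
  have hpos : 0 < h := by positivity
  have hmem : t₀ ∈ Set.Icc (t₀ - h) (t₀ + h) := ⟨by linarith, by linarith⟩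
  obtain ⟨C, hC⟩ := (isCompact_Icc (a := t₀ - h) (b := t₀ + h)).exists_bound_of_continuousOn
    (hF x₀).continuousOn
  have hC0 : 0 ≤ C := (norm_nonneg _).trans (hC t₀ hmem)
  have hPL : IsPicardLindelof F (⟨t₀, hmem⟩ : Set.Icc (t₀ - h) (t₀ + h)) x₀
      (⟨C, hC0⟩ : ℝ≥0) 0 (⟨C, hC0⟩ + k * ⟨C, hC0⟩) k := by
    refine ⟨fun t _ => (hk t).lipschitzOnWith, fun x _ => (hF x).continuousOn, ?_, ?_⟩
    · intro t ht x hx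
      have h1 := (hk t).dist_le_mul x x₀
      rw [dist_eq_norm] at h1
      have h2 : dist x x₀ ≤ C := hx
      have h3 := hC t ht
      have : F t x = F t x₀ + (F t x - F t x₀) := by abel
      rw [this]
      refine (norm_add_le _ _).trans (add_le_add h3 (h1.trans ?_))
      exact mul_le_mul_of_nonneg_left h2 hk0
    · push_cast
      have e1 : t₀ + h - t₀ = h := by ring
      have e2 : t₀ - (t₀ - h) = h := by ring
      simp only [e1, e2, max_self]
      rw [hh, mul_one_div, div_le_iff₀ (by positivity)]
      change C + k * C ≤ (C - 0) * _
      nlinarith [mul_nonneg hC0 hk0]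
  obtain ⟨α, h0, hα⟩ := hPL.exists_eq_forall_mem_Icc_hasDerivWithinAt₀
  refine ⟨α, h0, fun t ht => (hα t (Set.Ioo_subset_Icc_self ht)).hasDerivAt
    (Icc_mem_nhds ht.1 ht.2)⟩

lemma exists_solution_Ioo_of_lipschitz [CompleteSpace X] {F : ℝ → X → X} {k : ℝ≥0}
    (hF : ∀ x, Continuous fun t => F t x) (hk : ∀ t, LipschitzWith k (F t)) (t₀ : ℝ) (x₀ : X)
    (n : ℕ) :
    ∃ α : ℝ → X, α t₀ = x₀ ∧
      ∀ t ∈ Set.Ioo (t₀ - (n + 1) * (1 / (4 * (k + 1)))) (t₀ + (n + 1) * (1 / (4 * (k + 1)))),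
        HasDerivAt α (F t (α t)) t := by
  have hk0 : (0 : ℝ) ≤ k := k.2
  set e : ℝ := 1 / (4 * ((k : ℝ) + 1)) with he
  have h2 : 1 / (2 * ((k : ℝ) + 1)) = 2 * e := by rw [he]; field_simp; norm_num
  have hpos : 0 < e := by positivity
  induction n with
  | zero =>
    obtain ⟨α, h0, hα⟩ := exists_local_solution_of_lipschitz hF hk t₀ x₀
    rw [h2] at hα
    refine ⟨α, h0, fun t ht => hα t ?_⟩
    simp only [Nat.cast_zero, zero_add, one_mul] at ht
    exact ⟨by linarith [ht.1], by linarith [ht.2]⟩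
  | succ n ih =>
    obtain ⟨α, h0, hα⟩ := ih
    have hn : (0 : ℝ) ≤ n := Nat.cast_nonneg n
    set T : ℝ := (n + 1) * e with hT
    have hTe : e ≤ T := by rw [hT]; nlinarith
    have hT' : ((n + 1 : ℕ) + 1 : ℝ) * e = T + e := by rw [hT]; push_cast; ring
    rw [hT']
    obtain ⟨β, hβ0, hβ⟩ := exists_local_solution_of_lipschitz hF hk (t₀ + (T - e / 2))
      (α (t₀ + (T - e / 2)))
    obtain ⟨γ, hγ0, hγ⟩ := exists_local_solution_of_lipschitz hF hk (t₀ - (T - e / 2))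
      (α (t₀ - (T - e / 2)))
    rw [h2] at hβ hγ
    have hαβ : Set.EqOn α β (Set.Ioo (t₀ + (T - 2 * e)) (t₀ + T)) := by
      refine ODE_solution_unique_of_mem_Ioo (v := F) (s := fun _ => Set.univ) (K := k)
        (t₀ := t₀ + (T - e / 2))
        (fun t _ => (hk t).lipschitzOnWith) ⟨by linarith, by linarith⟩
        (fun t ht => ⟨hα t ⟨by linarith [ht.1], ht.2⟩, trivial⟩)
        (fun t ht => ⟨hβ t ⟨by linarith [ht.1], by linarith [ht.2]⟩, trivial⟩) hβ0.symm
    have hαγ : Set.EqOn α γ (Set.Ioo (t₀ - T) (t₀ - (T - 2 * e))) := by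
      refine ODE_solution_unique_of_mem_Ioo (v := F) (s := fun _ => Set.univ) (K := k)
        (t₀ := t₀ - (T - e / 2))
        (fun t _ => (hk t).lipschitzOnWith) ⟨by linarith, by linarith⟩
        (fun t ht => ⟨hα t ⟨ht.1, by linarith [ht.2]⟩, trivial⟩)
        (fun t ht => ⟨hγ t ⟨by linarith [ht.1], by linarith [ht.2]⟩, trivial⟩) hγ0.symm
    refine ⟨fun t => if t₀ + (T - e / 2) < t then β t else if t < t₀ - (T - e / 2) then γ t
      else α t, ?_, ?_⟩
    · have a1 : ¬ t₀ + (T - e / 2) < t₀ := by linarith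
      have a2 : ¬ t₀ < t₀ - (T - e / 2) := by linarith
      simp only [a1, a2, if_false, h0]
    · intro t ht
      rcases lt_or_ge (t₀ + (T - e)) t with h | h
      · have hev : (fun t => if t₀ + (T - e / 2) < t then β t else
            if t < t₀ - (T - e / 2) then γ t else α t) =ᶠ[𝓝 t] β := by
          filter_upwards [Ioi_mem_nhds h] with s hs
          have hs : t₀ + (T - e) < s := hs
          split_ifs with c1 c2
          · rfl
          · linarith
          · exact hαβ ⟨by linarith, by linarith⟩
        have h3 := (hβ t ⟨by linarith, by linarith [ht.2]⟩).congr_of_eventuallyEq hev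
        rw [← hev.eq_of_nhds] at h3
        exact h3
      · rcases lt_or_ge t (t₀ - (T - e)) with h' | h'
        · have hev : (fun t => if t₀ + (T - e / 2) < t then β t else
            if t < t₀ - (T - e / 2) then γ t else α t) =ᶠ[𝓝 t] γ := by
            filter_upwards [Iio_mem_nhds h'] with s hs
            have hs : s < t₀ - (T - e) := hs
            split_ifs with c1 c2
            · linarith
            · rfl
            · exact hαγ ⟨by linarith, by linarith⟩
          have h3 := (hγ t ⟨by linarith [ht.1], by linarith⟩).congr_of_eventuallyEq hev
          rw [← hev.eq_of_nhds] at h3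
          exact h3
        · have hev : (fun t => if t₀ + (T - e / 2) < t then β t else
            if t < t₀ - (T - e / 2) then γ t else α t) =ᶠ[𝓝 t] α := by
            filter_upwards [Ioo_mem_nhds (show t₀ - (T - e / 2) < t by linarith)
              (show t < t₀ + (T - e / 2) by linarith)] with s hs
            rw [if_neg (not_lt.2 hs.2.le), if_neg (not_lt.2 hs.1.le)]
          have h3 := (hα t ⟨by linarith, by linarith⟩).congr_of_eventuallyEq hev
          rw [← hev.eq_of_nhds] at h3
          exact h3

/-- Global existence for an ODE whose right-hand side is uniformly Lipschitz. -/
lemma exists_global_solution_of_lipschitz [CompleteSpace X] {F : ℝ → X → X} {k : ℝ≥0}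
    (hF : ∀ x, Continuous fun t => F t x) (hk : ∀ t, LipschitzWith k (F t)) (t₀ : ℝ) (x₀ : X) :
    ∃ α : ℝ → X, α t₀ = x₀ ∧ ∀ t, HasDerivAt α (F t (α t)) t := by
  have hk0 : (0 : ℝ) ≤ k := k.2
  choose α h0 hα using exists_solution_Ioo_of_lipschitz hF hk t₀ x₀
  set e : ℝ := 1 / (4 * ((k : ℝ) + 1)) with he
  have hpos : 0 < e := by positivity
  have hmono : ∀ m n : ℕ, m ≤ n → Set.EqOn (α m) (α n)
      (Set.Ioo (t₀ - (m + 1) * e) (t₀ + (m + 1) * e)) := by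
    intro m n hmn
    have hmn' : (m : ℝ) ≤ n := by exact_mod_cast hmn
    have hm : (0 : ℝ) < m + 1 := by positivity
    have hle : ((m : ℝ) + 1) * e ≤ (n + 1) * e := by gcongr
    have hme : 0 < ((m : ℝ) + 1) * e := by positivity
    refine ODE_solution_unique_of_mem_Ioo (v := F) (s := fun _ => Set.univ) (K := k)
      (t₀ := t₀) (fun t _ => (hk t).lipschitzOnWith) ⟨by linarith, by linarith⟩
      (fun t ht => ⟨hα m t ht, trivial⟩)
      (fun t ht => ⟨hα n t ⟨by linarith [ht.1], by linarith [ht.2]⟩, trivial⟩)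
      ((h0 m).trans (h0 n).symm)
  have hex : ∀ t : ℝ, ∃ n : ℕ, t ∈ Set.Ioo (t₀ - (n + 1) * e) (t₀ + (n + 1) * e) := by
    intro t
    obtain ⟨n, hn⟩ := exists_nat_gt (|t - t₀| / e)
    rw [div_lt_iff₀ hpos] at hn
    have := abs_lt.1 hn
    exact ⟨n, by constructor <;> nlinarith [this.1, this.2]⟩
  choose n hn using hex
  have key : ∀ t m, t ∈ Set.Ioo (t₀ - ((m : ℕ) + 1) * e) (t₀ + (m + 1) * e) →
      α (n t) t = α m t := by
    intro t m hm
    rcases le_total (n t) m with h | h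
    · exact hmono _ _ h (hn t)
    · exact (hmono _ _ h hm).symm
  refine ⟨fun t => α (n t) t, h0 _, fun t => ?_⟩
  have hev : (fun t => α (n t) t) =ᶠ[𝓝 t] α (n t) := by
    filter_upwards [Ioo_mem_nhds (hn t).1 (hn t).2] with s hs using key s _ hs
  exact (hα (n t) t (hn t)).congr_of_eventuallyEq hev

end GlobalODE

section MeanFieldFlow

variable {E : Type*} [NormedAddCommGroup E] [NormedSpace ℝ E]

/-- `K` is a `C¹` antisymmetric interaction kernel which is `L`-Lipschitz in its first variable. -/
structure IsInteractionKernel (K : E × E → E) (L : ℝ) : Prop where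
  nonneg : 0 ≤ L
  contDiff : ContDiff ℝ 1 K
  antisymm : ∀ z z', K (z, z') = - K (z', z)
  lip_fst : ∀ z w z', ‖K (z, z') - K (w, z')‖ ≤ L * ‖z - w‖

namespace IsInteractionKernel

variable {K : E × E → E} {L : ℝ}

lemma continuous (h : IsInteractionKernel K L) : Continuous K := h.contDiff.continuous

lemma lip_snd (h : IsInteractionKernel K L) (z z' w' : E) :
    ‖K (z, z') - K (z, w')‖ ≤ L * ‖z' - w'‖ := by
  rw [h.antisymm z z', h.antisymm z w', neg_sub_neg, norm_sub_rev]
  exact h.lip_fst z' w' z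

lemma lip (h : IsInteractionKernel K L) (z z' w w' : E) :
    ‖K (z, z') - K (w, w')‖ ≤ L * (‖z - w‖ + ‖z' - w'‖) := by
  have : K (z, z') - K (w, w') = (K (z, z') - K (w, z')) + (K (w, z') - K (w, w')) := by abel
  rw [this, mul_add]
  exact (norm_add_le _ _).trans (add_le_add (h.lip_fst z w z') (h.lip_snd w z' w'))

lemma apply_self (h : IsInteractionKernel K L) (z : E) : K (z, z) = 0 := by
  have h2 : (2 : ℝ) • K (z, z) = 0 := by
    rw [two_smul]; exact eq_neg_iff_add_eq_zero.1 (h.antisymm z z)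
  exact (smul_eq_zero.1 h2).resolve_left two_ne_zero

lemma norm_le (h : IsInteractionKernel K L) (z z' : E) : ‖K (z, z')‖ ≤ L * (‖z‖ + ‖z'‖) := by
  have := h.lip_fst z z' z'
  rw [h.apply_self, sub_zero] at this
  exact this.trans (mul_le_mul_of_nonneg_left (norm_sub_le _ _) h.nonneg)

end IsInteractionKernel

variable [MeasurableSpace E] [BorelSpace E]

/-- `Z` is the mean field characteristic flow associated with `K` and the initial measure `μ`. -/
structure IsMeanFieldFlow (K : E × E → E) (μ : Measure E) (Z : ℝ → E → E) : Prop where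
  zero : ∀ ζ, Z 0 ζ = ζ
  continuous : Continuous fun p : ℝ × E => Z p.1 p.2
  bound : ∀ T : ℝ, ∃ C : ℝ, 0 ≤ C ∧ ∀ t, |t| ≤ T → ∀ ζ, ‖Z t ζ‖ ≤ C * (1 + ‖ζ‖)
  hasDerivAt : ∀ t ζ, HasDerivAt (fun s => Z s ζ) (∫ ζ', K (Z t ζ, Z t ζ') ∂μ) t

variable [SecondCountableTopology E] {K : E × E → E} {L : ℝ} {μ : Measure E}

lemma integrable_kernel_comp [IsFiniteMeasure μ] (h : IsInteractionKernel K L)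
    (hμ : Integrable (fun z => ‖z‖) μ) {Y : E → E} (hY : AEStronglyMeasurable Y μ)
    {C : ℝ} (hC : ∀ ζ, ‖Y ζ‖ ≤ C * (1 + ‖ζ‖)) (z : E) :
    Integrable (fun ζ' => K (z, Y ζ')) μ := by
  have hg : Integrable (fun ζ' => L * (‖z‖ + C * (1 + ‖ζ'‖))) μ :=
    ((integrable_const _).add (((integrable_const _).add hμ).const_mul C)).const_mul L
  refine hg.mono' ?_ (ae_of_all _ fun ζ' => ?_)
  · exact (h.continuous.comp (continuous_const.prodMk continuous_id)).comp_aestronglyMeasurable hY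
  · exact (h.norm_le _ _).trans
      (mul_le_mul_of_nonneg_left (add_le_add le_rfl (hC ζ')) h.nonneg)

open BoundedContinuousFunction in
theorem exists_meanFieldFlow [CompleteSpace E] [IsProbabilityMeasure μ]
    (h : IsInteractionKernel K L) (hμ : Integrable (fun z => ‖z‖) μ) :
    ∃ Z, IsMeanFieldFlow K μ Z := by
  have hL := h.nonneg
  set M : ℝ := ∫ z, ‖z‖ ∂μ with hM
  have hM0 : 0 ≤ M := integral_nonneg fun _ => norm_nonneg _
  let pos : (E →ᵇ E) → E → E := fun w ζ => ζ + (1 + ‖ζ‖) • w ζ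
  have hpos_cont : ∀ w, Continuous (pos w) := fun w => by
    have := w.continuous
    fun_prop
  have h1 : ∀ ζ : E, 0 < 1 + ‖ζ‖ := fun ζ => by positivity
  have hpos_sub : ∀ w₁ w₂ ζ, ‖pos w₁ ζ - pos w₂ ζ‖ ≤ (1 + ‖ζ‖) * ‖w₁ - w₂‖ := by
    intro w₁ w₂ ζ
    have : pos w₁ ζ - pos w₂ ζ = (1 + ‖ζ‖) • ((w₁ - w₂) ζ) := by
      simp only [pos, BoundedContinuousFunction.coe_sub, Pi.sub_apply, smul_sub]; abel
    rw [this, norm_smul, Real.norm_of_nonneg (h1 ζ).le]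
    exact mul_le_mul_of_nonneg_left ((w₁ - w₂).norm_coe_le_norm ζ) (h1 ζ).le
  have hpos_norm : ∀ w ζ, ‖pos w ζ‖ ≤ (1 + ‖w‖) * (1 + ‖ζ‖) := by
    intro w ζ
    refine (norm_add_le _ _).trans ?_
    rw [norm_smul, Real.norm_of_nonneg (h1 ζ).le]
    nlinarith [w.norm_coe_le_norm ζ, h1 ζ, norm_nonneg ζ]
  have hInt : ∀ w z, Integrable (fun ζ' => K (z, pos w ζ')) μ := fun w z =>
    integrable_kernel_comp h hμ (hpos_cont w).aestronglyMeasurable (hpos_norm w) z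
  have hintg : ∀ a b c : ℝ, Integrable (fun ζ' : E => a * (b + c * (1 + ‖ζ'‖))) μ := fun a b c =>
    ((integrable_const _).add (((integrable_const _).add hμ).const_mul c)).const_mul a
  have hval : ∀ a b c : ℝ, ∫ ζ', a * (b + c * (1 + ‖ζ'‖)) ∂μ = a * (b + c * (1 + M)) := by
    intro a b c
    have : ∀ ζ' : E, a * (b + c * (1 + ‖ζ'‖)) = a * (b + c) + a * c * ‖ζ'‖ := fun ζ' => by ring
    simp_rw [this]
    rw [integral_add (integrable_const _) (hμ.const_mul _), integral_const_mul (a * c)]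
    simp only [integral_const, probReal_univ, smul_eq_mul, one_mul]
    rw [← hM]
    ring
  -- the vector field
  let V : (E →ᵇ E) → E → E := fun w z => ∫ ζ', K (z, pos w ζ') ∂μ
  have hVlip : ∀ w z z', ‖V w z - V w z'‖ ≤ L * ‖z - z'‖ := by
    intro w z z'
    simp only [V]
    rw [← integral_sub (hInt w z) (hInt w z')]
    refine (norm_integral_le_of_norm_le (integrable_const (L * ‖z - z'‖))
      (ae_of_all _ fun ζ' => h.lip_fst _ _ _)).trans ?_
    simp
  have hVcont : ∀ w, Continuous (V w) := fun w => by
    refine (LipschitzWith.of_dist_le_mul (K := ⟨L, hL⟩) fun z z' => ?_).continuous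
    rw [dist_eq_norm, dist_eq_norm]; exact hVlip w z z'
  have hVnorm : ∀ w z, ‖V w z‖ ≤ L * (‖z‖ + (1 + ‖w‖) * (1 + M)) := by
    intro w z
    rw [← hval]
    refine norm_integral_le_of_norm_le (hintg _ _ _) (ae_of_all _ fun ζ' => ?_)
    exact (h.norm_le _ _).trans
      (mul_le_mul_of_nonneg_left (add_le_add le_rfl (hpos_norm w ζ')) hL)
  let F : (E →ᵇ E) → (E →ᵇ E) := fun w =>
    BoundedContinuousFunction.ofNormedAddCommGroup
      (fun ζ => (1 + ‖ζ‖)⁻¹ • V w (pos w ζ))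
      (by
        have h2 : Continuous fun ζ : E => (1 + ‖ζ‖)⁻¹ :=
          (continuous_const.add continuous_norm).inv₀ fun ζ => (h1 ζ).ne'
        exact h2.smul ((hVcont w).comp (hpos_cont w)))
      (L * ((1 + ‖w‖) * (2 + M)))
      (by
        intro ζ
        rw [norm_smul, norm_inv, Real.norm_of_nonneg (h1 ζ).le, inv_mul_le_iff₀ (h1 ζ)]
        refine (hVnorm w _).trans ?_
        rw [show (1 + ‖ζ‖) * (L * ((1 + ‖w‖) * (2 + M))) =
          L * ((1 + ‖ζ‖) * ((1 + ‖w‖) * (2 + M))) by ring]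
        refine mul_le_mul_of_nonneg_left ?_ hL
        have := hpos_norm w ζ
        have h3 : 0 ≤ ‖ζ‖ * ((1 + ‖w‖) * (1 + M)) := by positivity
        nlinarith)
  have hFlip : ∀ w₁ w₂, ‖F w₁ - F w₂‖ ≤ L * (2 + M) * ‖w₁ - w₂‖ := by
    intro w₁ w₂
    rw [BoundedContinuousFunction.norm_le (by positivity)]
    intro ζ
    change ‖(1 + ‖ζ‖)⁻¹ • V w₁ (pos w₁ ζ) - (1 + ‖ζ‖)⁻¹ • V w₂ (pos w₂ ζ)‖ ≤ _
    rw [← smul_sub, norm_smul, norm_inv, Real.norm_of_nonneg (h1 ζ).le, inv_mul_le_iff₀ (h1 ζ)]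
    simp only [V]
    rw [← integral_sub (hInt _ _) (hInt _ _)]
    have h4 : ‖∫ ζ', (K (pos w₁ ζ, pos w₁ ζ') - K (pos w₂ ζ, pos w₂ ζ')) ∂μ‖ ≤
        L * ((1 + ‖ζ‖) * ‖w₁ - w₂‖ + ‖w₁ - w₂‖ * (1 + M)) := by
      rw [← hval]
      refine norm_integral_le_of_norm_le (hintg _ _ _) (ae_of_all _ fun ζ' => ?_)
      refine (h.lip _ _ _ _).trans (mul_le_mul_of_nonneg_left
        (add_le_add (hpos_sub _ _ _) ?_) hL)
      rw [mul_comm]; exact hpos_sub _ _ _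
    refine h4.trans ?_
    rw [show (1 + ‖ζ‖) * (L * (2 + M) * ‖w₁ - w₂‖) =
      L * ((1 + ‖ζ‖) * ((2 + M) * ‖w₁ - w₂‖)) by ring]
    refine mul_le_mul_of_nonneg_left ?_ hL
    have h3 : 0 ≤ ‖ζ‖ * ((1 + M) * ‖w₁ - w₂‖) := by positivity
    nlinarith
  have hk0 : 0 ≤ L * (2 + M) := by positivity
  obtain ⟨w, hw0, hw⟩ := exists_global_solution_of_lipschitz (X := E →ᵇ E)
    (F := fun _ => F) (k := ⟨L * (2 + M), hk0⟩) (fun x => continuous_const)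
    (fun t => LipschitzWith.of_dist_le_mul fun w₁ w₂ => by
      rw [dist_eq_norm, dist_eq_norm]; exact hFlip w₁ w₂) 0 0
  have hwc : Continuous w := continuous_iff_continuousAt.2 fun t => (hw t).continuousAt
  refine ⟨fun t => pos (w t), ?_, ?_, ?_, ?_⟩
  · intro ζ
    simp [pos, hw0]
  · have : Continuous fun p : ℝ × E => w p.1 p.2 :=
      (hwc.comp continuous_fst).eval continuous_snd
    simp only [pos]
    fun_prop
  · intro T
    obtain ⟨C, hC⟩ := (isCompact_Icc (a := -T) (b := T)).exists_bound_of_continuousOn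
      hwc.continuousOn
    refine ⟨1 + |C|, by positivity, fun t ht ζ => (hpos_norm _ _).trans ?_⟩
    have := (hC t (abs_le.1 ht)).trans (le_abs_self C)
    gcongr
  · intro t ζ
    have h5 : HasDerivAt (fun s => w s ζ) (F (w t) ζ) t := by
      have := (BoundedContinuousFunction.evalCLM ℝ (β := E) ζ).hasFDerivAt.comp_hasDerivAt t (hw t)
      exact this
    have h6 := (h5.const_smul (1 + ‖ζ‖)).const_add ζ
    have h7 : (1 + ‖ζ‖) • F (w t) ζ = V (w t) (pos (w t) ζ) := by
      change (1 + ‖ζ‖) • ((1 + ‖ζ‖)⁻¹ • V (w t) (pos (w t) ζ)) = _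
      rw [smul_smul, mul_inv_cancel₀ (h1 ζ).ne', one_smul]
    rw [h7] at h6
    exact h6

end MeanFieldFlow

/-- A comparison principle: `‖w‖` stays below a solution `β` of `β' = L β + r` as soon as
`‖w'‖ ≤ L ‖w‖ + r`. -/
lemma norm_le_of_norm_deriv_le {E : Type*} [NormedAddCommGroup E] [NormedSpace ℝ E]
    {w w' : ℝ → E} {β r : ℝ → ℝ} {L T : ℝ}
    (hw : ∀ t, HasDerivAt w (w' t) t) (hβ : ∀ t, HasDerivAt β (L * β t + r t) t)
    (h0 : ‖w 0‖ ≤ β 0) (hle : ∀ t, 0 ≤ t → t < T → ‖w' t‖ ≤ L * ‖w t‖ + r t)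
    {t : ℝ} (ht0 : 0 ≤ t) (htT : t ≤ T) : ‖w t‖ ≤ β t := by
  have key : ∀ ε : ℝ, 0 < ε → ‖w t‖ ≤ β t + ε * ((1 + t) * exp (L * t)) := by
    intro ε hε
    have hB : ∀ s, HasDerivAt (fun s => β s + ε * ((1 + s) * exp (L * s)))
        (L * β s + r s + ε * (1 * exp (L * s) + (1 + s) * (exp (L * s) * L))) s := by
      intro s
      have h1 : HasDerivAt (fun s => exp (L * s)) (exp (L * s) * L) s := by
        simpa using ((hasDerivAt_id s).const_mul L).exp
      exact (hβ s).add ((((hasDerivAt_id s).const_add 1).mul h1).const_mul ε)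
    refine image_norm_le_of_norm_deriv_right_lt_deriv_boundary (a := 0) (b := T) (f := w)
      (fun s _ => (hw s).continuousAt.continuousWithinAt)
      (fun s _ => (hw s).hasDerivWithinAt) ?_ hB ?_ ⟨ht0, htT⟩
    · simp only [add_zero, mul_zero, exp_zero, mul_one]; linarith
    · intro s hs hse
      refine (hle s hs.1 hs.2).trans_lt ?_
      have := exp_pos (L * s)
      rw [hse]
      nlinarith
  refine le_of_forall_pos_le_add fun δ hδ => ?_
  have hp : 0 < (1 + t) * exp (L * t) := by positivity
  have := key (δ / ((1 + t) * exp (L * t))) (by positivity)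
  rwa [div_mul_cancel₀ _ hp.ne'] at this

section MeanFieldFlow

variable {E : Type*} [NormedAddCommGroup E] [NormedSpace ℝ E]
variable {K : E × E → E} {L : ℝ}

lemma IsInteractionKernel.neg (h : IsInteractionKernel K L) :
    IsInteractionKernel (fun p => - K p) L where
  nonneg := h.nonneg
  contDiff := h.contDiff.neg
  antisymm z z' := by rw [h.antisymm]
  lip_fst z w z' := by rw [neg_sub_neg, norm_sub_rev]; exact h.lip_fst z w z'

variable [MeasurableSpace E] {μ ν : Measure E}

lemma IsMeanFieldFlow.neg {Z : ℝ → E → E} (hZ : IsMeanFieldFlow K μ Z) :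
    IsMeanFieldFlow (fun p => - K p) μ (fun t => Z (-t)) where
  zero ζ := by rw [neg_zero, hZ.zero]
  continuous := hZ.continuous.comp (continuous_fst.neg.prodMk continuous_snd)
  bound T := by
    obtain ⟨C, h0, hC⟩ := hZ.bound T
    exact ⟨C, h0, fun t ht ζ => hC (-t) (by rwa [abs_neg]) ζ⟩
  hasDerivAt t ζ := by
    have := (hZ.hasDerivAt (-t) ζ).scomp t (hasDerivAt_neg t)
    rw [neg_one_smul, ← integral_neg] at this
    exact this

variable [BorelSpace E] [SecondCountableTopology E]

lemma IsMeanFieldFlow.measurable {Z : ℝ → E → E} (hZ : IsMeanFieldFlow K μ Z) (t : ℝ) :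
    Measurable (Z t) :=
  (hZ.continuous.comp (continuous_const.prodMk continuous_id)).measurable

/-- **Dobrushin's estimate**, for `t ≥ 0`. -/
lemma dobrushin_estimate_nonneg {X Y : ℝ → E → E} (h : IsInteractionKernel K L)
    (hX : IsMeanFieldFlow K μ X) (hY : IsMeanFieldFlow K ν Y)
    {γ : Measure (E × E)} [IsProbabilityMeasure γ]
    (hγ1 : γ.map Prod.fst = μ) (hγ2 : γ.map Prod.snd = ν)
    (hμ : Integrable (fun z => ‖z‖) μ) (hν : Integrable (fun z => ‖z‖) ν)
    {T : ℝ} (hT : 0 ≤ T) :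
    ∫ p, ‖X T p.1 - Y T p.2‖ ∂γ ≤ exp (2 * L * T) * ∫ p, ‖p.1 - p.2‖ ∂γ := by
  have hL := h.nonneg
  have hfst : Integrable (fun p : E × E => ‖p.1‖) γ := by
    rw [← hγ1] at hμ
    exact (integrable_map_measure hμ.1 measurable_fst.aemeasurable).1 hμ
  have hsnd : Integrable (fun p : E × E => ‖p.2‖) γ := by
    rw [← hγ2] at hν
    exact (integrable_map_measure hν.1 measurable_snd.aemeasurable).1 hν
  have hXγ : ∀ t, AEStronglyMeasurable (fun p : E × E => X t p.1) γ := fun t =>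
    (((hX.measurable t).comp measurable_fst)).aestronglyMeasurable
  have hYγ : ∀ t, AEStronglyMeasurable (fun p : E × E => Y t p.2) γ := fun t =>
    (((hY.measurable t).comp measurable_snd)).aestronglyMeasurable
  obtain ⟨C₁, hC₁0, hC₁⟩ := hX.bound T
  obtain ⟨C₂, hC₂0, hC₂⟩ := hY.bound T
  set h0 : ℝ := ∫ p, ‖p.1 - p.2‖ ∂γ with hh0
  have hh0n : 0 ≤ h0 := integral_nonneg fun _ => norm_nonneg _
  set H : ℝ → ℝ := fun t => ∫ p, ‖X t p.1 - Y t p.2‖ ∂γ with hH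
  have hdom : Integrable (fun p : E × E => C₁ * (1 + ‖p.1‖) + C₂ * (1 + ‖p.2‖)) γ :=
    (((integrable_const _).add hfst).const_mul C₁).add
      (((integrable_const _).add hsnd).const_mul C₂)
  have hbd : ∀ t, |t| ≤ T → ∀ p : E × E,
      ‖X t p.1 - Y t p.2‖ ≤ C₁ * (1 + ‖p.1‖) + C₂ * (1 + ‖p.2‖) := fun t ht p =>
    (norm_sub_le _ _).trans (add_le_add (hC₁ t ht _) (hC₂ t ht _))
  have hInt : ∀ t, |t| ≤ T → Integrable (fun p : E × E => ‖X t p.1 - Y t p.2‖) γ :=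
    fun t ht => hdom.mono' ((hXγ t).sub (hYγ t)).norm
      (ae_of_all _ fun p => by rw [norm_norm]; exact hbd t ht p)
  have hd : Integrable (fun p : E × E => ‖p.1 - p.2‖) γ := by
    have := hInt 0 (by simpa using hT)
    simpa only [hX.zero, hY.zero] using this
  have hKX : ∀ t, |t| ≤ T → ∀ z, Integrable (fun p : E × E => K (z, X t p.1)) γ := by
    intro t ht z
    have hg : Integrable (fun p : E × E => L * (‖z‖ + C₁ * (1 + ‖p.1‖))) γ :=
      ((integrable_const _).add (((integrable_const _).add hfst).const_mul C₁)).const_mul L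
    refine hg.mono' ?_ (ae_of_all _ fun p => ?_)
    · exact (h.continuous.comp (continuous_const.prodMk continuous_id)).comp_aestronglyMeasurable
        (hXγ t)
    · exact (h.norm_le _ _).trans
        (mul_le_mul_of_nonneg_left (add_le_add le_rfl (hC₁ t ht p.1)) hL)
  have hKY : ∀ t, |t| ≤ T → ∀ z, Integrable (fun p : E × E => K (z, Y t p.2)) γ := by
    intro t ht z
    have hg : Integrable (fun p : E × E => L * (‖z‖ + C₂ * (1 + ‖p.2‖))) γ :=
      ((integrable_const _).add (((integrable_const _).add hsnd).const_mul C₂)).const_mul L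
    refine hg.mono' ?_ (ae_of_all _ fun p => ?_)
    · exact (h.continuous.comp (continuous_const.prodMk continuous_id)).comp_aestronglyMeasurable
        (hYγ t)
    · exact (h.norm_le _ _).trans
        (mul_le_mul_of_nonneg_left (add_le_add le_rfl (hC₂ t ht p.2)) hL)
  have hcont : ∀ z, Continuous fun w => K (z, w) := fun z =>
    h.continuous.comp (continuous_const.prodMk continuous_id)
  have hveq1 : ∀ t z, ∫ ζ', K (z, X t ζ') ∂μ = ∫ p, K (z, X t p.1) ∂γ := by
    intro t z
    rw [← hγ1, integral_map measurable_fst.aemeasurable]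
    exact ((hcont z).measurable.comp (hX.measurable t)).aestronglyMeasurable
  have hveq2 : ∀ t z, ∫ ζ', K (z, Y t ζ') ∂ν = ∫ p, K (z, Y t p.2) ∂γ := by
    intro t z
    rw [← hγ2, integral_map measurable_snd.aemeasurable]
    exact ((hcont z).measurable.comp (hY.measurable t)).aestronglyMeasurable
  have hvel : ∀ t, |t| ≤ T → ∀ x y,
      ‖(∫ ζ', K (X t x, X t ζ') ∂μ) - ∫ ζ', K (Y t y, Y t ζ') ∂ν‖ ≤
        L * ‖X t x - Y t y‖ + L * H t := by
    intro t ht x y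
    rw [hveq1, hveq2, ← integral_sub (hKX t ht _) (hKY t ht _)]
    have hg : Integrable (fun p : E × E => L * (‖X t x - Y t y‖ + ‖X t p.1 - Y t p.2‖)) γ :=
      ((integrable_const _).add (hInt t ht)).const_mul L
    refine (norm_integral_le_of_norm_le hg (ae_of_all _ fun p => h.lip _ _ _ _)).trans ?_
    rw [integral_const_mul, integral_add (integrable_const _) (hInt t ht)]
    simp [hH, mul_add]
  -- one step of the iteration
  have hstep : ∀ B : ℝ, (∀ t, 0 ≤ t → t ≤ T → H t ≤ B * exp (2 * L * t)) →
      ∀ t, 0 ≤ t → t ≤ T → H t ≤ exp (L * t) * h0 + B * (exp (2 * L * t) - exp (L * t)) := by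
    intro B hB t ht0 htT
    have hpt : ∀ p : E × E, ‖X t p.1 - Y t p.2‖ ≤
        exp (L * t) * ‖p.1 - p.2‖ + B * (exp (2 * L * t) - exp (L * t)) := by
      intro p
      refine norm_le_of_norm_deriv_le (L := L) (T := T) (r := fun s => L * (B * exp (2 * L * s)))
        (w := fun s => X s p.1 - Y s p.2)
        (β := fun s => exp (L * s) * ‖p.1 - p.2‖ + B * (exp (2 * L * s) - exp (L * s)))
        (fun s => (hX.hasDerivAt s p.1).sub (hY.hasDerivAt s p.2)) ?_ ?_ ?_ ht0 htT
      · intro s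
        have e1 : HasDerivAt (fun s => exp (L * s)) (exp (L * s) * L) s := by
          simpa using ((hasDerivAt_id s).const_mul L).exp
        have e2 : HasDerivAt (fun s => exp (2 * L * s)) (exp (2 * L * s) * (2 * L)) s := by
          simpa using ((hasDerivAt_id s).const_mul (2 * L)).exp
        refine ((e1.mul_const ‖p.1 - p.2‖).add ((e2.sub e1).const_mul B)).congr_deriv ?_
        ring
      · simp [hX.zero, hY.zero]
      · intro s hs0 hsT
        refine (hvel s (by rw [abs_of_nonneg hs0]; exact hsT.le) _ _).trans ?_
        gcongr
        exact hB s hs0 hsT.le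
    have := integral_mono (hInt t (by rwa [abs_of_nonneg ht0]))
      ((hd.const_mul _).add (integrable_const _)) hpt
    simp only [Pi.add_apply] at this
    rw [integral_add (hd.const_mul _) (integrable_const _), integral_const_mul] at this
    simpa using this
  set B₀ : ℝ := h0 + ∫ p, (C₁ * (1 + ‖p.1‖) + C₂ * (1 + ‖p.2‖)) ∂γ with hB₀
  have hI0 : 0 ≤ ∫ p : E × E, (C₁ * (1 + ‖p.1‖) + C₂ * (1 + ‖p.2‖)) ∂γ :=
    integral_nonneg fun p => by positivity
  set ρ : ℝ := 1 - exp (-(L * T)) with hρ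
  have hρ0 : 0 ≤ ρ := by
    have : exp (-(L * T)) ≤ 1 := exp_le_one_iff.2 (by nlinarith)
    linarith
  have hρ1 : ρ < 1 := by have := exp_pos (-(L * T)); linarith
  have hiter : ∀ n : ℕ, ∀ t, 0 ≤ t → t ≤ T →
      H t ≤ (h0 + (B₀ - h0) * ρ ^ n) * exp (2 * L * t) := by
    intro n
    induction n with
    | zero =>
      intro t ht0 htT
      have h1 : H t ≤ B₀ := by
        have := integral_mono (hInt t (by rwa [abs_of_nonneg ht0])) hdom
          (hbd t (by rwa [abs_of_nonneg ht0]))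
        simp only [hB₀]; simp only [hH]; linarith
      have h2 : 1 ≤ exp (2 * L * t) := one_le_exp (by positivity)
      have h3 : 0 ≤ B₀ := by linarith
      simp only [pow_zero, mul_one]
      nlinarith
    | succ n ih =>
      intro t ht0 htT
      refine (hstep _ ih t ht0 htT).trans ?_
      set c := (B₀ - h0) * ρ ^ n with hc
      have hc0 : 0 ≤ c := mul_nonneg (by linarith) (pow_nonneg hρ0 n)
      have e1 : exp (2 * L * t) = exp (L * t) * exp (L * t) := by rw [← exp_add]; ring_nf
      have e2 : exp (L * t) = exp (2 * L * t) * exp (-(L * t)) := by rw [← exp_add]; ring_nf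
      have e3 : exp (-(L * T)) ≤ exp (-(L * t)) := exp_le_exp.2 (by nlinarith)
      have e4 : exp (2 * L * t) * exp (-(L * T)) ≤ exp (L * t) := by
        rw [e2]; exact mul_le_mul_of_nonneg_left e3 (exp_pos _).le
      have : (B₀ - h0) * ρ ^ (n + 1) = c * ρ := by rw [hc]; ring
      rw [this, hρ]
      nlinarith [mul_le_mul_of_nonneg_left e4 hc0]
  have hlim : Tendsto (fun n : ℕ => (h0 + (B₀ - h0) * ρ ^ n) * exp (2 * L * T)) atTop
      (𝓝 ((h0 + (B₀ - h0) * 0) * exp (2 * L * T))) :=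
    (((tendsto_pow_atTop_nhds_zero_of_lt_one hρ0 hρ1).const_mul _).const_add _).mul_const _
  have := ge_of_tendsto' hlim fun n => hiter n T hT le_rfl
  simp only [mul_zero, add_zero] at this
  rwa [mul_comm] at this

/-- **Dobrushin's estimate**. -/
theorem dobrushin_estimate {X Y : ℝ → E → E} (h : IsInteractionKernel K L)
    (hX : IsMeanFieldFlow K μ X) (hY : IsMeanFieldFlow K ν Y)
    {γ : Measure (E × E)} [IsProbabilityMeasure γ]
    (hγ1 : γ.map Prod.fst = μ) (hγ2 : γ.map Prod.snd = ν)
    (hμ : Integrable (fun z => ‖z‖) μ) (hν : Integrable (fun z => ‖z‖) ν) (t : ℝ) :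
    ∫ p, ‖X t p.1 - Y t p.2‖ ∂γ ≤ exp (2 * L * |t|) * ∫ p, ‖p.1 - p.2‖ ∂γ := by
  rcases le_total 0 t with ht | ht
  · rw [abs_of_nonneg ht]
    exact dobrushin_estimate_nonneg h hX hY hγ1 hγ2 hμ hν ht
  · rw [abs_of_nonpos ht]
    have := dobrushin_estimate_nonneg h.neg hX.neg hY.neg hγ1 hγ2 hμ hν (neg_nonneg.2 ht)
    simpa only [neg_neg] using this

/-- The velocity fields of the mean field flow separate points at most exponentially. -/
lemma IsMeanFieldFlow.norm_flow_sub_le [IsProbabilityMeasure μ] {Z : ℝ → E → E}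
    (h : IsInteractionKernel K L)
    (hμ : Integrable (fun z => ‖z‖) μ) (hZ : IsMeanFieldFlow K μ Z) (s t : ℝ) (x y : E) :
    ‖Z s x - Z s y‖ ≤ exp (L * |t - s|) * ‖Z t x - Z t y‖ := by
  have hvel : ∀ t x y, ‖(∫ ζ', K (Z t x, Z t ζ') ∂μ) - ∫ ζ', K (Z t y, Z t ζ') ∂μ‖ ≤
        L * ‖Z t x - Z t y‖ := by
    intro t x y
    obtain ⟨C, hC0, hC⟩ := hZ.bound |t|
    have hi := fun z => integrable_kernel_comp h hμ (hZ.measurable t).aestronglyMeasurable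
      (hC t le_rfl) z
    rw [← integral_sub (hi _) (hi _)]
    refine (norm_integral_le_of_norm_le (integrable_const (L * ‖Z t x - Z t y‖))
      (ae_of_all _ fun ζ' => h.lip_fst _ _ _)).trans ?_
    simp
  have key : ∀ σ : ℝ, |σ| = 1 → ∀ r, 0 ≤ r →
      ‖Z (t + σ * r) x - Z (t + σ * r) y‖ ≤ exp (L * r) * ‖Z t x - Z t y‖ := by
    intro σ hσ r hr
    refine norm_le_of_norm_deriv_le (L := L) (T := r) (r := fun _ => 0)
      (w := fun r => Z (t + σ * r) x - Z (t + σ * r) y)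
      (w' := fun r => σ • ((∫ ζ', K (Z (t + σ * r) x, Z (t + σ * r) ζ') ∂μ) -
        ∫ ζ', K (Z (t + σ * r) y, Z (t + σ * r) ζ') ∂μ))
      (β := fun r => exp (L * r) * ‖Z t x - Z t y‖) ?_ ?_ ?_ ?_ hr le_rfl
    · intro r
      have hσr : HasDerivAt (fun r => t + σ * r) σ r := by
        simpa using ((hasDerivAt_id r).const_mul σ).const_add t
      exact HasDerivAt.scomp r ((hZ.hasDerivAt _ x).sub (hZ.hasDerivAt _ y)) hσr
    · intro s
      have e1 : HasDerivAt (fun s => exp (L * s)) (exp (L * s) * L) s := by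
        simpa using ((hasDerivAt_id s).const_mul L).exp
      refine (e1.mul_const ‖Z t x - Z t y‖).congr_deriv ?_
      ring
    · simp
    · intro s _ _
      rw [norm_smul, norm_eq_abs, hσ, one_mul, add_zero]
      exact hvel _ _ _
  rcases le_total t s with hts | hts
  · have := key 1 (by simp) (s - t) (by linarith)
    rw [abs_sub_comm, abs_of_nonneg (by linarith : 0 ≤ s - t)]
    simpa using this
  · have := key (-1) (by simp) (t - s) (by linarith)
    rw [abs_of_nonneg (by linarith : 0 ≤ t - s)]
    simpa using this

end MeanFieldFlow

section Empirical

variable {d : ℕ} {N : ℕ}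

lemma isProbabilityMeasure_empiricalMeasure (hN : 1 ≤ N) (z : Fin N → EuclideanSpace ℝ (Fin d)) :
    IsProbabilityMeasure (empiricalMeasure z) := by
  refine ⟨?_⟩
  have h0 : (N : ℝ≥0∞) ≠ 0 := by exact_mod_cast (by omega : N ≠ 0)
  simp [empiricalMeasure, ENNReal.inv_mul_cancel h0 (ENNReal.natCast_ne_top N)]

lemma integrable_empiricalMeasure (hN : 1 ≤ N) {F : Type*} [NormedAddCommGroup F]
    (z : Fin N → EuclideanSpace ℝ (Fin d))
    (φ : EuclideanSpace ℝ (Fin d) → F) :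
    Integrable φ (empiricalMeasure z) := by
  have h0 : (N : ℝ≥0∞) ≠ 0 := by exact_mod_cast (by omega : N ≠ 0)
  refine Integrable.smul_measure ?_ (ENNReal.inv_ne_top.2 h0)
  exact integrable_finsetSum_measure.2 fun j _ => integrable_dirac (by simp)

lemma integral_empiricalMeasure {F : Type*} [NormedAddCommGroup F] [NormedSpace ℝ F]
    [CompleteSpace F] (z : Fin N → EuclideanSpace ℝ (Fin d))
    (φ : EuclideanSpace ℝ (Fin d) → F) :
    ∫ x, φ x ∂(empiricalMeasure z) = (N : ℝ)⁻¹ • ∑ j, φ (z j) := by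
  rw [empiricalMeasure, integral_smul_measure,
    integral_finsetSum_measure fun j _ => integrable_dirac (by simp)]
  simp

lemma map_empiricalMeasure (z : Fin N → EuclideanSpace ℝ (Fin d))
    {T : EuclideanSpace ℝ (Fin d) → EuclideanSpace ℝ (Fin d)} (hT : Measurable T) :
    (empiricalMeasure z).map T = empiricalMeasure fun j => T (z j) := by
  ext s hs
  rw [Measure.map_apply hT hs]
  simp only [empiricalMeasure, Measure.smul_apply, Measure.finsetSum_apply, smul_eq_mul]
  congr 1
  refine Finset.sum_congr rfl fun j _ => ?_
  rw [Measure.dirac_apply' _ (hT hs), Measure.dirac_apply' _ hs]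
  rfl

variable {K : EuclideanSpace ℝ (Fin d) × EuclideanSpace ℝ (Fin d) → EuclideanSpace ℝ (Fin d)}
  {L : ℝ}

/-- The mean field flow of an empirical measure is the flow of the particle system. -/
lemma IsMeanFieldFlow.particle_eq (h : IsInteractionKernel K L) (hN : 1 ≤ N)
    {J : Fin N → EuclideanSpace ℝ (Fin d)} {X : ℝ → EuclideanSpace ℝ (Fin d) → _}
    (hX : IsMeanFieldFlow K (empiricalMeasure J) X)
    {Z : ℝ → Fin N → EuclideanSpace ℝ (Fin d)} (hZ0 : Z 0 = J)
    (hZ : ∀ t, HasDerivAt Z (fun i => (N : ℝ)⁻¹ • ∑ j : Fin N, K (Z t i, Z t j)) t) (t : ℝ) :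
    (fun i => X t (J i)) = Z t := by
  have hL := h.nonneg
  have hNpos : (0 : ℝ) < N := by exact_mod_cast hN
  have hX' : ∀ t, HasDerivAt (fun t i => X t (J i))
      (fun i => (N : ℝ)⁻¹ • ∑ j : Fin N, K (X t (J i), X t (J j))) t := by
    intro t
    refine hasDerivAt_pi.2 fun i => ?_
    have := hX.hasDerivAt t (J i)
    rwa [integral_empiricalMeasure] at this
  have := ODE_solution_unique_univ
    (v := fun _ (z : Fin N → EuclideanSpace ℝ (Fin d)) i => (N : ℝ)⁻¹ • ∑ j : Fin N, K (z i, z j))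
    (s := fun _ => Set.univ) (K := (L * 2).toNNReal) (t₀ := 0)
    (f := fun t i => X t (J i)) (g := Z) ?_ (fun t => ⟨hX' t, Set.mem_univ _⟩)
    (fun t => ⟨hZ t, Set.mem_univ _⟩) ?_
  · exact congrFun this t
  · intro _
    refine (LipschitzWith.of_dist_le_mul fun z w => ?_).lipschitzOnWith
    rw [dist_eq_norm, dist_eq_norm, Real.coe_toNNReal _ (by positivity), pi_norm_le_iff_of_nonneg (by positivity)]
    intro i
    simp only [Pi.sub_apply, ← smul_sub, ← Finset.sum_sub_distrib, norm_smul, norm_inv,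
      RCLike.norm_natCast]
    rw [inv_mul_le_iff₀ hNpos]
    refine (norm_sum_le_of_le (f := fun j => K (z i, z j) - K (w i, w j)) (n := fun _ => L * (‖z - w‖ + ‖z - w‖)) _
      fun j _ => ?_).trans ?_
    · refine (h.lip _ _ _ _).trans ?_
      gcongr
      · exact norm_le_pi_norm (z - w) i
      · exact norm_le_pi_norm (z - w) j
    · simp only [Finset.sum_const, Finset.card_univ, Fintype.card_fin, nsmul_eq_mul]
      refine le_of_eq ?_
      ring
  · simp [hX.zero, hZ0]

theorem distMK1_map_le (h : IsInteractionKernel K L) {μ ν : Measure (EuclideanSpace ℝ (Fin d))}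
    [IsProbabilityMeasure μ] {X Y : ℝ → EuclideanSpace ℝ (Fin d) → EuclideanSpace ℝ (Fin d)}
    (hX : IsMeanFieldFlow K μ X) (hY : IsMeanFieldFlow K ν Y)
    (hμ : Integrable (fun z => ‖z‖) μ) (hν : Integrable (fun z => ‖z‖) ν) (t : ℝ) :
    distMK1 (μ.map (X t)) (ν.map (Y t)) ≤ ENNReal.ofReal (exp (2 * L * |t|)) * distMK1 μ ν := by
  have hc0 : ENNReal.ofReal (exp (2 * L * |t|)) ≠ 0 := by
    rw [Ne, ENNReal.ofReal_eq_zero, not_le]; exact exp_pos _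
  simp only [distMK1]
  simp_rw [ENNReal.mul_iInf_of_ne hc0 ENNReal.ofReal_ne_top]
  refine le_iInf₂ fun γ hγ => ?_
  obtain ⟨hγ1, hγ2⟩ := hγ
  have hγp : IsProbabilityMeasure γ := by
    refine ⟨?_⟩
    have : (γ.map Prod.fst) Set.univ = 1 := by rw [hγ1]; exact measure_univ
    rwa [Measure.map_apply measurable_fst MeasurableSet.univ] at this
  have hXm := hX.measurable t
  have hYm := hY.measurable t
  have hm : Measurable fun p : EuclideanSpace ℝ (Fin d) × EuclideanSpace ℝ (Fin d) =>
      (X t p.1, Y t p.2) := (hXm.comp measurable_fst).prodMk (hYm.comp measurable_snd)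
  refine le_trans (iInf₂_le (γ.map fun p => (X t p.1, Y t p.2)) (And.intro ?_ ?_)) ?_
  · rw [Measure.map_map measurable_fst hm, ← hγ1, Measure.map_map hXm measurable_fst]
    rfl
  · rw [Measure.map_map measurable_snd hm, ← hγ2, Measure.map_map hYm measurable_snd]
    rfl
  · rw [lintegral_map (measurable_fst.edist measurable_snd) hm]
    have hfst : Integrable (fun p : EuclideanSpace ℝ (Fin d) × EuclideanSpace ℝ (Fin d) => ‖p.1‖)
        γ := by
      rw [← hγ1] at hμ
      exact (integrable_map_measure hμ.1 measurable_fst.aemeasurable).1 hμ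
    have hsnd : Integrable (fun p : EuclideanSpace ℝ (Fin d) × EuclideanSpace ℝ (Fin d) => ‖p.2‖)
        γ := by
      rw [← hγ2] at hν
      exact (integrable_map_measure hν.1 measurable_snd.aemeasurable).1 hν
    obtain ⟨C₁, hC₁0, hC₁⟩ := hX.bound |t|
    obtain ⟨C₂, hC₂0, hC₂⟩ := hY.bound |t|
    have hi : Integrable (fun p : EuclideanSpace ℝ (Fin d) × EuclideanSpace ℝ (Fin d) =>
        ‖X t p.1 - Y t p.2‖) γ := by
      have hdom : Integrable (fun p : EuclideanSpace ℝ (Fin d) × EuclideanSpace ℝ (Fin d) =>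
          C₁ * (1 + ‖p.1‖) + C₂ * (1 + ‖p.2‖)) γ :=
        (((integrable_const _).add hfst).const_mul C₁).add
          (((integrable_const _).add hsnd).const_mul C₂)
      refine hdom.mono' ?_ (ae_of_all _ fun p => ?_)
      · exact ((hXm.comp measurable_fst).sub (hYm.comp measurable_snd)).norm.aestronglyMeasurable
      · rw [norm_norm]
        exact (norm_sub_le _ _).trans (add_le_add (hC₁ t le_rfl _) (hC₂ t le_rfl _))
    have hd : Integrable (fun p : EuclideanSpace ℝ (Fin d) × EuclideanSpace ℝ (Fin d) =>
        ‖p.1 - p.2‖) γ := (hfst.add hsnd).mono'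
          (measurable_fst.sub measurable_snd).norm.aestronglyMeasurable
          (ae_of_all _ fun p => by rw [norm_norm]; exact norm_sub_le _ _)
    simp_rw [edist_dist, dist_eq_norm]
    rw [← ofReal_integral_eq_lintegral_ofReal hi (ae_of_all _ fun _ => norm_nonneg _),
      ← ofReal_integral_eq_lintegral_ofReal hd (ae_of_all _ fun _ => norm_nonneg _),
      ← ENNReal.ofReal_mul (exp_pos _).le]
    exact ENNReal.ofReal_le_ofReal (dobrushin_estimate h hX hY hγ1 hγ2 hμ hν t)

end Empirical

section Density

variable {E : Type*} [NormedAddCommGroup E] [NormedSpace ℝ E] [FiniteDimensional ℝ E]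
  [MeasureSpace E] [BorelSpace E] [(volume : Measure E).IsAddHaarMeasure]

lemma AntilipschitzWith.volume_preimage_le {k : ℝ≥0} {T : E → E} (hT : AntilipschitzWith k T)
    (s : Set E) : volume (T ⁻¹' s) ≤ (k : ℝ≥0∞) ^ Module.finrank ℝ E * volume s := by
  have h := hT.hausdorffMeasure_preimage_le (d := Module.finrank ℝ E) (Nat.cast_nonneg _) s
  rw [Measure.isAddLeftInvariant_eq_smul (volume : Measure E)
    (Measure.hausdorffMeasure (Module.finrank ℝ E))]
  simp only [Measure.smul_apply, ENNReal.smul_def, smul_eq_mul]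
  rw [ENNReal.rpow_natCast] at h
  calc _ ≤ _ := mul_le_mul_right h _
    _ = _ := by ring

variable {K : E × E → E} {L : ℝ} {μ : Measure E} [IsProbabilityMeasure μ] {Z : ℝ → E → E}

/-- Every point is reached by a characteristic. -/
lemma IsMeanFieldFlow.surjective (h : IsInteractionKernel K L)
    (hμ : Integrable (fun z => ‖z‖) μ) (hZ : IsMeanFieldFlow K μ Z) (s : ℝ) :
    Function.Surjective (Z s) := by
  intro z
  have hL := h.nonneg
  let F : ℝ → E → E := fun t z => ∫ ζ', K (z, Z t ζ') ∂μ
  have hm : ∀ t z, AEStronglyMeasurable (fun ζ' => K (z, Z t ζ')) μ := fun t z =>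
    ((h.continuous.comp (continuous_const.prodMk continuous_id)).comp
      (hZ.continuous.comp (continuous_const.prodMk continuous_id))).aestronglyMeasurable
  have hi : ∀ t z, Integrable (fun ζ' => K (z, Z t ζ')) μ := fun t z => by
    obtain ⟨C, hC0, hC⟩ := hZ.bound |t|
    exact integrable_kernel_comp h hμ (hZ.measurable t).aestronglyMeasurable
      (hC t le_rfl) z
  have hFc : ∀ z, Continuous fun t => F t z := by
    intro z
    refine continuous_iff_continuousAt.2 fun t => ?_
    obtain ⟨C, hC0, hC⟩ := hZ.bound (|t| + 1)
    have hg : Integrable (fun ζ' => L * (‖z‖ + C * (1 + ‖ζ'‖))) μ :=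
      ((integrable_const _).add (((integrable_const _).add hμ).const_mul C)).const_mul L
    have hev : ∀ᶠ s in 𝓝 t, |s| ≤ |t| + 1 :=
      (continuous_abs.continuousAt.eventually_lt continuousAt_const
        (by linarith)).mono fun s hs => hs.le
    refine continuousAt_of_dominated (Eventually.of_forall fun s => hm s z) ?_ hg ?_
    · filter_upwards [hev] with s hs
      refine ae_of_all _ fun ζ' => (h.norm_le _ _).trans
        (mul_le_mul_of_nonneg_left (add_le_add le_rfl (hC s hs ζ')) hL)
    · refine ae_of_all _ fun ζ' => Continuous.continuousAt ?_
      exact h.continuous.comp (continuous_const.prodMk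
        (hZ.continuous.comp (continuous_id.prodMk continuous_const)))
  have hFl : ∀ t, LipschitzWith L.toNNReal (F t) := by
    intro t
    refine LipschitzWith.of_dist_le_mul fun x y => ?_
    rw [dist_eq_norm, dist_eq_norm, Real.coe_toNNReal _ hL]
    simp only [F]
    rw [← integral_sub (hi _ _) (hi _ _)]
    refine (norm_integral_le_of_norm_le (integrable_const (L * ‖x - y‖))
      (ae_of_all _ fun ζ' => h.lip_fst _ _ _)).trans ?_
    simp
  obtain ⟨α, hα0, hα⟩ := exists_global_solution_of_lipschitz hFc hFl s z
  have := ODE_solution_unique_univ (v := F) (s := fun _ => Set.univ) (K := L.toNNReal)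
    (f := α) (g := fun t => Z t (α 0)) (t₀ := 0) (fun t => (hFl t).lipschitzOnWith)
    (fun t => ⟨hα t, Set.mem_univ _⟩) (fun t => ⟨hZ.hasDerivAt t _, Set.mem_univ _⟩)
    (hZ.zero _).symm
  exact ⟨α 0, (congrFun this s).symm.trans hα0⟩

lemma IsMeanFieldFlow.antilipschitz [SecondCountableTopology E] (h : IsInteractionKernel K L)
    (hμ : Integrable (fun z => ‖z‖) μ) (hZ : IsMeanFieldFlow K μ Z) (t : ℝ) :
    AntilipschitzWith (exp (L * |t|)).toNNReal (Z t) := by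
  refine AntilipschitzWith.of_le_mul_dist fun x y => ?_
  have := hZ.norm_flow_sub_le h hμ 0 t x y
  rw [Real.coe_toNNReal _ (exp_pos _).le, dist_eq_norm, dist_eq_norm]
  simpa [hZ.zero] using this

lemma IsMeanFieldFlow.absolutelyContinuous (h : IsInteractionKernel K L)
    (hμ : Integrable (fun z => ‖z‖) μ) (hμv : μ ≪ volume) (hZ : IsMeanFieldFlow K μ Z) (t : ℝ) :
    μ.map (Z t) ≪ volume := by
  refine Measure.AbsolutelyContinuous.mk fun s hs h0 => ?_
  rw [Measure.map_apply (hZ.measurable t) hs]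
  refine hμv ?_
  have := (hZ.antilipschitz h hμ t).volume_preimage_le s
  rw [h0, mul_zero] at this
  exact le_antisymm this bot_le

/-- The density at time `t` of the measure transported by the mean field flow. -/
def flowDensity (μ : Measure E) (Z : ℝ → E → E) (t : ℝ) (z : E) : ℝ :=
  ((μ.map (Z t)).rnDeriv volume z).toReal

lemma flowDensity_nonneg (t : ℝ) (z : E) : 0 ≤ flowDensity μ Z t z := ENNReal.toReal_nonneg

lemma integrable_flowDensity (t : ℝ) : Integrable (flowDensity μ Z t) :=
  Measure.integrable_toReal_rnDeriv

lemma IsMeanFieldFlow.withDensity_flowDensity (h : IsInteractionKernel K L)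
    (hμ : Integrable (fun z => ‖z‖) μ) (hμv : μ ≪ volume) (hZ : IsMeanFieldFlow K μ Z) (t : ℝ) :
    volume.withDensity (fun z => ENNReal.ofReal (flowDensity μ Z t z)) = μ.map (Z t) := by
  rw [← Measure.withDensity_rnDeriv_eq _ _ (hZ.absolutelyContinuous h hμ hμv t)]
  refine withDensity_congr_ae ?_
  filter_upwards [(μ.map (Z t)).rnDeriv_lt_top volume] with z hz
  rw [flowDensity, ENNReal.ofReal_toReal hz.ne]

lemma IsMeanFieldFlow.integral_flowDensity_smul (h : IsInteractionKernel K L)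
    (hμ : Integrable (fun z => ‖z‖) μ) (hμv : μ ≪ volume) (hZ : IsMeanFieldFlow K μ Z) (t : ℝ)
    {F : Type*} [NormedAddCommGroup F] [NormedSpace ℝ F] {φ : E → F} (hφ : StronglyMeasurable φ) :
    ∫ z, flowDensity μ Z t z • φ z = ∫ ζ, φ (Z t ζ) ∂μ := by
  have := Measure.isProbabilityMeasure_map (μ := μ) (hZ.measurable t).aemeasurable
  rw [← integral_map (hZ.measurable t).aemeasurable hφ.aestronglyMeasurable]
  exact integral_rnDeriv_smul (hZ.absolutelyContinuous h hμ hμv t)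

/-- The density of the transported measure is a weak solution of the mean field equation. -/
lemma IsMeanFieldFlow.hasDerivAt_integral_flowDensity (h : IsInteractionKernel K L)
    (hμ : Integrable (fun z => ‖z‖) μ) (hμv : μ ≪ volume) (hZ : IsMeanFieldFlow K μ Z)
    {φ : E → ℝ} (hφ : ContDiff ℝ 1 φ) (hb : ∃ C : ℝ, ∀ z, |φ z| ≤ C)
    (hb' : ∃ C : ℝ, ∀ z, ‖fderiv ℝ φ z‖ ≤ C) (t : ℝ) :
    HasDerivAt (fun s => ∫ z, φ z * flowDensity μ Z s z)
      (∫ z, fderiv ℝ φ z (∫ z', flowDensity μ Z t z' • K (z, z')) * flowDensity μ Z t z) t := by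
  have hL := h.nonneg
  obtain ⟨C₀, hC₀⟩ := hb
  obtain ⟨C₁, hC₁⟩ := hb'
  have hC₁0 : 0 ≤ C₁ := (norm_nonneg _).trans (hC₁ 0)
  have hKm : ∀ z, StronglyMeasurable fun z' => K (z, z') := fun z =>
    (h.continuous.comp (continuous_const.prodMk continuous_id)).stronglyMeasurable
  obtain ⟨C, hC0, hC⟩ := hZ.bound (|t| + 1)
  set M := ∫ ζ, ‖ζ‖ ∂μ with hM
  let V : ℝ → E → E := fun t z => ∫ ζ', K (z, Z t ζ') ∂μ
  have hVbd : ∀ s, |s| ≤ |t| + 1 → ∀ z, ‖V s z‖ ≤ L * (‖z‖ + C * (1 + M)) := by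
    intro s hs z
    have hg : Integrable (fun ζ' => L * (‖z‖ + C * (1 + ‖ζ'‖))) μ :=
      ((integrable_const _).add (((integrable_const _).add hμ).const_mul C)).const_mul L
    have hg1 : Integrable (fun ζ' => C * (1 + ‖ζ'‖)) μ :=
      ((integrable_const _).add hμ).const_mul C
    refine (norm_integral_le_of_norm_le hg (ae_of_all _ fun ζ' => (h.norm_le _ _).trans
        (mul_le_mul_of_nonneg_left (add_le_add le_rfl (hC s hs ζ')) hL))).trans ?_
    rw [integral_const_mul, integral_add (integrable_const _) hg1, integral_const_mul,
      integral_add (integrable_const _) hμ]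
    simp [hM]
  have hVcont : Continuous (V t) := by
    refine (LipschitzWith.of_dist_le_mul (K := L.toNNReal) fun x y => ?_).continuous
    rw [dist_eq_norm, dist_eq_norm, Real.coe_toNNReal _ hL]
    have hi := fun z => integrable_kernel_comp h hμ (hZ.measurable t).aestronglyMeasurable
      (hC t (by linarith)) z
    simp only [V]
    rw [← integral_sub (hi _) (hi _)]
    refine (norm_integral_le_of_norm_le (integrable_const (L * ‖x - y‖))
      (ae_of_all _ fun ζ' => h.lip_fst _ _ _)).trans ?_
    simp
  have e1 : ∀ s, ∫ z, φ z * flowDensity μ Z s z = ∫ ζ, φ (Z s ζ) ∂μ := by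
    intro s
    rw [← hZ.integral_flowDensity_smul h hμ hμv s hφ.continuous.stronglyMeasurable]
    simp only [smul_eq_mul, mul_comm]
  have e2 : ∫ z, fderiv ℝ φ z (∫ z', flowDensity μ Z t z' • K (z, z')) * flowDensity μ Z t z =
      ∫ ζ, fderiv ℝ φ (Z t ζ) (V t (Z t ζ)) ∂μ := by
    have hc : Continuous fun z => fderiv ℝ φ z (V t z) :=
      (hφ.continuous_fderiv one_ne_zero).clm_apply hVcont
    rw [← hZ.integral_flowDensity_smul h hμ hμv t hc.stronglyMeasurable]
    refine integral_congr_ae (ae_of_all _ fun z => ?_)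
    simp only [hZ.integral_flowDensity_smul h hμ hμv t (hKm z), smul_eq_mul, mul_comm]
    rfl
  simp_rw [e1]
  rw [e2]
  have hZc : ∀ s, Continuous (Z s) := fun s =>
    hZ.continuous.comp (continuous_const.prodMk continuous_id)
  refine (hasDerivAt_integral_of_dominated_loc_of_deriv_le (s := Metric.ball t 1)
    (F := fun s ζ => φ (Z s ζ)) (F' := fun s ζ => fderiv ℝ φ (Z s ζ) (V s (Z s ζ)))
    (bound := fun ζ => C₁ * (L * (C * (1 + ‖ζ‖) + C * (1 + M))))
    (Metric.ball_mem_nhds t one_pos)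
    (Eventually.of_forall fun s => (hφ.continuous.comp (hZc s)).aestronglyMeasurable) ?_ ?_ ?_ ?_
    ?_).2
  · refine (integrable_const C₀).mono' (hφ.continuous.comp (hZc t)).aestronglyMeasurable
      (ae_of_all _ fun ζ => hC₀ _)
  · exact (((hφ.continuous_fderiv one_ne_zero).comp (hZc t)).clm_apply
      (hVcont.comp (hZc t))).aestronglyMeasurable
  · refine ae_of_all _ fun ζ s hs => ?_
    have hs' : |s| ≤ |t| + 1 := by
      have h1 : |s - t| < 1 := by simpa [dist_eq_norm] using hs
      have h2 := abs_sub_abs_le_abs_sub s t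
      linarith
    refine (ContinuousLinearMap.le_opNorm _ _).trans ?_
    refine mul_le_mul (hC₁ _) ((hVbd s hs' _).trans ?_) (norm_nonneg _) hC₁0
    have := hC s hs' ζ
    gcongr
  · have hg : Integrable (fun ζ => C * (1 + ‖ζ‖)) μ := ((integrable_const _).add hμ).const_mul C
    exact ((hg.add (integrable_const _)).const_mul L).const_mul C₁
  · refine ae_of_all _ fun ζ s _ => ?_
    exact ((hφ.differentiable one_ne_zero (Z s ζ)).hasFDerivAt).comp_hasDerivAt s (hZ.hasDerivAt s ζ)

end Density

section Continuity

lemma abs_integral_sub_le_of_measure_le {α : Type*} [MeasurableSpace α] {μ ν : Measure α} {c : ℝ}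
    (hc : 1 ≤ c) (h1 : ν ≤ ENNReal.ofReal c • μ) (h2 : μ ≤ ENNReal.ofReal c • ν) {F : α → ℝ}
    (hF : Integrable F μ) : |∫ x, F x ∂ν - ∫ x, F x ∂μ| ≤ (c - 1) * ∫ x, |F x| ∂μ := by
  have hc0 : 0 ≤ c := by linarith
  have hpos : ∀ G : α → ℝ, (∀ x, 0 ≤ G x) → Integrable G μ →
      Integrable G ν ∧ |∫ x, G x ∂ν - ∫ x, G x ∂μ| ≤ (c - 1) * ∫ x, G x ∂μ := by
    intro G hG hGi
    have hGν : Integrable G ν :=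
      (hGi.smul_measure (ENNReal.ofReal_ne_top (r := c))).mono_measure h1
    have i1 := integral_mono_measure h1 (ae_of_all _ hG)
      (hGi.smul_measure (ENNReal.ofReal_ne_top (r := c)))
    have i2 := integral_mono_measure h2 (ae_of_all _ hG)
      (hGν.smul_measure (ENNReal.ofReal_ne_top (r := c)))
    rw [integral_smul_measure, ENNReal.toReal_ofReal hc0, smul_eq_mul] at i1 i2
    refine ⟨hGν, ?_⟩
    have p1 : 0 ≤ ∫ x, G x ∂μ := integral_nonneg hG
    have p2 : 0 ≤ ∫ x, G x ∂ν := integral_nonneg hG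
    rw [abs_le]
    constructor
    · rcases le_total (∫ x, G x ∂ν) (∫ x, G x ∂μ) with h | h <;> nlinarith
    · linarith
  have hp := hpos (fun x => max (F x) 0) (fun x => le_max_right _ _) hF.pos_part
  have hn := hpos (fun x => max (- F x) 0) (fun x => le_max_right _ _) hF.neg_part
  have e1 : ∀ x, F x = max (F x) 0 - max (- F x) 0 := fun x => by
    rcases le_total (F x) 0 with h | h
    · rw [max_eq_right h, max_eq_left (by linarith)]; ring
    · rw [max_eq_left h, max_eq_right (by linarith)]; ring
  have e2 : ∀ x, |F x| = max (F x) 0 + max (- F x) 0 := fun x => by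
    rcases le_total (F x) 0 with h | h
    · rw [max_eq_right h, max_eq_left (by linarith), abs_of_nonpos h]; ring
    · rw [max_eq_left h, max_eq_right (by linarith), abs_of_nonneg h]; ring
  have a1 : ∫ x, F x ∂μ = ∫ x, max (F x) 0 ∂μ - ∫ x, max (- F x) 0 ∂μ := by
    rw [← integral_sub hF.pos_part hF.neg_part]
    exact integral_congr_ae (ae_of_all _ e1)
  have a2 : ∫ x, F x ∂ν = ∫ x, max (F x) 0 ∂ν - ∫ x, max (- F x) 0 ∂ν := by
    rw [← integral_sub hp.1 hn.1]
    exact integral_congr_ae (ae_of_all _ e1)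
  have a3 : ∫ x, |F x| ∂μ = ∫ x, max (F x) 0 ∂μ + ∫ x, max (- F x) 0 ∂μ := by
    rw [← integral_add hF.pos_part hF.neg_part]
    exact integral_congr_ae (ae_of_all _ e2)
  rw [a1, a2, a3]
  have b1 := hp.2
  have b2 := hn.2
  rw [abs_le] at b1 b2 ⊢
  constructor <;> linarith [b1.1, b1.2, b2.1, b2.2]

variable {E : Type*} [NormedAddCommGroup E] [NormedSpace ℝ E] [FiniteDimensional ℝ E]
  [MeasureSpace E] [BorelSpace E] [(volume : Measure E).IsAddHaarMeasure]

variable {K : E × E → E} {L : ℝ} {μ : Measure E} [IsProbabilityMeasure μ] {Z : ℝ → E → E}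

lemma IsMeanFieldFlow.tendsto_integral_abs_flowDensity_sub (h : IsInteractionKernel K L)
    (hμ : Integrable (fun z => ‖z‖) μ) (hμv : μ ≪ volume) (hZ : IsMeanFieldFlow K μ Z) (s : ℝ) :
    Tendsto (fun t => ∫ z, |flowDensity μ Z t z - flowDensity μ Z s z|) (𝓝 s) (𝓝 0) := by
  have hL := h.nonneg
  have hinj : ∀ t, Function.Injective (Z t) := fun t => (hZ.antilipschitz h hμ t).injective
  let e : ℝ → E ≃ E := fun t => Equiv.ofBijective (Z t) ⟨hinj t, hZ.surjective h hμ t⟩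
  have he : ∀ t ζ, (e t).symm (Z t ζ) = ζ := fun t ζ => (e t).symm_apply_apply ζ
  have he' : ∀ t z, Z t ((e t).symm z) = z := fun t z => (e t).apply_symm_apply z
  let Φ : ℝ → ℝ → E → E := fun t s z => Z t ((e s).symm z)
  have hΦZ : ∀ t s ζ, Φ t s (Z s ζ) = Z t ζ := fun t s ζ => by simp only [Φ, he]
  have hΦΦ : ∀ t s z, Φ s t (Φ t s z) = z := fun t s z => by simp only [Φ, he, he']
  have hΦlip : ∀ t s x y, ‖Φ t s x - Φ t s y‖ ≤ exp (L * |t - s|) * ‖x - y‖ := by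
    intro t s x y
    have := hZ.norm_flow_sub_le h hμ t s ((e s).symm x) ((e s).symm y)
    rwa [he', he', abs_sub_comm] at this
  have hΦL : ∀ t s, LipschitzWith (exp (L * |t - s|)).toNNReal (Φ t s) := fun t s =>
    LipschitzWith.of_dist_le_mul fun x y => by
      rw [dist_eq_norm, dist_eq_norm, Real.coe_toNNReal _ (exp_pos _).le]
      exact hΦlip t s x y
  have hΦA : ∀ t s, AntilipschitzWith (exp (L * |t - s|)).toNNReal (Φ t s) := fun t s =>
    AntilipschitzWith.of_le_mul_dist fun x y => by
      rw [dist_eq_norm, dist_eq_norm, Real.coe_toNNReal _ (exp_pos _).le]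
      have := hΦlip s t (Φ t s x) (Φ t s y)
      rwa [hΦΦ, hΦΦ, abs_sub_comm] at this
  let c : ℝ → ℝ := fun t => exp (L * |t - s|) ^ Module.finrank ℝ E
  have hc1 : ∀ t, 1 ≤ c t := fun t => one_le_pow₀ (one_le_exp (by positivity))
  have hcc : Continuous c := by
    simp only [c]
    fun_prop
  have hcs : c s = 1 := by simp [c]
  have hvol : ∀ t s (A : Set E), volume (Φ t s ⁻¹' A) ≤
      ENNReal.ofReal (exp (L * |t - s|) ^ Module.finrank ℝ E) * volume A := by
    intro t s A
    have := (hΦA t s).volume_preimage_le A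
    rwa [ENNReal.ofReal_pow (exp_pos _).le]
  set f := flowDensity μ Z with hf
  have hfi : ∀ t, Integrable (f t) := fun t => integrable_flowDensity t
  have key : ∀ g : E → ℝ, Integrable g → Continuous g → ∀ t,
      Integrable (fun z => g (Φ s t z)) → ∫ z, |f t z - f s z| ≤ (2 * ∫ z, |f s z - g z|) +
        ((c t - 1) * ∫ z, |g (Φ s t z)|) + ∫ z, |g (Φ s t z) - g z| := by
    intro g hg hgc t hgΦ
    obtain ⟨ft, hftm, hft⟩ : ∃ u : E → ℝ, StronglyMeasurable u ∧ f t - f s =ᵐ[volume] u :=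
      ((hfi t).sub (hfi s)).1
    let φ : E → ℝ := fun z => if 0 ≤ ft z then 1 else -1
    have hφm : Measurable φ := Measurable.ite (measurableSet_le measurable_const hftm.measurable)
      measurable_const measurable_const
    have hφ1 : ∀ z, ‖φ z‖ ≤ 1 := fun z => by simp only [φ]; split_ifs <;> simp
    have hφ1' : ∀ z, |φ z| ≤ 1 := hφ1
    have hΦm : Measurable (Φ t s) := (hΦL t s).continuous.measurable
    have hφΦ : Measurable fun z => φ (Φ t s z) := hφm.comp hΦm
    have hmul : ∀ u : E → ℝ, Integrable u → ∀ v : E → ℝ, Measurable v → (∀ z, ‖v z‖ ≤ 1) →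
        Integrable (fun z => u z * v z) := fun u hu v hv hv1 =>
      hu.norm.mono' (hu.1.mul hv.aestronglyMeasurable) (ae_of_all _ fun z => by
      rw [norm_mul]
      exact mul_le_of_le_one_right (norm_nonneg _) (hv1 z))
    have s1 : ∫ z, |f t z - f s z| = (∫ z, f t z * φ z) - ∫ z, f s z * φ z := by
      rw [← integral_sub (hmul _ (hfi t) _ hφm hφ1) (hmul _ (hfi s) _ hφm hφ1)]
      refine integral_congr_ae ?_
      filter_upwards [hft] with z hz
      simp only [Pi.sub_apply] at hz
      rw [← sub_mul, hz]
      simp only [φ]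
      split_ifs with h0
      · rw [abs_of_nonneg h0, mul_one]
      · rw [abs_of_neg (not_le.1 h0)]; ring
    have s2 : ∫ z, f t z * φ z = ∫ z, f s z * φ (Φ t s z) := by
      have a1 := hZ.integral_flowDensity_smul h hμ hμv t hφm.stronglyMeasurable
      have a2 := hZ.integral_flowDensity_smul h hμ hμv s hφΦ.stronglyMeasurable
      simp only [smul_eq_mul] at a1 a2
      rw [a1, a2]
      simp only [hΦZ]
    have s3 : (∫ z, f s z * φ (Φ t s z)) - ∫ z, f s z * φ z =
        (∫ z, (f s z - g z) * (φ (Φ t s z) - φ z)) +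
          ((∫ z, g z * φ (Φ t s z)) - ∫ z, g z * φ z) := by
      rw [← integral_sub (hmul _ (hfi s) _ hφΦ fun z => hφ1 _) (hmul _ (hfi s) _ hφm hφ1),
        ← integral_sub (hmul _ hg _ hφΦ fun z => hφ1 _) (hmul _ hg _ hφm hφ1), ← integral_add]
      · refine integral_congr_ae (ae_of_all _ fun z => ?_)
        simp only
        ring
      · simp only [mul_sub]
        exact (hmul _ ((hfi s).sub hg) _ hφΦ fun z => hφ1 _).sub
          (hmul _ ((hfi s).sub hg) _ hφm hφ1)
      · exact (hmul _ hg _ hφΦ fun z => hφ1 _).sub (hmul _ hg _ hφm hφ1)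
    have s4 : ∫ z, (f s z - g z) * (φ (Φ t s z) - φ z) ≤ 2 * ∫ z, |f s z - g z| := by
      rw [← integral_const_mul]
      refine (le_abs_self _).trans ?_
      rw [← norm_eq_abs]
      refine norm_integral_le_of_norm_le (((hfi s).sub hg).abs.const_mul 2)
        (ae_of_all _ fun z => ?_)
      rw [norm_mul, mul_comm]
      refine mul_le_mul ((norm_sub_le _ _).trans ?_) le_rfl (norm_nonneg _) zero_le_two
      linarith [hφ1 (Φ t s z), hφ1 z]
    have s5 : ∫ z, g z * φ (Φ t s z) = ∫ z, g (Φ s t z) * φ z ∂(volume.map (Φ t s)) := by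
      rw [integral_map hΦm.aemeasurable]
      · simp only [hΦΦ]
      · exact ((hgc.comp (hΦL s t).continuous).measurable.mul hφm).aestronglyMeasurable
    have hgφ := hmul _ hgΦ _ hφm hφ1
    have s6 := abs_integral_sub_le_of_measure_le (μ := volume) (ν := volume.map (Φ t s)) (hc1 t)
      (Measure.le_iff.2 fun A hA => by
        rw [Measure.map_apply hΦm hA]; exact hvol t s A)
      (Measure.le_iff.2 fun A hA => by
        rw [Measure.smul_apply, Measure.map_apply hΦm hA, smul_eq_mul]
        have := hvol s t (Φ t s ⁻¹' A)
        rw [← Set.preimage_comp, show Φ t s ∘ Φ s t = id from funext (hΦΦ s t),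
          Set.preimage_id, abs_sub_comm] at this
        exact this) hgφ
    have s7 : ∫ z, |g (Φ s t z) * φ z| ≤ ∫ z, |g (Φ s t z)| :=
      integral_mono hgφ.abs hgΦ.abs fun z => by
        simp only [abs_mul]
        exact mul_le_of_le_one_right (abs_nonneg _) (hφ1' z)
    have s8 : (∫ z, g (Φ s t z) * φ z) - ∫ z, g z * φ z ≤ ∫ z, |g (Φ s t z) - g z| := by
      rw [← integral_sub hgφ (hmul _ hg _ hφm hφ1)]
      refine (le_abs_self _).trans ?_
      rw [← norm_eq_abs]
      refine norm_integral_le_of_norm_le (hgΦ.sub hg).abs (ae_of_all _ fun z => ?_)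
      rw [← sub_mul, norm_mul]
      exact mul_le_of_le_one_right (abs_nonneg _) (hφ1' z)
    have s9 := mul_le_mul_of_nonneg_left s7 (sub_nonneg.2 (hc1 t))
    rw [← s5] at s6
    rw [s1, s2, s3]
    have := (abs_le.1 s6).2
    linarith
  -- pointwise convergence of the transition maps
  have hΨ : ∀ z, Tendsto (fun t => Φ s t z) (𝓝 s) (𝓝 z) := by
    intro z
    rw [tendsto_iff_norm_sub_tendsto_zero]
    have hb : ∀ t, ‖Φ s t z - z‖ ≤ exp (L * |t - s|) * ‖Z s ((e s).symm z) - Z t ((e s).symm z)‖ := by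
      intro t
      have := hΦlip s t z (Z t ((e s).symm z))
      rwa [hΦZ, he', abs_sub_comm, show ‖z - Z t ((e s).symm z)‖ =
        ‖Z s ((e s).symm z) - Z t ((e s).symm z)‖ by rw [he']] at this
    refine squeeze_zero (fun _ => norm_nonneg _) hb ?_
    have hc : Continuous fun t => exp (L * |t - s|) *
        ‖Z s ((e s).symm z) - Z t ((e s).symm z)‖ := by
      have : Continuous fun t => Z t ((e s).symm z) :=
        hZ.continuous.comp (continuous_id.prodMk continuous_const)
      fun_prop
    have := hc.tendsto s
    simpa using this
  rw [Metric.tendsto_nhds]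
  intro ε hε
  obtain ⟨g, hgs, hgε, hgc, hgi⟩ :=
    (hfi s).exists_hasCompactSupport_integral_sub_le (ε := ε / 4) (by positivity)
  obtain ⟨R, hR⟩ := hgs.isCompact.isBounded.subset_closedBall (0 : E)
  obtain ⟨B, hB⟩ := hgs.exists_bound_of_continuous hgc
  have hev : ∀ᶠ t in 𝓝 s, exp (L * |t - s|) * |R| + ‖Z t ((e s).symm 0)‖ < |R| + 1 := by
    have hc : Continuous fun t => exp (L * |t - s|) * |R| + ‖Z t ((e s).symm 0)‖ := by
      have : Continuous fun t => Z t ((e s).symm 0) :=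
        hZ.continuous.comp (continuous_id.prodMk continuous_const)
      fun_prop
    refine hc.continuousAt.eventually_lt continuousAt_const ?_
    simp [he']
  have hsupp : ∀ t, exp (L * |t - s|) * |R| + ‖Z t ((e s).symm 0)‖ < |R| + 1 →
      ∀ z, ‖g (Φ s t z)‖ ≤ (Metric.closedBall (0 : E) (|R| + 1)).indicator (fun _ => B) z := by
    intro t ht z
    by_cases hz : g (Φ s t z) = 0
    · rw [hz, norm_zero]
      refine Set.indicator_nonneg (fun _ _ => (norm_nonneg _).trans (hB 0)) _
    · have h1 : ‖Φ s t z‖ ≤ R := by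
        have := hR (subset_tsupport _ hz)
        simpa using this
      have h2 : ‖z‖ ≤ |R| + 1 := by
        have h3 := hΦlip t s (Φ s t z) 0
        rw [hΦΦ, sub_zero] at h3
        have h4 : ‖z‖ ≤ ‖z - Φ t s 0‖ + ‖Φ t s 0‖ := by
          simpa using norm_add_le (z - Φ t s 0) (Φ t s 0)
        have h5 : exp (L * |t - s|) * ‖Φ s t z‖ ≤ exp (L * |t - s|) * |R| :=
          mul_le_mul_of_nonneg_left (h1.trans (le_abs_self R)) (exp_pos _).le
        simp only [Φ] at *
        linarith
      rw [Set.indicator_of_mem (by simpa using h2)]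
      exact hB _
  have hdom : Integrable ((Metric.closedBall (0 : E) (|R| + 1)).indicator (fun _ => B)) :=
    (integrable_indicator_iff Metric.isClosed_closedBall.measurableSet).2
      (integrableOn_const (by
        exact (isCompact_closedBall _ _).measure_lt_top.ne))
  have hmeas : ∀ t, AEStronglyMeasurable (fun z => g (Φ s t z)) volume := fun t =>
    (hgc.comp (hΦL s t).continuous).aestronglyMeasurable
  have hlim1 : Tendsto (fun t => ∫ z, |g (Φ s t z)|) (𝓝 s) (𝓝 (∫ z, |g z|)) := by
    refine tendsto_integral_filter_of_dominated_convergence _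
      (Eventually.of_forall fun t => (hmeas t).norm) ?_ hdom ?_
    · filter_upwards [hev] with t ht
      refine ae_of_all _ fun z => ?_
      rw [norm_eq_abs, abs_abs]
      exact hsupp t ht z
    · exact ae_of_all _ fun z => (((hgc.tendsto z).comp (hΨ z))).abs
  have hlim2 : Tendsto (fun t => ∫ z, |g (Φ s t z) - g z|) (𝓝 s) (𝓝 (∫ z : E, |(0 : ℝ)|)) := by
    refine tendsto_integral_filter_of_dominated_convergence _
      (Eventually.of_forall fun t => ((hmeas t).sub hgc.aestronglyMeasurable).norm) ?_
      (hdom.add hgi.norm) ?_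
    · filter_upwards [hev] with t ht
      refine ae_of_all _ fun z => ?_
      rw [norm_eq_abs, abs_abs]
      exact (norm_sub_le _ _).trans (add_le_add (hsupp t ht z) le_rfl)
    · refine ae_of_all _ fun z => Tendsto.abs ?_
      have := ((hgc.tendsto z).comp (hΨ z)).sub_const (g z)
      simpa using this
  have hlim : Tendsto (fun t => 2 * (ε / 4) + ((c t - 1) * ∫ z, |g (Φ s t z)|) +
      ∫ z, |g (Φ s t z) - g z|) (𝓝 s)
      (𝓝 (2 * (ε / 4) + ((c s - 1) * ∫ z, |g z|) + ∫ z : E, |(0 : ℝ)|)) :=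
    ((((hcc.tendsto s).sub_const 1).mul hlim1).const_add _).add hlim2
  simp only [hcs, sub_self, zero_mul, add_zero, abs_zero, integral_zero] at hlim
  filter_upwards [hev, hlim.eventually_lt_const (show 2 * (ε / 4) < ε by linarith)] with t ht ht2
  rw [dist_zero_right, norm_eq_abs, abs_of_nonneg (integral_nonneg fun _ => abs_nonneg _)]
  have hi : Integrable (fun z => g (Φ s t z)) :=
    hdom.mono' (hmeas t) (ae_of_all _ (hsupp t ht))
  have h1 := key g hgi hgc t hi
  have h2 : ∫ z, |f s z - g z| ≤ ε / 4 := hgε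
  linarith

end Continuity

section WeakConvergence

variable {d : ℕ}

/-- The easy half of Kantorovich duality. -/
lemma enorm_integral_sub_le_distMK1 {μ ν : Measure (EuclideanSpace ℝ (Fin d))}
    [IsProbabilityMeasure μ] {φ : EuclideanSpace ℝ (Fin d) → ℝ} {ℓ : ℝ≥0} (hℓ : ℓ ≠ 0)
    (hφ : LipschitzWith ℓ φ) {C : ℝ} (hb : ∀ z, ‖φ z‖ ≤ C) :
    ‖∫ z, φ z ∂μ - ∫ z, φ z ∂ν‖ₑ ≤ ℓ * distMK1 μ ν := by
  simp only [distMK1]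
  rw [ENNReal.mul_iInf_of_ne (by simpa using hℓ) ENNReal.coe_ne_top]
  refine le_iInf fun γ => ?_
  rw [ENNReal.mul_iInf_of_ne (by simpa using hℓ) ENNReal.coe_ne_top]
  refine le_iInf fun hγ => ?_
  obtain ⟨rfl, rfl⟩ := hγ
  have hφm : ∀ m : Measure (EuclideanSpace ℝ (Fin d)), AEStronglyMeasurable φ m :=
    fun m => hφ.continuous.aestronglyMeasurable
  have hγ : IsProbabilityMeasure γ :=
    (MeasureTheory.Measure.isProbabilityMeasure_map_iff measurable_fst.aemeasurable).1 inferInstance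
  rw [integral_map measurable_fst.aemeasurable (hφm _),
    integral_map measurable_snd.aemeasurable (hφm _), ← integral_sub]
  · refine (enorm_integral_le_lintegral_enorm _).trans ?_
    rw [← lintegral_const_mul' _ _ ENNReal.coe_ne_top]
    refine lintegral_mono fun p => ?_
    rw [← edist_eq_enorm_sub]
    exact hφ p.1 p.2
  · exact (integrable_const C).mono'
      (hφ.continuous.comp continuous_fst).aestronglyMeasurable (.of_forall fun p => hb _)
  · exact (integrable_const C).mono'
      (hφ.continuous.comp continuous_snd).aestronglyMeasurable (.of_forall fun p => hb _)

lemma tendsto_integral_of_tendsto_distMK1 {μ : ℕ → Measure (EuclideanSpace ℝ (Fin d))}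
    {ν : Measure (EuclideanSpace ℝ (Fin d))} (hμ : ∀ n, 1 ≤ n → IsProbabilityMeasure (μ n))
    [hν : IsProbabilityMeasure ν] (h : Tendsto (fun n => distMK1 (μ n) ν) atTop (𝓝 0))
    {φ : EuclideanSpace ℝ (Fin d) → ℝ} (hφ : Continuous φ) (hb : ∃ C : ℝ, ∀ z, |φ z| ≤ C) :
    Tendsto (fun n => ∫ z, φ z ∂(μ n)) atTop (𝓝 (∫ z, φ z ∂ν)) := by
  obtain ⟨C, hC⟩ := hb
  rw [← tendsto_add_atTop_iff_nat 1] at h ⊢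
  have hp : ∀ n, IsProbabilityMeasure (μ (n + 1)) := fun n => hμ _ (by omega)
  let P : ℕ → ProbabilityMeasure (EuclideanSpace ℝ (Fin d)) := fun n => ⟨μ (n + 1), hp n⟩
  let Q : ProbabilityMeasure (EuclideanSpace ℝ (Fin d)) := ⟨ν, hν⟩
  have hP : Tendsto P atTop (𝓝 Q) := by
    rw [tendsto_iff_forall_lipschitz_integral_tendsto]
    rintro f ⟨B, hB⟩ ⟨ℓ, hℓ⟩
    have hbd : ∀ z, ‖f z‖ ≤ B + ‖f 0‖ := fun z => by
      have h1 := hB z 0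
      rw [dist_eq_norm] at h1
      linarith [norm_sub_norm_le (f z) (f 0)]
    rw [tendsto_iff_edist_tendsto_0]
    have h2 := ENNReal.Tendsto.const_mul (a := ((ℓ + 1 : ℝ≥0) : ℝ≥0∞)) h
      (Or.inr ENNReal.coe_ne_top)
    rw [mul_zero] at h2
    refine tendsto_of_tendsto_of_tendsto_of_le_of_le tendsto_const_nhds h2
      (fun _ => zero_le) fun n => ?_
    simp only [edist_eq_enorm_sub]
    exact enorm_integral_sub_le_distMK1 (by positivity)
      (hℓ.weaken (le_add_of_nonneg_right zero_le_one)) hbd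
  rw [ProbabilityMeasure.tendsto_iff_forall_integral_tendsto] at hP
  exact hP (BoundedContinuousFunction.ofNormedAddCommGroup φ hφ C hC)

end WeakConvergence

lemma isInteractionKernel_of_fderiv {d : ℕ} {L : ℝ} (hL : 0 ≤ L)
    {K : EuclideanSpace ℝ (Fin d) × EuclideanSpace ℝ (Fin d) → EuclideanSpace ℝ (Fin d)}
    (hK : ContDiff ℝ 1 K) (hK1 : ∀ z z', K (z, z') = - K (z', z))
    (hK2 : ∀ z z', ‖fderiv ℝ (fun w => K (w, z')) z‖ ≤ L) : IsInteractionKernel K L := by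
  refine ⟨hL, hK, hK1, fun z z' w => ?_⟩
  have hd : Differentiable ℝ (fun u => K (u, w)) :=
    (hK.differentiable one_ne_zero).comp (differentiable_id.prodMk (differentiable_const w))
  exact convex_univ.norm_image_sub_le_of_norm_fderiv_le (fun u _ => hd u)
    (fun u _ => hK2 u w) (Set.mem_univ _) (Set.mem_univ _)

section Density

variable {d : ℕ} {f₀ : EuclideanSpace ℝ (Fin d) → ℝ}

lemma isProbabilityMeasure_densMeasure (h0 : ∀ z, 0 ≤ f₀ z) (hi : Integrable f₀)
    (h1 : ∫ z, f₀ z = 1) : IsProbabilityMeasure (densMeasure f₀) := by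
  refine ⟨?_⟩
  rw [densMeasure, withDensity_apply _ MeasurableSet.univ, Measure.restrict_univ,
    ← ofReal_integral_eq_lintegral_ofReal hi (.of_forall h0), h1, ENNReal.ofReal_one]

lemma integrable_norm_densMeasure (h0 : ∀ z, 0 ≤ f₀ z) (hi : Integrable f₀)
    (hm : Integrable (fun z => ‖z‖ * f₀ z)) :
    Integrable (fun z => ‖z‖) (densMeasure f₀) := by
  rw [densMeasure, integrable_withDensity_iff_integrable_smul₀'
    hi.aestronglyMeasurable.aemeasurable.ennreal_ofReal (.of_forall fun _ => ENNReal.ofReal_lt_top)]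
  refine hm.congr (.of_forall fun z => ?_)
  simp only [ENNReal.toReal_ofReal (h0 z), smul_eq_mul]
  ring

lemma flowDensity_zero_ae_eq (h0 : ∀ z, 0 ≤ f₀ z) (hi : Integrable f₀)
    {Z : ℝ → EuclideanSpace ℝ (Fin d) → EuclideanSpace ℝ (Fin d)} (hZ : ∀ ζ, Z 0 ζ = ζ) :
    flowDensity (densMeasure f₀) Z 0 =ᵐ[volume] f₀ := by
  have hid : Z 0 = id := funext hZ
  have hr := Measure.rnDeriv_withDensity₀ (volume : Measure (EuclideanSpace ℝ (Fin d)))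
    hi.aestronglyMeasurable.aemeasurable.ennreal_ofReal
  filter_upwards [hr] with z hz
  simp only [flowDensity, hid, Measure.map_id]
  rw [densMeasure, hz, ENNReal.toReal_ofReal (h0 z)]

variable {K : EuclideanSpace ℝ (Fin d) × EuclideanSpace ℝ (Fin d) → EuclideanSpace ℝ (Fin d)}
  {L : ℝ} {Z : ℝ → EuclideanSpace ℝ (Fin d) → EuclideanSpace ℝ (Fin d)}

theorem isL1MeanFieldSol_flowDensity (h : IsInteractionKernel K L) (h0 : ∀ z, 0 ≤ f₀ z)
    (hi : Integrable f₀) (h1 : ∫ z, f₀ z = 1) (hm : Integrable (fun z => ‖z‖ * f₀ z))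
    (hZ : IsMeanFieldFlow K (densMeasure f₀) Z) :
    IsL1MeanFieldSol K f₀ (flowDensity (densMeasure f₀) Z) := by
  have := isProbabilityMeasure_densMeasure h0 hi h1
  have hμ := integrable_norm_densMeasure h0 hi hm
  have hv : densMeasure f₀ ≪ volume := withDensity_absolutelyContinuous _ _
  exact ⟨fun t => integrable_flowDensity t,
    fun t => hZ.tendsto_integral_abs_flowDensity_sub h hμ hv t,
    flowDensity_zero_ae_eq h0 hi hZ.zero,
    fun φ hφ hb hb' t => hZ.hasDerivAt_integral_flowDensity h hμ hv hφ hb hb' t⟩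

theorem distMK1_particles_le (h : IsInteractionKernel K L) (h0 : ∀ z, 0 ≤ f₀ z)
    (hi : Integrable f₀) (h1 : ∫ z, f₀ z = 1) (hm : Integrable (fun z => ‖z‖ * f₀ z))
    (hZ : IsMeanFieldFlow K (densMeasure f₀) Z) {N : ℕ} (hN : 1 ≤ N)
    {J : Fin N → EuclideanSpace ℝ (Fin d)} {z : ℝ → Fin N → EuclideanSpace ℝ (Fin d)}
    (hz0 : z 0 = J)
    (hz : ∀ t, HasDerivAt z (fun i => (N : ℝ)⁻¹ • ∑ j : Fin N, K (z t i, z t j)) t) (t : ℝ) :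
    distMK1 (empiricalMeasure (z t)) (densMeasure (flowDensity (densMeasure f₀) Z t)) ≤
      ENNReal.ofReal (exp (2 * L * |t|)) * distMK1 (empiricalMeasure J) (densMeasure f₀) := by
  have := isProbabilityMeasure_densMeasure h0 hi h1
  have := isProbabilityMeasure_empiricalMeasure hN J
  have hμ := integrable_norm_densMeasure h0 hi hm
  have hv : densMeasure f₀ ≪ volume := withDensity_absolutelyContinuous _ _
  have hJ := integrable_empiricalMeasure hN J (fun z => ‖z‖)
  obtain ⟨X, hX⟩ := exists_meanFieldFlow (μ := empiricalMeasure J) h hJ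
  have h2 := distMK1_map_le h hX hZ hJ hμ t
  rw [map_empiricalMeasure J (hX.measurable t), hX.particle_eq h hN hz0 hz t,
    ← hZ.withDensity_flowDensity h hμ hv t] at h2
  exact h2

lemma isProbabilityMeasure_densMeasure_flowDensity (h : IsInteractionKernel K L)
    (h0 : ∀ z, 0 ≤ f₀ z)
    (hi : Integrable f₀) (h1 : ∫ z, f₀ z = 1) (hm : Integrable (fun z => ‖z‖ * f₀ z))
    (hZ : IsMeanFieldFlow K (densMeasure f₀) Z) (t : ℝ) :
    IsProbabilityMeasure (densMeasure (flowDensity (densMeasure f₀) Z t)) := by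
  have := isProbabilityMeasure_densMeasure h0 hi h1
  have hμ := integrable_norm_densMeasure h0 hi hm
  have hv : densMeasure f₀ ≪ volume := withDensity_absolutelyContinuous _ _
  rw [densMeasure, hZ.withDensity_flowDensity h hμ hv t]
  exact Measure.isProbabilityMeasure_map (hZ.measurable t).aemeasurable

lemma integral_densMeasure {g : EuclideanSpace ℝ (Fin d) → ℝ} (hg0 : ∀ z, 0 ≤ g z)
    (hg : Integrable g) (φ : EuclideanSpace ℝ (Fin d) → ℝ) :
    ∫ z, φ z ∂(densMeasure g) = ∫ z, φ z * g z := by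
  rw [densMeasure, integral_withDensity_eq_integral_toReal_smul₀
    hg.aestronglyMeasurable.aemeasurable.ennreal_ofReal (.of_forall fun _ => ENNReal.ofReal_lt_top)]
  refine integral_congr_ae (.of_forall fun z => ?_)
  simp only [ENNReal.toReal_ofReal (hg0 z), smul_eq_mul]
  ring

end Density

section Transport

variable {E : Type*} [NormedAddCommGroup E] [NormedSpace ℝ E] [FiniteDimensional ℝ E]
  [MeasureSpace E] [BorelSpace E] [(volume : Measure E).IsAddHaarMeasure]

/-- `g` is `L¹`-continuous and solves the transport equation `∂ₜ g + div (g c) = 0` weakly for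
times in `I`. -/
structure IsTransportedBy (c : ℝ → E → E) (g : ℝ → E → ℝ) (I : Set ℝ) : Prop where
  integrable : ∀ t ∈ I, Integrable (g t)
  tendsto : ∀ t₀ ∈ I, Tendsto (fun t => ∫ z, |g t z - g t₀ z|) (𝓝[I] t₀) (𝓝 0)
  field_continuous : ∀ t ∈ I, Continuous (c t)
  hasDerivAt : ∀ φ : E → ℝ, ContDiff ℝ 1 φ → HasCompactSupport φ → ∀ t ∈ I,
    HasDerivAt (fun s => ∫ z, φ z * g s z) (∫ z, fderiv ℝ φ z (c t z) * g t z) t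

variable {c : ℝ → E → E} {g : ℝ → E → ℝ} {I : Set ℝ}

/-- Differentiating a transported density against a time dependent test function. -/
lemma IsTransportedBy.hasDerivAt_integral (hg : IsTransportedBy c g I) (hI : IsOpen I)
    {t : ℝ} (ht : t ∈ I)
    {θ : ℝ → E → ℝ} {θ' : E → ℝ} {C : ℝ} (hθ : ContDiff ℝ 1 (θ t))
    (hθs : HasCompactSupport (θ t)) (hm : ∀ s, Continuous (θ s))
    (hd : ∀ z, HasDerivAt (fun s => θ s z) (θ' z) t)
    (hC : ∀ᶠ s in 𝓝 t, ∀ z, |θ s z - θ t z| ≤ C * |s - t|) :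
    HasDerivAt (fun s => ∫ z, θ s z * g s z)
      ((∫ z, θ' z * g t z) + ∫ z, fderiv ℝ (θ t) z (c t z) * g t z) t := by
  obtain ⟨B, hB⟩ := hθs.exists_bound_of_continuous hθ.continuous
  have hIt : I ∈ 𝓝 t := hI.mem_nhds ht
  -- frozen density
  have h1 : HasDerivAt (fun s => ∫ z, θ s z * g t z) (∫ z, θ' z * g t z) t := by
    have hInt : ∀ s, (∀ z, |θ s z - θ t z| ≤ C * |s - t|) →
        Integrable (fun z => θ s z * g t z) := fun s hs => by
      refine (hg.integrable t ht).bdd_mul (c := C * |s - t| + B) (hm s).aestronglyMeasurable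
        (.of_forall fun z => ?_)
      have h7 := norm_sub_norm_le (θ s z) (θ t z)
      rw [Real.norm_eq_abs (θ s z - θ t z)] at h7
      linarith [hs z, hB z]
    have h0 : ∀ z, |θ t z - θ t z| ≤ C * |t - t| := hC.self_of_nhds
    rw [hasDerivAt_iff_tendsto_slope]
    have hC' : ∀ᶠ s in 𝓝[≠] t, ∀ z, |θ s z - θ t z| ≤ C * |s - t| := hC.filter_mono inf_le_left
    have key : Tendsto (fun s => ∫ z, slope (fun s => θ s z) t s * g t z) (𝓝[≠] t)
        (𝓝 (∫ z, θ' z * g t z)) := by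
      refine tendsto_integral_filter_of_dominated_convergence (fun z => C * |g t z|)
        (.of_forall fun s => ?_) ?_ ((hg.integrable t ht).abs.const_mul C)
        (.of_forall fun z => ((hasDerivAt_iff_tendsto_slope.1 (hd z)).mul_const _))
      · simp only [slope_def_field]
        exact (((hm s).sub (hm t)).div_const _).aestronglyMeasurable.mul
          (hg.integrable t ht).aestronglyMeasurable
      · filter_upwards [hC', self_mem_nhdsWithin] with s hs hst
        have hpos : 0 < |s - t| := abs_pos.2 (sub_ne_zero.2 hst)
        refine .of_forall fun z => ?_
        rw [norm_mul, Real.norm_eq_abs, Real.norm_eq_abs, slope_def_field, abs_div]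
        exact mul_le_mul_of_nonneg_right ((div_le_iff₀ hpos).2 (hs z)) (abs_nonneg _)
    refine key.congr' ?_
    filter_upwards [hC'] with s hs
    rw [slope_def_field, ← integral_sub (hInt s hs) (hInt t h0), ← integral_div]
    refine integral_congr_ae (.of_forall fun z => ?_)
    simp only [slope_def_field]
    ring
  have h2 := hg.hasDerivAt (θ t) hθ hθs t ht
  -- the mixed increment is of higher order
  have h3 : HasDerivAt (fun s => ∫ z, (θ s z - θ t z) * (g s z - g t z)) 0 t := by
    rw [hasDerivAt_iff_isLittleO]
    simp only [sub_self, zero_mul, integral_zero, sub_zero, smul_zero]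
    have hlim : Tendsto (fun s => C * ∫ z, |g s z - g t z|) (𝓝 t) (𝓝 0) := by
      have := (hg.tendsto t ht).const_mul C
      rwa [mul_zero, hI.nhdsWithin_eq ht] at this
    rw [Asymptotics.isLittleO_iff]
    intro ε hε
    filter_upwards [hC, hIt, hlim.eventually_lt_const hε] with s hs hsI hs'
    have hi : Integrable (fun z => |g s z - g t z|) :=
      ((hg.integrable s hsI).sub (hg.integrable t ht)).abs
    calc ‖∫ z, (θ s z - θ t z) * (g s z - g t z)‖
        ≤ ∫ z, (C * |s - t|) * |g s z - g t z| := by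
          refine norm_integral_le_of_norm_le (hi.const_mul _) (.of_forall fun z => ?_)
          rw [norm_mul]
          exact mul_le_mul_of_nonneg_right (hs z) (abs_nonneg _)
      _ = (C * ∫ z, |g s z - g t z|) * |s - t| := by rw [integral_const_mul]; ring
      _ ≤ ε * ‖s - t‖ := mul_le_mul_of_nonneg_right hs'.le (abs_nonneg _)
  have h4 := ((h1.add h2).sub (hasDerivAt_const t (∫ z, θ t z * g t z))).add h3
  rw [sub_zero, add_zero] at h4
  refine h4.congr_of_eventuallyEq ?_
  filter_upwards [hC, hIt] with s hs hsI
  have hbs : ∀ z, ‖θ s z‖ ≤ C * |s - t| + B := fun z => by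
    have h5 := hs z
    have h6 := hB z
    have h7 := norm_sub_norm_le (θ s z) (θ t z)
    rw [← Real.norm_eq_abs] at h5
    linarith
  have i1 : ∀ r ∈ I, Integrable (fun z => θ s z * g r z) := fun r hr =>
    (hg.integrable r hr).bdd_mul (hm s).aestronglyMeasurable (.of_forall hbs)
  have i2 : ∀ r ∈ I, Integrable (fun z => θ t z * g r z) := fun r hr =>
    (hg.integrable r hr).bdd_mul hθ.continuous.aestronglyMeasurable (.of_forall hB)
  have e : (fun z => (θ s z - θ t z) * (g s z - g t z)) =
      fun z => (θ s z * g s z - θ s z * g t z) - (θ t z * g s z - θ t z * g t z) := by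
    ext z; ring
  have e1 := integral_sub (i1 s hsI) (i1 t ht)
  have e2 := integral_sub (i2 s hsI) (i2 t ht)
  have e3 := integral_sub ((i1 s hsI).sub (i1 t ht)) ((i2 s hsI).sub (i2 t ht))
  simp only [Pi.sub_apply] at e3
  simp only [Pi.add_apply, Pi.sub_apply]
  rw [e, e3, e1, e2]
  ring

end Transport

section Euler

variable {E : Type*} [NormedAddCommGroup E] [NormedSpace ℝ E]

/-- The backward Euler transport of the test function `φ`, given at time `q`, by the field `b`:
the result of `n` steps of length `h`. -/
def eulerBack (b : ℝ → E → E) (φ : E → ℝ) (q h : ℝ) : ℕ → E → ℝ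
  | 0 => φ
  | n + 1 => fun z => eulerBack b φ q h n (z + h • b (q - (n + 1 : ℕ) * h) z)

/-- A field which is `C¹` and `Λ`-Lipschitz in space, jointly continuous, and of linear growth
with constant `κ`, for times in `[p, q]`. -/
structure IsTameField (b : ℝ → E → E) (Λ κ p q : ℝ) : Prop where
  contDiff : ∀ t ∈ Set.Icc p q, ContDiff ℝ 1 (b t)
  norm_fderiv_le : ∀ t ∈ Set.Icc p q, ∀ z, ‖fderiv ℝ (b t) z‖ ≤ Λ
  norm_le : ∀ t ∈ Set.Icc p q, ∀ z, ‖b t z‖ ≤ κ * (1 + ‖z‖)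
  continuousOn : ContinuousOn (fun x : ℝ × E => b x.1 x.2) (Set.Icc p q ×ˢ Set.univ)

variable {b : ℝ → E → E} {φ : E → ℝ} {Λ κ p q h : ℝ} {n : ℕ}

lemma euler_node_mem (hh : 0 ≤ h) (hn : n * h ≤ q - p) : q - n * h ∈ Set.Icc p q :=
  ⟨by linarith, by nlinarith [(Nat.cast_nonneg n : (0 : ℝ) ≤ n)]⟩

lemma euler_pred_le (hh : 0 ≤ h) (hn : (n + 1 : ℕ) * h ≤ q - p) : n * h ≤ q - p := by
  push_cast at hn; linarith

lemma IsTameField.contDiff_eulerBack (hb : IsTameField b Λ κ p q) (hφ : ContDiff ℝ 1 φ)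
    (hh : 0 ≤ h) (hn : n * h ≤ q - p) : ContDiff ℝ 1 (eulerBack b φ q h n) := by
  induction n with
  | zero => exact hφ
  | succ n ih =>
    exact (ih (euler_pred_le hh hn)).comp
      (contDiff_id.add ((hb.contDiff _ (euler_node_mem hh hn)).const_smul h))

lemma norm_fderiv_comp_add_smul_le {ψ : E → ℝ} {β : E → E} {ℓ u : ℝ} (hψ : ContDiff ℝ 1 ψ)
    (hβ : ContDiff ℝ 1 β) (hℓ : ∀ z, ‖fderiv ℝ ψ z‖ ≤ ℓ) (hΛ : ∀ z, ‖fderiv ℝ β z‖ ≤ Λ)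
    (hu : 0 ≤ u) (z : E) :
    ‖fderiv ℝ (fun z => ψ (z + u • β z)) z‖ ≤ ℓ * exp (Λ * u) := by
  have hd : HasFDerivAt (fun z => z + u • β z)
      (ContinuousLinearMap.id ℝ E + u • fderiv ℝ β z) z :=
    (hasFDerivAt_id z).add ((hβ.differentiable one_ne_zero z).hasFDerivAt.const_smul u)
  have h1 := (((hψ.differentiable one_ne_zero) (z + u • β z)).hasFDerivAt.comp z hd).fderiv
  simp only [Function.comp_def] at h1
  rw [h1]
  have hℓ0 : 0 ≤ ℓ := (norm_nonneg _).trans (hℓ z)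
  refine (ContinuousLinearMap.opNorm_comp_le _ _).trans ?_
  refine mul_le_mul (hℓ _) ?_ (norm_nonneg _) hℓ0
  calc ‖ContinuousLinearMap.id ℝ E + u • fderiv ℝ β z‖
      ≤ 1 + u * Λ := by
        refine (norm_add_le _ _).trans (add_le_add ContinuousLinearMap.norm_id_le ?_)
        rw [norm_smul, Real.norm_of_nonneg hu]
        exact mul_le_mul_of_nonneg_left (hΛ z) hu
    _ ≤ exp (Λ * u) := by linarith [Real.add_one_le_exp (Λ * u)]

lemma IsTameField.norm_fderiv_eulerBack_le (hb : IsTameField b Λ κ p q) (hφ : ContDiff ℝ 1 φ)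
    {ℓ : ℝ} (hℓ : ∀ z, ‖fderiv ℝ φ z‖ ≤ ℓ)
    (hh : 0 ≤ h) (hn : n * h ≤ q - p) (z : E) :
    ‖fderiv ℝ (eulerBack b φ q h n) z‖ ≤ ℓ * exp (Λ * (n * h)) := by
  induction n generalizing z with
  | zero => simpa [eulerBack] using hℓ z
  | succ n ih =>
    have hn' := euler_pred_le hh hn
    have := norm_fderiv_comp_add_smul_le (hb.contDiff_eulerBack hφ hh hn')
      (hb.contDiff _ (euler_node_mem hh hn)) (ih hn') (hb.norm_fderiv_le _ (euler_node_mem hh hn))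
      hh z
    refine this.trans_eq ?_
    rw [mul_assoc, ← Real.exp_add]
    push_cast
    ring_nf

lemma IsTameField.abs_eulerBack_le (hb : IsTameField b Λ κ p q) {ω : ℝ} (hω : 0 ≤ ω)
    (hφ : ∀ z, |φ z| ≤ ω * (1 + ‖z‖))
    (hh : 0 ≤ h) (hn : n * h ≤ q - p) (z : E) :
    |eulerBack b φ q h n z| ≤ ω * exp (κ * (n * h)) * (1 + ‖z‖) := by
  induction n generalizing z with
  | zero => simpa [eulerBack] using hφ z
  | succ n ih =>
    have hn' := euler_pred_le hh hn
    set β := b (q - (n + 1 : ℕ) * h) with hβ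
    have hβz : ‖β z‖ ≤ κ * (1 + ‖z‖) := hb.norm_le _ (euler_node_mem hh hn) z
    have h1 : 1 + ‖z + h • β z‖ ≤ exp (κ * h) * (1 + ‖z‖) := by
      have h2 : ‖h • β z‖ ≤ h * (κ * (1 + ‖z‖)) := by
        rw [norm_smul, Real.norm_of_nonneg hh]
        exact mul_le_mul_of_nonneg_left hβz hh
      have h3 := mul_le_mul_of_nonneg_right (Real.add_one_le_exp (κ * h))
        (by positivity : (0 : ℝ) ≤ 1 + ‖z‖)
      nlinarith [norm_add_le z (h • β z)]
    calc |eulerBack b φ q h (n + 1) z| = |eulerBack b φ q h n (z + h • β z)| := rfl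
      _ ≤ ω * exp (κ * (n * h)) * (1 + ‖z + h • β z‖) := ih hn' _
      _ ≤ ω * exp (κ * (n * h)) * (exp (κ * h) * (1 + ‖z‖)) :=
          mul_le_mul_of_nonneg_left h1 (by positivity)
      _ = ω * exp (κ * ((n + 1 : ℕ) * h)) * (1 + ‖z‖) := by
          have : κ * ((n + 1 : ℕ) * h) = κ * (n * h) + κ * h := by push_cast; ring
          rw [this, Real.exp_add]; ring

lemma exp_neg_two_mul_le {x : ℝ} (h0 : 0 ≤ x) (h1 : x ≤ 1 / 2) : exp (-(2 * x)) ≤ 1 - x := by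
  rw [Real.exp_neg, inv_le_comm₀ (exp_pos _) (by linarith)]
  have h2 : (1 - x)⁻¹ ≤ 1 + 2 * x := by
    rw [inv_le_iff_one_le_mul₀ (by linarith)]
    nlinarith
  linarith [Real.add_one_le_exp (2 * x)]

lemma add_smul_growth_ge {β : E → E} {u : ℝ} (hβ : ∀ z, ‖β z‖ ≤ κ * (1 + ‖z‖)) (hu : 0 ≤ u)
    (hκ : 0 ≤ κ) (hκu : κ * u ≤ 1 / 2) (z : E) :
    1 + ‖z‖ ≤ exp (2 * κ * u) * (1 + ‖z + u • β z‖) := by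
  have h1 := exp_neg_two_mul_le (mul_nonneg hκ hu) hκu
  have h2 : ‖u • β z‖ ≤ u * (κ * (1 + ‖z‖)) := by
    rw [norm_smul, Real.norm_of_nonneg hu]
    exact mul_le_mul_of_nonneg_left (hβ z) hu
  have h3 : ‖z‖ - ‖u • β z‖ ≤ ‖z + u • β z‖ := by
    have := norm_sub_norm_le z (-(u • β z))
    rwa [norm_neg, sub_neg_eq_add] at this
  have h4 : exp (-(2 * (κ * u))) * (1 + ‖z‖) ≤ 1 + ‖z + u • β z‖ := by
    have := mul_le_mul_of_nonneg_right h1 (by positivity : (0 : ℝ) ≤ 1 + ‖z‖)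
    nlinarith
  have h5 := mul_le_mul_of_nonneg_left h4 (exp_pos (2 * κ * u)).le
  rw [← mul_assoc, ← Real.exp_add] at h5
  have h6 : 2 * κ * u + -(2 * (κ * u)) = 0 := by ring
  rw [h6, Real.exp_zero, one_mul] at h5
  exact h5

lemma IsTameField.eulerBack_eq_zero (hb : IsTameField b Λ κ p q) (hκ : 0 ≤ κ) {R : ℝ}
    (hφ : ∀ z, R < 1 + ‖z‖ → φ z = 0)
    (hh : 0 ≤ h) (hκh : κ * h ≤ 1 / 2) (hn : n * h ≤ q - p) (z : E)
    (hz : R * exp (2 * κ * (n * h)) < 1 + ‖z‖) :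
    eulerBack b φ q h n z = 0 := by
  induction n generalizing z with
  | zero => exact hφ z (by simpa using hz)
  | succ n ih =>
    refine ih (euler_pred_le hh hn) _ ?_
    have h1 := add_smul_growth_ge (hb.norm_le _ (euler_node_mem hh hn)) hh hκ hκh z
    have h2 : 2 * κ * ((n + 1 : ℕ) * h) = 2 * κ * h + 2 * κ * (n * h) := by push_cast; ring
    rw [h2, Real.exp_add] at hz
    have h3 := exp_pos (2 * κ * h)
    refine lt_of_mul_lt_mul_left (a := exp (2 * κ * h)) ?_ h3.le
    calc _ = R * (exp (2 * κ * h) * exp (2 * κ * (n * h))) := by ring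
      _ < 1 + ‖z‖ := hz
      _ ≤ _ := h1

end Euler

section Euler

variable {E : Type*} [NormedAddCommGroup E] [NormedSpace ℝ E] [FiniteDimensional ℝ E]
  [MeasureSpace E] [BorelSpace E] [(volume : Measure E).IsAddHaarMeasure]

variable {c : ℝ → E → E} {g : ℝ → E → ℝ} {I : Set ℝ}

lemma integrable_mul_of_hasCompactSupport {F G : E → ℝ} (hF : Continuous F)
    (hFs : HasCompactSupport F) (hG : Integrable G) : Integrable (fun z => F z * G z) := by
  obtain ⟨B, hB⟩ := hFs.exists_bound_of_continuous hF
  exact hG.bdd_mul hF.aestronglyMeasurable (.of_forall hB)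

lemma hasCompactSupport_of_norm {F : E → ℝ} {R : ℝ} (hF : ∀ z, R < 1 + ‖z‖ → F z = 0) :
    HasCompactSupport F := by
  have := FiniteDimensional.proper_real E
  refine HasCompactSupport.intro (isCompact_closedBall (0 : E) (R - 1)) fun z hz => hF z ?_
  rw [mem_closedBall_zero_iff, not_le] at hz
  linarith

/-- One Euler step of the duality argument. -/
lemma IsTransportedBy.hasDerivAt_euler (hg : IsTransportedBy c g I) (hI : IsOpen I)
    {β : E → E} {ψ : E → ℝ} {ℓ Λ κ R ω η Γ s τ h : ℝ}
    (hs : s ∈ I) (hsτ : s ≤ τ) (hsh : τ - s ≤ h)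
    (hψ : ContDiff ℝ 1 ψ) (hβ : ContDiff ℝ 1 β) (hℓ : ∀ z, ‖fderiv ℝ ψ z‖ ≤ ℓ)
    (hR : ∀ z, R < 1 + ‖z‖ → ψ z = 0)
    (hΛ : ∀ z, ‖fderiv ℝ β z‖ ≤ Λ) (hκ : 0 ≤ κ) (hβκ : ∀ z, ‖β z‖ ≤ κ * (1 + ‖z‖))
    (hκh : κ * h ≤ 1 / 4) (hη : ∀ z, 1 + ‖z‖ ≤ R * exp (2 * κ * h) → ‖c s z - β z‖ ≤ η + ω)
    (hη0 : 0 ≤ η + ω)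
    (hΓ : ∫ z, |g s z| ≤ Γ) (hR0 : 0 ≤ R) :
    ∃ J' : ℝ, |J'| ≤ ℓ * Γ * ((1 + h * Λ) * (η + ω) + h * Λ * (κ * (R * exp (2 * κ * h)))) ∧
      HasDerivAt (fun r => ∫ z, ψ (z + (τ - r) • β z) * g r z) J' s := by
  have hℓ0 : 0 ≤ ℓ := (norm_nonneg _).trans (hℓ 0)
  have hΛ0 : 0 ≤ Λ := (norm_nonneg _).trans (hΛ 0)
  have hh : 0 ≤ h := by linarith
  have hτs : 0 ≤ τ - s := by linarith
  set θ : ℝ → E → ℝ := fun r z => ψ (z + (τ - r) • β z) with hθdef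
  have hθC : ∀ r, ContDiff ℝ 1 (θ r) := fun r => hψ.comp (contDiff_id.add (hβ.const_smul _))
  have hLip : ∀ x y, |ψ x - ψ y| ≤ ℓ * ‖x - y‖ := fun x y =>
    convex_univ.norm_image_sub_le_of_norm_fderiv_le
      (fun z _ => hψ.differentiable one_ne_zero z) (fun z _ => hℓ z) (Set.mem_univ _) (Set.mem_univ _)
  -- support of the interpolated test functions
  have hsupp : ∀ u, κ * |u| ≤ 1 / 2 → ∀ z, 2 * R < 1 + ‖z‖ → ψ (z + u • β z) = 0 := by
    intro u hu z hz
    refine hR _ ?_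
    have h1 : ‖u • β z‖ ≤ 1 / 2 * (1 + ‖z‖) := by
      rw [norm_smul, Real.norm_eq_abs]
      have := mul_le_mul_of_nonneg_left (hβκ z) (abs_nonneg u)
      have := mul_le_mul_of_nonneg_right hu (by positivity : (0 : ℝ) ≤ 1 + ‖z‖)
      nlinarith
    have h3 : ‖z‖ - ‖u • β z‖ ≤ ‖z + u • β z‖ := by
      have := norm_sub_norm_le z (-(u • β z))
      rwa [norm_neg, sub_neg_eq_add] at this
    linarith
  have hκs : κ * |τ - s| ≤ 1 / 4 := by
    rw [abs_of_nonneg hτs]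
    exact (mul_le_mul_of_nonneg_left hsh hκ).trans hκh
  have hθs : HasCompactSupport (θ s) :=
    hasCompactSupport_of_norm (R := 2 * R) fun z hz => hsupp _ (by linarith) z hz
  set y : E → E := fun z => z + (τ - s) • β z with hy
  have hyC : ContDiff ℝ 1 y := contDiff_id.add (hβ.const_smul _)
  set θ' : E → ℝ := fun z => fderiv ℝ ψ (y z) (-β z) with hθ'
  have hd : ∀ z, HasDerivAt (fun r => θ r z) (θ' z) s := fun z => by
    have h1 : HasDerivAt (fun r : ℝ => z + (τ - r) • β z) (-β z) s := by
      have := (((hasDerivAt_id s).const_sub τ).smul_const (β z)).const_add z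
      simpa using this
    exact ((hψ.differentiable one_ne_zero (y z)).hasFDerivAt.comp_hasDerivAt s h1)
  have hC : ∀ᶠ r in 𝓝 s, ∀ z, |θ r z - θ s z| ≤ (ℓ * (κ * (2 * R))) * |r - s| := by
    have hlim : Tendsto (fun r => κ * |τ - r|) (𝓝 s) (𝓝 (κ * |τ - s|)) := by
      exact (continuous_const.mul (continuous_const.sub continuous_id).abs).tendsto s
    filter_upwards [hlim.eventually_lt_const (show κ * |τ - s| < 1 / 2 by linarith)] with r hr z
    rcases lt_or_ge (2 * R) (1 + ‖z‖) with hz | hz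
    · simp only [hθdef]
      rw [hsupp _ hr.le z hz, hsupp _ (by linarith) z hz, sub_zero, abs_zero]
      positivity
    · refine (hLip _ _).trans ?_
      have e : z + (τ - r) • β z - (z + (τ - s) • β z) = (s - r) • β z := by
        rw [add_sub_add_left_eq_sub, ← sub_smul]; congr 1; ring
      rw [e, norm_smul, Real.norm_eq_abs, abs_sub_comm]
      have h1 : ‖β z‖ ≤ κ * (2 * R) := (hβκ z).trans (mul_le_mul_of_nonneg_left hz hκ)
      have h2 := mul_le_mul_of_nonneg_left h1 (abs_nonneg (r - s))
      have h3 := mul_le_mul_of_nonneg_left h2 hℓ0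
      linarith
  have hJ := hg.hasDerivAt_integral hI hs (hθC s) hθs (fun r => (hθC r).continuous) hd hC
  refine ⟨_, ?_, hJ⟩
  have hcs := hg.field_continuous s hs
  have hfy : Continuous fun z => fderiv ℝ ψ (y z) :=
    (hψ.continuous_fderiv one_ne_zero).comp hyC.continuous
  have hfder : ∀ z v, fderiv ℝ (θ s) z v = fderiv ℝ ψ (y z) (v + (τ - s) • fderiv ℝ β z v) := by
    intro z v
    have h1 : HasFDerivAt y (ContinuousLinearMap.id ℝ E + (τ - s) • fderiv ℝ β z) z :=
      (hasFDerivAt_id z).add ((hβ.differentiable one_ne_zero z).hasFDerivAt.const_smul _)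
    have h2 := (((hψ.differentiable one_ne_zero) (y z)).hasFDerivAt.comp z h1).fderiv
    simp only [hθdef, Function.comp_def, hy] at h2 ⊢
    rw [h2]
    simp
  -- vanishing of the gradient of the test function
  have hgrad : ∀ z, R * exp (2 * κ * h) < 1 + ‖z‖ → fderiv ℝ ψ (y z) = 0 := by
    intro z hz
    have h1 := add_smul_growth_ge hβκ hτs hκ (by rw [abs_of_nonneg hτs] at hκs; linarith) z
    have h2 : exp (2 * κ * (τ - s)) ≤ exp (2 * κ * h) := by
      apply exp_le_exp.2; exact mul_le_mul_of_nonneg_left hsh (by positivity)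
    have h3 : R < 1 + ‖y z‖ := by
      have h4 := mul_le_mul_of_nonneg_right h2 (by positivity : (0 : ℝ) ≤ 1 + ‖y z‖)
      refine lt_of_mul_lt_mul_left (a := exp (2 * κ * h)) ?_ (exp_pos _).le
      calc _ = R * exp (2 * κ * h) := by ring
        _ < 1 + ‖z‖ := hz
        _ ≤ _ := h1.trans h4
    have h5 : ψ =ᶠ[𝓝 (y z)] fun _ => (0 : ℝ) := by
      have : IsOpen {x : E | R < 1 + ‖x‖} :=
        isOpen_lt continuous_const (continuous_const.add continuous_norm)
      filter_upwards [this.mem_nhds h3] with x hx using hR x hx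
    rw [h5.fderiv_eq]
    simp
  have hF1c : HasCompactSupport θ' := hasCompactSupport_of_norm (R := R * exp (2 * κ * h)) fun z hz => by
    simp only [hθ', hgrad z hz, zero_apply]
  have hF2c : HasCompactSupport fun z => fderiv ℝ (θ s) z (c s z) :=
    hasCompactSupport_of_norm (R := R * exp (2 * κ * h)) fun z hz => by
      rw [hfder, hgrad z hz, zero_apply]
  have i1 : Integrable (fun z => θ' z * g s z) :=
    integrable_mul_of_hasCompactSupport (hfy.clm_apply hβ.continuous.neg) hF1c (hg.integrable s hs)
  have i2 : Integrable (fun z => fderiv ℝ (θ s) z (c s z) * g s z) :=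
    integrable_mul_of_hasCompactSupport
      (((hθC s).continuous_fderiv one_ne_zero).clm_apply hcs) hF2c (hg.integrable s hs)
  rw [← integral_add i1 i2]
  set D := (1 + h * Λ) * (η + ω) + h * Λ * (κ * (R * exp (2 * κ * h))) with hD
  have hD0 : 0 ≤ D := by positivity
  have hpt : ∀ z, |θ' z + fderiv ℝ (θ s) z (c s z)| ≤ ℓ * D := by
    intro z
    have e : θ' z + fderiv ℝ (θ s) z (c s z) =
        fderiv ℝ ψ (y z) ((c s z - β z) + (τ - s) • fderiv ℝ β z (c s z)) := by
      rw [hfder, hθ', ← map_add]; congr 1; abel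
    rw [e]
    rcases lt_or_ge (R * exp (2 * κ * h)) (1 + ‖z‖) with hz | hz
    · rw [hgrad z hz, zero_apply, abs_zero]; positivity
    · have h1 := hη z hz
      have h2 : ‖c s z‖ ≤ (η + ω) + κ * (R * exp (2 * κ * h)) := by
        have h3 : ‖c s z‖ ≤ ‖c s z - β z‖ + ‖β z‖ := norm_le_norm_sub_add _ _
        have h4 := (hβκ z).trans (mul_le_mul_of_nonneg_left hz hκ)
        linarith
      have h5 : ‖(τ - s) • fderiv ℝ β z (c s z)‖ ≤
          h * (Λ * ((η + ω) + κ * (R * exp (2 * κ * h)))) := by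
        rw [norm_smul, Real.norm_of_nonneg hτs]
        refine mul_le_mul hsh ?_ (norm_nonneg _) hh
        exact (ContinuousLinearMap.le_opNorm _ _).trans
          (mul_le_mul (hΛ z) h2 (norm_nonneg _) hΛ0)
      rw [← Real.norm_eq_abs]
      refine (ContinuousLinearMap.le_opNorm _ _).trans
        (mul_le_mul (hℓ _) ?_ (norm_nonneg _) hℓ0)
      refine (norm_add_le _ _).trans ?_
      rw [hD]
      nlinarith
  calc |∫ z, (θ' z * g s z + fderiv ℝ (θ s) z (c s z) * g s z)|
      ≤ ∫ z, (ℓ * D) * |g s z| := by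
        rw [← Real.norm_eq_abs]
        refine norm_integral_le_of_norm_le ((hg.integrable s hs).abs.const_mul _)
          (.of_forall fun z => ?_)
        rw [← add_mul, norm_mul]
        exact mul_le_mul_of_nonneg_right (hpt z) (abs_nonneg _)
    _ = (ℓ * D) * ∫ z, |g s z| := integral_const_mul _ _
    _ ≤ (ℓ * D) * Γ := mul_le_mul_of_nonneg_left hΓ (by positivity)
    _ = ℓ * Γ * D := by ring

end Euler

section Euler

variable {E : Type*} [NormedAddCommGroup E] [NormedSpace ℝ E] [FiniteDimensional ℝ E]
  [MeasureSpace E] [BorelSpace E] [(volume : Measure E).IsAddHaarMeasure]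

variable {c b : ℝ → E → E} {g : ℝ → E → ℝ} {I : Set ℝ} {φ : E → ℝ} {ℓ Λ κ R ω Γ p q h : ℝ}
  {η : ℝ → ℝ}

lemma abs_sub_le_integral_of_hasDerivAt {F B : ℝ → ℝ} {x y : ℝ} (hxy : x ≤ y)
    (hB : IntervalIntegrable B volume x y)
    (hF : ∀ s ∈ Set.Icc x y, ∃ F', |F'| ≤ B s ∧ HasDerivAt F F' s) :
    |F y - F x| ≤ ∫ s in x..y, B s := by
  have hd : ∀ s ∈ Set.Icc x y, |deriv F s| ≤ B s ∧ HasDerivAt F (deriv F s) s := by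
    intro s hs
    obtain ⟨F', h1, h2⟩ := hF s hs
    rw [h2.deriv]; exact ⟨h1, h2⟩
  have hi : IntervalIntegrable (deriv F) volume x y := by
    refine hB.mono_fun' (measurable_deriv F).aestronglyMeasurable ?_
    filter_upwards [ae_restrict_mem measurableSet_uIoc] with s hs
    rw [Set.uIoc_of_le hxy] at hs
    exact (hd s ⟨hs.1.le, hs.2⟩).1
  rw [← intervalIntegral.integral_eq_sub_of_hasDerivAt (f' := deriv F)
    (fun s hs => (hd s (by rwa [Set.uIcc_of_le hxy] at hs)).2) hi, ← Real.norm_eq_abs]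
  exact intervalIntegral.norm_integral_le_of_norm_le hxy
    (.of_forall fun s hs => (hd s ⟨hs.1.le, hs.2⟩).1) hB

lemma IsTransportedBy.abs_integral_sub_eulerBack_le (hg : IsTransportedBy c g I) (hI : IsOpen I)
    (hpq : Set.Icc p q ⊆ I) (hb : IsTameField b Λ κ p q) (hκ : 0 ≤ κ) (hΛ : 0 ≤ Λ)
    (hφ : ContDiff ℝ 1 φ) (hℓ : ∀ z, ‖fderiv ℝ φ z‖ ≤ ℓ)
    (hR0 : 0 ≤ R) (hR : ∀ z, R < 1 + ‖z‖ → φ z = 0)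
    (hηi : IntervalIntegrable η volume p q) (hη0 : ∀ s, 0 ≤ η s)
    (hη : ∀ s ∈ Set.Icc p q, ∀ z, 1 + ‖z‖ ≤ R * exp (2 * κ * (q - p)) → ‖c s z - b s z‖ ≤ η s)
    (hΓ : ∀ s ∈ Set.Icc p q, ∫ z, |g s z| ≤ Γ) (hh : 0 ≤ h) (hκh : κ * h ≤ 1 / 4) (hω0 : 0 ≤ ω)
    (hω : ∀ s ∈ Set.Icc p q, ∀ s' ∈ Set.Icc p q, |s - s'| ≤ h →
      ∀ z, 1 + ‖z‖ ≤ R * exp (2 * κ * (q - p)) → ‖b s z - b s' z‖ ≤ ω)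
    (n : ℕ) (hn : n * h ≤ q - p) :
    |(∫ z, φ z * g q z) - ∫ z, eulerBack b φ q h n z * g (q - n * h) z| ≤
      ∫ s in (q - n * h)..q, ℓ * exp (Λ * (q - p)) * Γ *
        ((1 + h * Λ) * (η s + ω) + h * Λ * (κ * (R * exp (2 * κ * (q - p))))) := by
  have hℓ0 : 0 ≤ ℓ := (norm_nonneg _).trans (hℓ 0)
  set B : ℝ → ℝ := fun s => ℓ * exp (Λ * (q - p)) * Γ *
        ((1 + h * Λ) * (η s + ω) + h * Λ * (κ * (R * exp (2 * κ * (q - p))))) with hB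
  have hBi : IntervalIntegrable B volume p q :=
    (((hηi.add intervalIntegrable_const).const_mul _).add intervalIntegrable_const).const_mul _
  have hsub : ∀ x ∈ Set.Icc p q, ∀ y ∈ Set.Icc p q, IntervalIntegrable B volume x y := by
    intro x hx y hy
    refine hBi.mono_set ?_
    rw [Set.uIcc_of_le (hx.1.trans hx.2)]
    exact Set.uIcc_subset_Icc hx hy
  induction n with
  | zero => simp [eulerBack]
  | succ n ih =>
    have hn' := euler_pred_le hh hn
    have hσ := euler_node_mem hh hn
    have hτ := euler_node_mem hh hn'
    have hq : q ∈ Set.Icc p q := ⟨hτ.1.trans hτ.2, le_rfl⟩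
    set σ := q - (n + 1 : ℕ) * h with hσdef
    set τ := q - n * h with hτdef
    have hτσ : τ - σ = h := by rw [hσdef, hτdef]; push_cast; ring
    set ψ := eulerBack b φ q h n with hψ
    set F : ℝ → ℝ := fun r => ∫ z, ψ (z + (τ - r) • b σ z) * g r z with hF
    have hexp : exp (2 * κ * (n * h)) * exp (2 * κ * h) ≤ exp (2 * κ * (q - p)) := by
      rw [← Real.exp_add]
      apply exp_le_exp.2
      push_cast at hn
      nlinarith
    have hRR : R * exp (2 * κ * (n * h)) * exp (2 * κ * h) ≤ R * exp (2 * κ * (q - p)) := by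
      rw [mul_assoc]; exact mul_le_mul_of_nonneg_left hexp hR0
    have hΓ0 : 0 ≤ Γ := (integral_nonneg fun z => abs_nonneg _).trans (hΓ q hq)
    have hstep : |F τ - F σ| ≤ ∫ s in σ..τ, B s := by
      refine abs_sub_le_integral_of_hasDerivAt (by linarith) (hsub σ hσ τ hτ) fun s hs => ?_
      have hsI : s ∈ Set.Icc p q := ⟨hσ.1.trans hs.1, hs.2.trans hτ.2⟩
      obtain ⟨J, hJ, hJd⟩ := hg.hasDerivAt_euler hI (β := b σ) (ψ := ψ)
        (ℓ := ℓ * exp (Λ * (q - p))) (Λ := Λ)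
        (κ := κ) (R := R * exp (2 * κ * (n * h))) (ω := ω) (η := η s) (Γ := Γ) (s := s) (τ := τ)
        (h := h) (hpq hsI) hs.2 (by linarith [hs.1]) (hb.contDiff_eulerBack hφ hh hn')
        (hb.contDiff σ hσ)
        (fun z => (hb.norm_fderiv_eulerBack_le hφ hℓ hh hn' z).trans
          (mul_le_mul_of_nonneg_left (exp_le_exp.2 (mul_le_mul_of_nonneg_left hn' hΛ)) hℓ0))
        (fun z hz => hb.eulerBack_eq_zero hκ hR hh (by linarith) hn' z hz)
        (hb.norm_fderiv_le σ hσ) hκ (hb.norm_le σ hσ) hκh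
        (fun z hz => (norm_sub_le_norm_sub_add_norm_sub _ (b s z) _).trans
          (add_le_add (hη s hsI z (hz.trans hRR))
            (hω s hsI σ hσ (by rw [abs_of_nonneg (by linarith [hs.1])]; linarith [hs.2]) z
              (hz.trans hRR))))
        (add_nonneg (hη0 s) hω0) (hΓ s hsI) (by positivity)
      refine ⟨J, hJ.trans ?_, hJd⟩
      simp only [hB]
      gcongr
    have e1 : F τ = ∫ z, ψ z * g τ z := by simp [hF]
    have e2 : F σ = ∫ z, eulerBack b φ q h (n + 1) z * g σ z := by
      simp only [hF, hτσ, eulerBack]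
      rfl
    rw [← e2, ← intervalIntegral.integral_add_adjacent_intervals (hsub σ hσ τ hτ) (hsub τ hτ q hq)]
    have h1 := ih hn'
    rw [← e1] at h1
    have h2 := abs_add_le ((∫ z, φ z * g q z) - F τ) (F τ - F σ)
    rw [sub_add_sub_cancel] at h2
    linarith

/-- A transported density is tested, up to a small error, by the backward Euler transport of the
test function along a nearby tame field. -/
theorem IsTransportedBy.eventually_abs_integral_sub_eulerBack_le (hg : IsTransportedBy c g I)
    (hI : IsOpen I) (hle : p ≤ q)
    (hpq : Set.Icc p q ⊆ I) (hb : IsTameField b Λ κ p q) (hκ : 0 ≤ κ) (hΛ : 0 ≤ Λ)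
    (hφ : ContDiff ℝ 1 φ) (hℓ : ∀ z, ‖fderiv ℝ φ z‖ ≤ ℓ)
    (hR0 : 0 ≤ R) (hR : ∀ z, R < 1 + ‖z‖ → φ z = 0)
    (hηi : IntervalIntegrable η volume p q) (hη0 : ∀ s, 0 ≤ η s)
    (hη : ∀ s ∈ Set.Icc p q, ∀ z, 1 + ‖z‖ ≤ R * exp (2 * κ * (q - p)) → ‖c s z - b s z‖ ≤ η s)
    (hΓ : ∀ s ∈ Set.Icc p q, ∫ z, |g s z| ≤ Γ) {ε : ℝ} (hε : 0 < ε) :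
    ∀ᶠ n : ℕ in atTop,
      |(∫ z, φ z * g q z) - ∫ z, eulerBack b φ q ((q - p) / n) n z * g p z| ≤
        ℓ * exp (Λ * (q - p)) * Γ * (∫ s in p..q, η s) + ε := by
  have hℓ0 : 0 ≤ ℓ := (norm_nonneg _).trans (hℓ 0)
  have hΓ0 : 0 ≤ Γ := (integral_nonneg fun z => abs_nonneg _).trans (hΓ q ⟨hle, le_rfl⟩)
  set A := ℓ * exp (Λ * (q - p)) * Γ with hA
  have hA0 : 0 ≤ A := by positivity
  set R' := R * exp (2 * κ * (q - p)) with hR'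
  obtain ⟨ω, hω, hAω⟩ : ∃ ω > 0, A * (q - p) * ω < ε := by
    refine ⟨ε / (A * (q - p) + 1), by have := sub_nonneg.2 hle; positivity, ?_⟩
    have : 0 ≤ A * (q - p) := mul_nonneg hA0 (sub_nonneg.2 hle)
    rw [mul_div_assoc', div_lt_iff₀ (by linarith)]
    nlinarith
  have := FiniteDimensional.proper_real E
  have huc := ((isCompact_Icc (a := p) (b := q)).prod
    (isCompact_closedBall (0 : E) R')).uniformContinuousOn_of_continuous
    (hb.continuousOn.mono (Set.prod_mono_right (Set.subset_univ _)))
  rw [Metric.uniformContinuousOn_iff] at huc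
  obtain ⟨δ, hδ, huc⟩ := huc ω hω
  have hlim : Tendsto (fun n : ℕ => (q - p) / n) atTop (𝓝 0) :=
    tendsto_const_div_atTop_nhds_zero_nat _
  have hcont : Tendsto (fun h : ℝ => A * ((1 + h * Λ) * ((∫ s in p..q, η s) + (q - p) * ω) +
      (q - p) * (h * Λ * (κ * R')))) (𝓝 0)
      (𝓝 (A * ((∫ s in p..q, η s) + (q - p) * ω))) := by
    have : Continuous fun h : ℝ => A * ((1 + h * Λ) * ((∫ s in p..q, η s) + (q - p) * ω) +
      (q - p) * (h * Λ * (κ * R'))) := by fun_prop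
    have h2 := this.tendsto 0
    simpa using h2
  have hκl : Tendsto (fun h : ℝ => κ * h) (𝓝 0) (𝓝 0) := by
    have hc : Continuous fun h : ℝ => κ * h := by fun_prop
    simpa using hc.tendsto 0
  filter_upwards [hlim.eventually_lt_const hδ, (hcont.comp hlim).eventually_lt_const
    (show A * ((∫ s in p..q, η s) + (q - p) * ω) < A * (∫ s in p..q, η s) + ε by
      rw [mul_add]; linarith), (hκl.comp hlim).eventually_lt_const (show (0 : ℝ) < 1 / 4 by norm_num),
    eventually_ge_atTop 1] with n h1 h2 h3 h4
  have hn0 : (n : ℝ) ≠ 0 := by exact_mod_cast (by omega : n ≠ 0)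
  have hnh : n * ((q - p) / n) = q - p := mul_div_cancel₀ _ hn0
  have hh : 0 ≤ (q - p) / n := div_nonneg (sub_nonneg.2 hle) (Nat.cast_nonneg n)
  have key := hg.abs_integral_sub_eulerBack_le hI hpq hb hκ hΛ hφ hℓ hR0 hR hηi hη0 hη hΓ hh
    h3.le hω.le (fun s hs s' hs' hss z hz => by
      have hzB : z ∈ Metric.closedBall (0 : E) R' := by
        rw [mem_closedBall_zero_iff]; linarith
      have := huc (s, z) ⟨hs, hzB⟩ (s', z) ⟨hs', hzB⟩ (by
        rw [Prod.dist_eq, dist_self, max_lt_iff, Real.dist_eq]; exact ⟨by linarith, hδ⟩)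
      rw [dist_eq_norm] at this
      exact this.le) n hnh.le
  rw [hnh, sub_sub_cancel] at key
  refine key.trans (le_trans (le_of_eq ?_) h2.le)
  simp only [Function.comp_apply]
  rw [intervalIntegral.integral_const_mul, intervalIntegral.integral_add
    ((hηi.add intervalIntegrable_const).const_mul _) intervalIntegrable_const,
    intervalIntegral.integral_const_mul,
    intervalIntegral.integral_add hηi intervalIntegrable_const]
  simp only [intervalIntegral.integral_const, smul_eq_mul]
  rfl

end Euler

section MeanField

variable {E : Type*} [NormedAddCommGroup E] [NormedSpace ℝ E] [FiniteDimensional ℝ E]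
  [MeasureSpace E] [BorelSpace E] [(volume : Measure E).IsAddHaarMeasure]

/-- The mean field `𝒦ρ` generated by a (signed) density `ρ`. -/
def meanField (K : E × E → E) (ρ : E → ℝ) (z : E) : E := ∫ z', ρ z' • K (z, z')

variable {K : E × E → E} {L : ℝ} {ρ σ : E → ℝ}

lemma IsInteractionKernel.integrable_smul (h : IsInteractionKernel K L) (hρ : Integrable ρ)
    {w : E} (hw : Integrable fun z' => ρ z' • K (w, z')) (z : E) :
    Integrable fun z' => ρ z' • K (z, z') := by
  have h1 : Integrable fun z' => ρ z' • (K (z, z') - K (w, z')) := by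
    refine (hρ.norm.const_mul (L * ‖z - w‖)).mono'
      (hρ.aestronglyMeasurable.smul (Continuous.aestronglyMeasurable ?_)) (.of_forall fun z' => ?_)
    · exact (h.continuous.comp (Continuous.prodMk_right z)).sub
        (h.continuous.comp (Continuous.prodMk_right w))
    · rw [norm_smul, mul_comm]
      exact mul_le_mul_of_nonneg_right (h.lip_fst z w z') (norm_nonneg _)
  refine (h1.add hw).congr (.of_forall fun z' => ?_)
  simp only [Pi.add_apply, smul_sub, sub_add_cancel]

lemma meanField_eq_zero (h : IsInteractionKernel K L) (hρ : Integrable ρ)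
    {w : E} (hw : ¬ Integrable fun z' => ρ z' • K (w, z')) (z : E) : meanField K ρ z = 0 :=
  integral_undef fun h' => hw (h.integrable_smul hρ h' w)

lemma meanField_sub (h : IsInteractionKernel K L) (hρ : Integrable ρ)
    {v : E} (hv : Integrable fun z' => ρ z' • K (v, z')) (z w : E) :
    meanField K ρ z - meanField K ρ w = ∫ z', ρ z' • (K (z, z') - K (w, z')) := by
  simp only [meanField, smul_sub]
  rw [integral_sub (h.integrable_smul hρ hv z) (h.integrable_smul hρ hv w)]

lemma norm_integral_smul_kernel_sub_le (h : IsInteractionKernel K L) (hρ : Integrable ρ)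
    (z w : E) : ‖∫ z', ρ z' • (K (z, z') - K (w, z'))‖ ≤ L * ‖z - w‖ * ∫ z', |ρ z'| := by
  rw [← integral_const_mul]
  refine norm_integral_le_of_norm_le (hρ.abs.const_mul _) (.of_forall fun z' => ?_)
  rw [norm_smul, mul_comm]
  exact mul_le_mul_of_nonneg_right (h.lip_fst z w z') (norm_nonneg _)

lemma norm_meanField_sub_le (h : IsInteractionKernel K L) (hρ : Integrable ρ) (z w : E) :
    ‖meanField K ρ z - meanField K ρ w‖ ≤ L * ‖z - w‖ * ∫ z', |ρ z'| := by
  by_cases hw : Integrable fun z' => ρ z' • K (w, z')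
  · rw [meanField_sub h hρ hw]
    exact norm_integral_smul_kernel_sub_le h hρ z w
  · rw [meanField_eq_zero h hρ hw, meanField_eq_zero h hρ hw, sub_self, norm_zero]
    have := h.nonneg
    have : 0 ≤ ∫ z', |ρ z'| := integral_nonneg fun _ => abs_nonneg _
    positivity

lemma continuous_meanField (h : IsInteractionKernel K L) (hρ : Integrable ρ) :
    Continuous (meanField K ρ) := by
  have hL := h.nonneg
  have h0 : 0 ≤ ∫ z', |ρ z'| := integral_nonneg fun _ => abs_nonneg _
  refine (LipschitzWith.of_dist_le_mul (K := (L * ∫ z', |ρ z'|).toNNReal) fun z w => ?_).continuous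
  rw [dist_eq_norm, dist_eq_norm, Real.coe_toNNReal _ (by positivity)]
  linarith [norm_meanField_sub_le h hρ z w]

/-- Weak solutions of the mean field equation in `C(ℝ; L¹)`, without initial data. -/
structure IsL1Solution (K : E × E → E) (g : ℝ → E → ℝ) : Prop where
  integrable : ∀ t, Integrable (g t)
  tendsto : ∀ t₀, Tendsto (fun t => ∫ z, |g t z - g t₀ z|) (𝓝 t₀) (𝓝 0)
  weak : ∀ φ : E → ℝ, ContDiff ℝ 1 φ → (∃ C : ℝ, ∀ z, |φ z| ≤ C) →
    (∃ C : ℝ, ∀ z, ‖fderiv ℝ φ z‖ ≤ C) → ∀ t,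
      HasDerivAt (fun s => ∫ z, φ z * g s z)
        (∫ z, fderiv ℝ φ z (meanField K (g t) z) * g t z) t

variable {g : ℝ → E → ℝ}

lemma ContDiff.bounds_of_hasCompactSupport {φ : E → ℝ} (hφ : ContDiff ℝ 1 φ)
    (hs : HasCompactSupport φ) :
    (∃ C : ℝ, ∀ z, |φ z| ≤ C) ∧ ∃ C : ℝ, ∀ z, ‖fderiv ℝ φ z‖ ≤ C :=
  ⟨hs.exists_bound_of_continuous hφ.continuous,
    (hs.fderiv (𝕜 := ℝ)).exists_bound_of_continuous (hφ.continuous_fderiv one_ne_zero)⟩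

lemma IsL1Solution.isTransportedBy (h : IsInteractionKernel K L) (hg : IsL1Solution K g) :
    IsTransportedBy (fun t => meanField K (g t)) g Set.univ where
  integrable t _ := hg.integrable t
  tendsto t _ := by rw [nhdsWithin_univ]; exact hg.tendsto t
  field_continuous t _ := continuous_meanField h (hg.integrable t)
  hasDerivAt φ hφ hs t _ :=
    hg.weak φ hφ (hφ.bounds_of_hasCompactSupport hs).1 (hφ.bounds_of_hasCompactSupport hs).2 t

lemma IsL1Solution.integral_eq (hg : IsL1Solution K g) (t : ℝ) :
    ∫ z, g t z = ∫ z, g 0 z := by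
  have h1 : ∀ s, HasDerivAt (fun s => ∫ z, g s z) 0 s := fun s => by
    have := hg.weak (fun _ => 1) contDiff_const ⟨1, by simp⟩ ⟨0, by simp⟩ s
    simpa using this
  exact is_const_of_deriv_eq_zero (fun s => (h1 s).differentiableAt) (fun s => (h1 s).deriv) t 0

lemma IsL1Solution.continuous_integral_abs (hg : IsL1Solution K g) :
    Continuous fun t => ∫ z, |g t z| := by
  refine continuous_iff_continuousAt.2 fun t₀ => ?_
  rw [ContinuousAt, tendsto_iff_dist_tendsto_zero]
  refine squeeze_zero (fun _ => dist_nonneg) (fun t => ?_) (hg.tendsto t₀)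
  rw [Real.dist_eq, ← integral_sub (hg.integrable t).abs (hg.integrable t₀).abs,
    ← Real.norm_eq_abs]
  exact norm_integral_le_of_norm_le ((hg.integrable t).sub (hg.integrable t₀)).abs
    (.of_forall fun z => abs_abs_sub_abs_le_abs_sub _ _)

lemma IsL1Solution.exists_mass_bound (hg : IsL1Solution K g) (p q : ℝ) :
    ∃ Γ : ℝ, 0 ≤ Γ ∧ ∀ s ∈ Set.Icc p q, ∫ z, |g s z| ≤ Γ := by
  obtain ⟨Γ, hΓ⟩ := (isCompact_Icc (a := p) (b := q)).exists_bound_of_continuousOn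
    hg.continuous_integral_abs.continuousOn
  refine ⟨max Γ 0, le_max_right _ _, fun s hs => ?_⟩
  exact (le_abs_self _).trans ((hΓ s hs).trans (le_max_left _ _))

/-- The mean field equation is invariant under time reversal together with `K ↦ -K`. -/
lemma IsL1Solution.neg (hg : IsL1Solution K g) :
    IsL1Solution (fun p => -K p) (fun t => g (-t)) where
  integrable t := hg.integrable _
  tendsto t₀ := by
    have h1 : Tendsto (fun t : ℝ => -t) (𝓝 t₀) (𝓝 (-t₀)) := tendsto_neg t₀
    exact (hg.tendsto (-t₀)).comp h1
  weak φ hφ hb hb' t := by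
    have h1 := (hg.weak φ hφ hb hb' (-t)).comp t (hasDerivAt_neg t)
    refine h1.congr_deriv ?_
    rw [mul_neg_one, ← integral_neg]
    refine integral_congr_ae (.of_forall fun z => ?_)
    simp only [meanField, smul_neg, integral_neg, map_neg, neg_mul]

end MeanField

section KernelIntegral

variable {E : Type*} [NormedAddCommGroup E] [NormedSpace ℝ E] [FiniteDimensional ℝ E]
  [MeasurableSpace E] [BorelSpace E]
  {α : Type*} [MeasurableSpace α] {m : Measure α}
  {K : E × E → E} {L : ℝ} {ρ : α → ℝ} {Y : α → E}

lemma IsInteractionKernel.norm_fderiv_fst_le (h : IsInteractionKernel K L) (z z' : E) :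
    ‖fderiv ℝ (fun u => K (u, z')) z‖ ≤ L := by
  have hl : LipschitzWith L.toNNReal fun u => K (u, z') := by
    refine LipschitzWith.of_dist_le_mul fun u v => ?_
    rw [dist_eq_norm, dist_eq_norm, Real.coe_toNNReal _ h.nonneg]
    exact h.lip_fst u v z'
  have := norm_fderiv_le_of_lipschitz ℝ hl (x₀ := z)
  rwa [Real.coe_toNNReal _ h.nonneg] at this

lemma IsInteractionKernel.aestronglyMeasurable_comp (h : IsInteractionKernel K L)
    (hY : AEStronglyMeasurable Y m) (z : E) : AEStronglyMeasurable (fun a => K (z, Y a)) m :=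
  (h.continuous.comp (Continuous.prodMk_right z)).comp_aestronglyMeasurable hY

lemma IsInteractionKernel.integrable_smul_sub (h : IsInteractionKernel K L) (hρ : Integrable ρ m)
    (hY : AEStronglyMeasurable Y m) (z w : E) :
    Integrable (fun a => ρ a • (K (z, Y a) - K (w, Y a))) m := by
  refine (hρ.norm.const_mul (L * ‖z - w‖)).mono' (hρ.aestronglyMeasurable.smul
    ((h.aestronglyMeasurable_comp hY z).sub (h.aestronglyMeasurable_comp hY w)))
    (.of_forall fun a => ?_)
  rw [norm_smul, mul_comm]
  exact mul_le_mul_of_nonneg_right (h.lip_fst z w (Y a)) (norm_nonneg _)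

lemma IsInteractionKernel.norm_integral_smul_sub_le (h : IsInteractionKernel K L)
    (hρ : Integrable ρ m) (z w : E) :
    ‖∫ a, ρ a • (K (z, Y a) - K (w, Y a)) ∂m‖ ≤ L * ‖z - w‖ * ∫ a, |ρ a| ∂m := by
  rw [← integral_const_mul]
  refine norm_integral_le_of_norm_le (hρ.abs.const_mul _) (.of_forall fun a => ?_)
  rw [norm_smul, mul_comm]
  exact mul_le_mul_of_nonneg_right (h.lip_fst z w (Y a)) (norm_nonneg _)

lemma IsInteractionKernel.contDiff_integral (h : IsInteractionKernel K L) (hρ : Integrable ρ m)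
    (hY : AEStronglyMeasurable Y m) (w : E) :
    ContDiff ℝ 1 (fun z => ∫ a, ρ a • (K (z, Y a) - K (w, Y a)) ∂m) := by
  have hd : ∀ z z', HasFDerivAt (fun u => K (u, z'))
      ((fderiv ℝ K (z, z')).comp (ContinuousLinearMap.inl ℝ E E)) z := fun z z' => by
    have h1 := (h.contDiff.differentiable one_ne_zero (z, z')).hasFDerivAt
    exact h1.comp z (hasFDerivAt_prodMk_left z z')
  have hc : Continuous fun p : E × E =>
      (fderiv ℝ K p).comp (ContinuousLinearMap.inl ℝ E E) :=
    (h.contDiff.continuous_fderiv one_ne_zero).clm_comp continuous_const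
  have hb : ∀ z z', ‖(fderiv ℝ K (z, z')).comp (ContinuousLinearMap.inl ℝ E E)‖ ≤ L :=
    fun z z' => by rw [← (hd z z').fderiv]; exact h.norm_fderiv_fst_le z z'
  have hm : ∀ z, AEStronglyMeasurable (fun a => ρ a •
      (fderiv ℝ K (z, Y a)).comp (ContinuousLinearMap.inl ℝ E E)) m := fun z =>
    hρ.aestronglyMeasurable.smul
      ((hc.comp (Continuous.prodMk_right z)).comp_aestronglyMeasurable hY)
  have hbound : ∀ z a, ‖ρ a • (fderiv ℝ K (z, Y a)).comp (ContinuousLinearMap.inl ℝ E E)‖ ≤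
      L * ‖ρ a‖ := fun z a => by
    rw [norm_smul, mul_comm]
    exact mul_le_mul_of_nonneg_right (hb z (Y a)) (norm_nonneg _)
  have hD : ∀ z, HasFDerivAt (fun z => ∫ a, ρ a • (K (z, Y a) - K (w, Y a)) ∂m)
      (∫ a, ρ a • (fderiv ℝ K (z, Y a)).comp (ContinuousLinearMap.inl ℝ E E) ∂m) z := by
    intro z
    refine hasFDerivAt_integral_of_dominated_of_fderiv_le (bound := fun a => L * ‖ρ a‖)
      (Filter.univ_mem) (.of_forall fun u => ?_) (h.integrable_smul_sub hρ hY z w)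
      (hm z) (.of_forall fun a u _ => hbound u a) (hρ.norm.const_mul L)
      (.of_forall fun a u _ => ?_)
    · exact (h.integrable_smul_sub hρ hY u w).aestronglyMeasurable
    · exact ((hd u (Y a)).sub_const _).const_smul (ρ a)
  refine contDiff_one_iff_hasFDerivAt.2 ⟨_, ?_, hD⟩
  refine continuous_of_dominated hm (fun z => .of_forall (hbound z)) (hρ.norm.const_mul L)
    (.of_forall fun a => ?_)
  exact (hc.comp (Continuous.prodMk_left (Y a))).const_smul (ρ a)

lemma IsInteractionKernel.norm_fderiv_integral_le (h : IsInteractionKernel K L)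
    (hρ : Integrable ρ m) (hY : AEStronglyMeasurable Y m) (w z : E) :
    ‖fderiv ℝ (fun z => ∫ a, ρ a • (K (z, Y a) - K (w, Y a)) ∂m) z‖ ≤ L * ∫ a, |ρ a| ∂m := by
  have h0 : 0 ≤ L * ∫ a, |ρ a| ∂m := mul_nonneg h.nonneg (integral_nonneg fun _ => abs_nonneg _)
  have hl : LipschitzWith (L * ∫ a, |ρ a| ∂m).toNNReal
      fun z => ∫ a, ρ a • (K (z, Y a) - K (w, Y a)) ∂m := by
    refine LipschitzWith.of_dist_le_mul fun u v => ?_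
    rw [dist_eq_norm, dist_eq_norm, Real.coe_toNNReal _ h0,
      ← integral_sub (h.integrable_smul_sub hρ hY u w) (h.integrable_smul_sub hρ hY v w)]
    have := h.norm_integral_smul_sub_le (Y := Y) hρ u v
    simp only [← smul_sub, sub_sub_sub_cancel_right]
    linarith
  have := norm_fderiv_le_of_lipschitz ℝ hl (x₀ := z)
  rwa [Real.coe_toNNReal _ h0] at this

end KernelIntegral

section Duality

variable {E : Type*} [NormedAddCommGroup E] [NormedSpace ℝ E] [FiniteDimensional ℝ E]
  [MeasureSpace E] [BorelSpace E] [(volume : Measure E).IsAddHaarMeasure]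

variable (E) in
/-- A `C¹` cutoff with values in `[0, 1]`, equal to `1` near the origin and compactly supported. -/
lemma exists_contDiff_cutoff : ∃ χ : E → ℝ, ∃ C : ℝ, ContDiff ℝ 1 χ ∧ 0 ≤ C ∧
    (∀ z, ‖z‖ ≤ 1 → χ z = 1) ∧ (∀ z, 2 ≤ ‖z‖ → χ z = 0) ∧ (∀ z, 0 ≤ χ z) ∧ (∀ z, χ z ≤ 1) ∧
    ∀ z, ‖fderiv ℝ χ z‖ ≤ C := by
  let B : ContDiffBump (0 : E) := ⟨1, 2, by norm_num, by norm_num⟩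
  have hB : ContDiff ℝ 1 B := B.contDiff
  obtain ⟨C, hC⟩ := (hB.bounds_of_hasCompactSupport B.hasCompactSupport).2
  refine ⟨B, C, hB, (norm_nonneg _).trans (hC 0), fun z hz => ?_, fun z hz => ?_,
    fun z => B.nonneg, fun z => B.le_one, hC⟩
  · exact B.one_of_mem_closedBall (by simpa using hz)
  · exact B.zero_of_le_dist (by simpa using hz)

/-- A density tested against compactly supported functions with gradient at most `1` gives at most
`β`. -/
def IsDualBound (ρ : E → ℝ) (β : ℝ) : Prop :=
  ∀ φ : E → ℝ, ContDiff ℝ 1 φ → HasCompactSupport φ → (∀ z, ‖fderiv ℝ φ z‖ ≤ 1) →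
    |∫ z, φ z * ρ z| ≤ β

lemma IsDualBound.abs_integral_le {ρ : E → ℝ} {β : ℝ} (hβ : IsDualBound ρ β) {φ : E → ℝ}
    (hφ : ContDiff ℝ 1 φ) (hs : HasCompactSupport φ) {ℓ : ℝ} (hℓ : 0 < ℓ)
    (hφℓ : ∀ z, ‖fderiv ℝ φ z‖ ≤ ℓ) : |∫ z, φ z * ρ z| ≤ ℓ * β := by
  have h1 := hβ (fun z => ℓ⁻¹ * φ z) (contDiff_const.mul hφ) (hs.mul_left) fun z => by
    rw [fderiv_const_mul (hφ.differentiable one_ne_zero z), norm_smul, norm_inv, norm_eq_abs,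
      abs_of_pos hℓ, inv_mul_le_iff₀ hℓ, mul_one]
    exact hφℓ z
  simp only [mul_assoc, integral_const_mul, abs_mul, abs_inv, abs_of_pos hℓ] at h1
  rwa [inv_mul_le_iff₀ hℓ] at h1

variable (E) in
/-- The dual bound extends, up to a constant, to all globally Lipschitz `C¹` test functions. -/
lemma exists_abs_integral_le_of_isDualBound : ∃ C : ℝ, 0 < C ∧ ∀ (ρ : E → ℝ) (β : ℝ),
    Integrable ρ → Integrable (fun z => ‖z‖ * |ρ z|) → ∫ z, ρ z = 0 → IsDualBound ρ β →
    ∀ (φ : E → ℝ) (ℓ : ℝ), ContDiff ℝ 1 φ → 0 < ℓ → (∀ z, ‖fderiv ℝ φ z‖ ≤ ℓ) →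
      |∫ z, φ z * ρ z| ≤ C * ℓ * β := by
  obtain ⟨χ, C, hχ, hC0, hχ1, hχ2, hχ0, hχle, hC⟩ := exists_contDiff_cutoff E
  refine ⟨1 + 2 * C, by positivity, fun ρ β hρ hm h0 hβ φ ℓ hφ hℓ hφℓ => ?_⟩
  have hlip : ∀ z, ‖φ z - φ 0‖ ≤ ℓ * ‖z‖ := fun z => by
    simpa using convex_univ.norm_image_sub_le_of_norm_fderiv_le
      (fun x _ => hφ.differentiable one_ne_zero x) (fun x _ => hφℓ x)
      (Set.mem_univ (0 : E)) (Set.mem_univ z)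
  have hInt : Integrable (fun z => (φ z - φ 0) * ρ z) := by
    refine (hm.const_mul ℓ).mono' ((hφ.continuous.sub continuous_const).aestronglyMeasurable.mul
      hρ.aestronglyMeasurable) (.of_forall fun z => ?_)
    rw [norm_mul, ← mul_assoc]
    exact mul_le_mul_of_nonneg_right (hlip z) (abs_nonneg _)
  have heq : ∫ z, φ z * ρ z = ∫ z, (φ z - φ 0) * ρ z := by
    have h1 : ∫ z, φ z * ρ z = ∫ z, ((φ z - φ 0) * ρ z + φ 0 * ρ z) :=
      integral_congr_ae (.of_forall fun z => by ring)
    rw [h1, integral_add hInt (hρ.const_mul _), integral_const_mul, h0, mul_zero, add_zero]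
  rw [heq]
  have hn : ∀ n : ℕ, (0 : ℝ) < n + 1 := fun n => by positivity
  have hcut : ∀ n : ℕ,
      |∫ z, χ ((n + 1 : ℝ)⁻¹ • z) * (φ z - φ 0) * ρ z| ≤ (1 + 2 * C) * ℓ * β := fun n => by
    have hχn : ContDiff ℝ 1 fun z : E => χ ((n + 1 : ℝ)⁻¹ • z) :=
      hχ.comp (contDiff_const_smul _)
    have hzero : ∀ z : E, 2 * (n + 1 : ℝ) ≤ ‖z‖ → χ ((n + 1 : ℝ)⁻¹ • z) = 0 := fun z hz => by
      refine hχ2 _ ?_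
      rw [norm_smul, norm_inv, norm_eq_abs, abs_of_pos (hn n), le_inv_mul_iff₀ (hn n)]
      linarith
    refine IsDualBound.abs_integral_le hβ (hχn.mul (hφ.sub contDiff_const)) ?_ (by positivity)
      fun z => ?_
    · refine hasCompactSupport_of_norm (R := 1 + 2 * (n + 1 : ℝ)) fun z hz => ?_
      simp only [hzero z (by linarith), zero_mul]
    · have hd1 : HasFDerivAt (fun z : E => χ ((n + 1 : ℝ)⁻¹ • z))
          ((n + 1 : ℝ)⁻¹ • fderiv ℝ χ ((n + 1 : ℝ)⁻¹ • z)) z := by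
        have := (hχ.differentiable one_ne_zero ((n + 1 : ℝ)⁻¹ • z)).hasFDerivAt.comp z
          ((hasFDerivAt_id z).const_smul ((n + 1 : ℝ)⁻¹))
        refine this.congr_fderiv ?_
        ext v; simp
      have hd2 : HasFDerivAt (fun z => φ z - φ 0) (fderiv ℝ φ z) z :=
        (hφ.differentiable one_ne_zero z).hasFDerivAt.sub_const _
      rw [HasFDerivAt.fderiv (f := fun x => χ ((n + 1 : ℝ)⁻¹ • x) * (φ x - φ 0)) (hd1.mul hd2)]
      refine (norm_add_le _ _).trans ?_
      rw [norm_smul, norm_smul, norm_smul, norm_eq_abs (χ _), abs_of_nonneg (hχ0 _)]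
      have h2 : χ ((n + 1 : ℝ)⁻¹ • z) * ‖fderiv ℝ φ z‖ ≤ 1 * ℓ :=
        mul_le_mul (hχle _) (hφℓ z) (norm_nonneg _) zero_le_one
      have h3 : ‖φ z - φ 0‖ * (‖(n + 1 : ℝ)⁻¹‖ * ‖fderiv ℝ χ ((n + 1 : ℝ)⁻¹ • z)‖) ≤
          2 * C * ℓ := by
        rcases le_or_gt ‖z‖ (2 * (n + 1 : ℝ)) with hz | hz
        · calc _ ≤ (ℓ * ‖z‖) * (‖(n + 1 : ℝ)⁻¹‖ * C) := by
                gcongr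
                · exact hlip z
                · exact hC _
            _ ≤ (ℓ * (2 * (n + 1 : ℝ))) * (‖(n + 1 : ℝ)⁻¹‖ * C) := by gcongr
            _ = 2 * C * ℓ := by
                rw [norm_inv, norm_eq_abs, abs_of_pos (hn n)]; field_simp
        · have h4 : fderiv ℝ (fun z : E => χ ((n + 1 : ℝ)⁻¹ • z)) z = 0 := by
            have : (fun z : E => χ ((n + 1 : ℝ)⁻¹ • z)) =ᶠ[𝓝 z] fun _ => 0 := by
              filter_upwards [(isOpen_lt continuous_const continuous_norm).mem_nhds hz] with y hy
              exact hzero y (le_of_lt hy)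
            rw [this.fderiv_eq]; simp
          rw [hd1.fderiv] at h4
          rw [← norm_smul, h4, norm_zero, mul_zero]
          positivity
      nlinarith
  have hlim : Tendsto (fun n : ℕ => ∫ z, χ ((n + 1 : ℝ)⁻¹ • z) * (φ z - φ 0) * ρ z) atTop
      (𝓝 (∫ z, (φ z - φ 0) * ρ z)) := by
    refine tendsto_integral_of_dominated_convergence (fun z => ‖(φ z - φ 0) * ρ z‖) (fun n => ?_)
      hInt.norm (fun n => .of_forall fun z => ?_) (.of_forall fun z => ?_)
    · simp only [mul_assoc]
      exact ((hχ.continuous.comp (continuous_const_smul _)).aestronglyMeasurable).mul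
        hInt.aestronglyMeasurable
    · rw [mul_assoc, norm_mul, norm_eq_abs, abs_of_nonneg (hχ0 _)]
      exact mul_le_of_le_one_left (norm_nonneg _) (hχle _)
    · refine tendsto_const_nhds.congr' ?_
      filter_upwards [eventually_ge_atTop ⌈‖z‖⌉₊] with n hn'
      rw [hχ1, one_mul]
      rw [norm_smul, norm_inv, norm_eq_abs, abs_of_pos (hn n), inv_mul_le_iff₀ (hn n)]
      have := (Nat.le_ceil ‖z‖).trans (Nat.cast_le.mpr hn')
      linarith
  exact le_of_tendsto hlim.abs (.of_forall hcut)

variable (E) in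
/-- The mean field is controlled by the dual bound. -/
lemma exists_norm_meanField_sub_le_of_isDualBound : ∃ C : ℝ, 0 < C ∧
    ∀ (K : E × E → E) (L : ℝ), IsInteractionKernel K L → ∀ (ρ σ : E → ℝ) (β : ℝ),
    Integrable ρ → Integrable (fun z => ‖z‖ * |ρ z|) →
    Integrable σ → Integrable (fun z => ‖z‖ * |σ z|) →
    (∫ z, ρ z) = ∫ z, σ z → IsDualBound (fun z => ρ z - σ z) β →
      ∀ z, ‖meanField K ρ z - meanField K σ z‖ ≤ C * (L + 1) * β := by
  obtain ⟨C, hC0, hC⟩ := exists_abs_integral_le_of_isDualBound E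
  refine ⟨C, hC0, fun K L h ρ σ β hρ hρm hσ hσm h0 hβ z => ?_⟩
  have hK : ∀ τ : E → ℝ, Integrable τ → Integrable (fun z => ‖z‖ * |τ z|) →
      Integrable fun z' => τ z' • K (z, z') := fun τ hτ hτm => by
    have hdom : Integrable fun z' => L * ‖z‖ * |τ z'| + L * (‖z'‖ * |τ z'|) :=
      (hτ.abs.const_mul _).add (hτm.const_mul _)
    refine hdom.mono' (hτ.aestronglyMeasurable.smul
      (h.continuous.comp (Continuous.prodMk_right z)).aestronglyMeasurable)
      (.of_forall fun z' => ?_)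
    rw [norm_smul, norm_eq_abs]
    nlinarith [h.norm_le z z', abs_nonneg (τ z')]
  have hsub : meanField K ρ z - meanField K σ z = ∫ z', (ρ z' - σ z') • K (z, z') := by
    rw [meanField, meanField, ← integral_sub (hK ρ hρ hρm) (hK σ hσ hσm)]
    simp only [sub_smul]
  have hInt : Integrable fun z' => (ρ z' - σ z') • K (z, z') := by
    simp only [sub_smul]
    exact (hK ρ hρ hρm).sub (hK σ hσ hσm)
  rw [hsub]
  obtain ⟨e, he, hev⟩ := exists_dual_vector'' ℝ (∫ z', (ρ z' - σ z') • K (z, z'))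
  have h1 : ‖∫ z', (ρ z' - σ z') • K (z, z')‖ = ∫ z', e (K (z, z')) * (ρ z' - σ z') := by
    have h2 := e.integral_comp_comm hInt
    simp only [map_smul, smul_eq_mul] at h2
    refine Eq.trans (Eq.symm hev) ?_
    rw [← h2]
    simp only [mul_comm]
  rw [h1]
  refine (le_abs_self _).trans (hC _ β (hρ.sub hσ) ?_ ?_ hβ _ (L + 1) ?_ ?_ fun y => ?_)
  · refine (hρm.add hσm).mono' (continuous_norm.aestronglyMeasurable.mul
      (hρ.sub hσ).aestronglyMeasurable.norm) (.of_forall fun y => ?_)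
    rw [norm_mul, norm_norm, norm_eq_abs, abs_abs]
    simp only [Pi.add_apply]
    rw [← mul_add]
    exact mul_le_mul_of_nonneg_left (norm_sub_le (ρ y) (σ y)) (norm_nonneg y)
  · rw [integral_sub' hρ hσ, h0, sub_self]
  · exact e.contDiff.comp (h.contDiff.comp (contDiff_const.prodMk contDiff_id))
  · linarith [h.nonneg]
  · refine norm_fderiv_le_of_lipschitz (C := (L + 1).toNNReal) ℝ
      (LipschitzWith.of_dist_le_mul fun u v => ?_) |>.trans_eq
      (Real.coe_toNNReal _ (by linarith [h.nonneg]))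
    rw [dist_eq_norm, dist_eq_norm, ← map_sub, Real.coe_toNNReal _ (by linarith [h.nonneg])]
    refine (e.le_of_opNorm_le he _).trans ?_
    nlinarith [h.lip_snd z u v, norm_nonneg (u - v)]

end Duality

section Uniqueness

variable {E : Type*} [NormedAddCommGroup E] [NormedSpace ℝ E] [FiniteDimensional ℝ E]
  [MeasureSpace E] [BorelSpace E] [(volume : Measure E).IsAddHaarMeasure]

lemma IsTameField.mono {b : ℝ → E → E} {Λ κ p q p' q' : ℝ} (hb : IsTameField b Λ κ p q)
    (hp : p ≤ p') (hq : q' ≤ q) : IsTameField b Λ κ p' q' where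
  contDiff t ht := hb.contDiff t ⟨hp.trans ht.1, ht.2.trans hq⟩
  norm_fderiv_le t ht := hb.norm_fderiv_le t ⟨hp.trans ht.1, ht.2.trans hq⟩
  norm_le t ht := hb.norm_le t ⟨hp.trans ht.1, ht.2.trans hq⟩
  continuousOn := hb.continuousOn.mono
    (Set.prod_mono (Set.Icc_subset_Icc hp hq) subset_rfl)

lemma HasCompactSupport.exists_radius {φ : E → ℝ} (hs : HasCompactSupport φ) :
    ∃ R : ℝ, 0 ≤ R ∧ ∀ z, R < 1 + ‖z‖ → φ z = 0 := by
  obtain ⟨R, hR⟩ := hs.isCompact.isBounded.subset_closedBall 0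
  refine ⟨max (1 + R) 0, le_max_right _ _, fun z hz => ?_⟩
  by_contra hne
  have h1 := hR (subset_tsupport φ hne)
  rw [mem_closedBall_zero_iff] at h1
  linarith [le_max_left (1 + R) 0]

lemma ae_eq_of_isDualBound_zero {ρ σ : E → ℝ} (hρ : Integrable ρ) (hσ : Integrable σ)
    (h : ∀ β > 0, IsDualBound (fun z => ρ z - σ z) β) : ρ =ᵐ[volume] σ := by
  have hl : LocallyIntegrable (fun z => ρ z - σ z) := (hρ.sub hσ).locallyIntegrable
  have h0 := ae_eq_zero_of_integral_contDiff_smul_eq_zero hl fun φ hφ hs => by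
    have hφ1 : ContDiff ℝ 1 φ := hφ.of_le (by exact_mod_cast le_top)
    obtain ⟨C, hC⟩ := (hφ1.bounds_of_hasCompactSupport hs).2
    have hC0 : 0 ≤ C := (norm_nonneg _).trans (hC 0)
    have h1 : |∫ z, φ z * (ρ z - σ z)| ≤ 0 := by
      refine le_of_forall_pos_le_add fun ε hε => ?_
      have h2 := (h (ε / (C + 1)) (by positivity)).abs_integral_le hφ1 hs (ℓ := C + 1)
        (by positivity) fun z => (hC z).trans (by linarith)
      rwa [mul_div_cancel₀ _ (by positivity), ← zero_add ε] at h2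
    simpa using h1
  filter_upwards [h0] with z hz
  exact sub_eq_zero.mp hz

variable {K : E × E → E} {L : ℝ} {f g : ℝ → E → ℝ} {κ p q M Γ β : ℝ}

lemma isDualBound_of_moment {ρ σ : E → ℝ} (hρ : Integrable ρ)
    (hρm : Integrable fun z => ‖z‖ * |ρ z|) (hσ : Integrable σ)
    (hσm : Integrable fun z => ‖z‖ * |σ z|) (h0 : (∫ z, ρ z) = ∫ z, σ z) :
    IsDualBound (fun z => ρ z - σ z) ((∫ z, ‖z‖ * |ρ z|) + ∫ z, ‖z‖ * |σ z|) := by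
  intro φ hφ hs hφ1
  have hlip : ∀ z, |φ z - φ 0| ≤ ‖z‖ := fun z => by
    simpa using convex_univ.norm_image_sub_le_of_norm_fderiv_le
      (fun x _ => hφ.differentiable one_ne_zero x) (fun x _ => hφ1 x)
      (Set.mem_univ (0 : E)) (Set.mem_univ z)
  have hb : ∀ z, ‖(φ z - φ 0) * (ρ z - σ z)‖ ≤ ‖z‖ * |ρ z| + ‖z‖ * |σ z| := fun z => by
    rw [norm_mul, ← mul_add]
    exact mul_le_mul (hlip z) (norm_sub_le _ _) (norm_nonneg _) (norm_nonneg _)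
  have hInt : Integrable fun z => (φ z - φ 0) * (ρ z - σ z) :=
    (hρm.add hσm).mono' ((hφ.continuous.sub continuous_const).aestronglyMeasurable.mul
      (hρ.sub hσ).aestronglyMeasurable) (.of_forall hb)
  have heq : ∫ z, φ z * (ρ z - σ z) = ∫ z, (φ z - φ 0) * (ρ z - σ z) := by
    have h1 : ∫ z, φ z * (ρ z - σ z) =
        ∫ z, ((φ z - φ 0) * (ρ z - σ z) + φ 0 * (ρ z - σ z)) :=
      integral_congr_ae (.of_forall fun z => by ring)
    have h2 : Integrable fun z => φ 0 * (ρ z - σ z) := (hρ.sub hσ).const_mul _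
    rw [h1, integral_add hInt h2, integral_const_mul,
      integral_sub hρ hσ, h0, sub_self, mul_zero, add_zero]
  rw [heq, ← integral_add hρm hσm]
  exact norm_integral_le_of_norm_le (hρm.add hσm) (.of_forall hb)

/-- The stability estimate between two solutions agreeing at time `p`: the dual distance
improves by a factor proportional to the elapsed time. -/
lemma IsL1Solution.isDualBound_of_isDualBound (h : IsInteractionKernel K L)
    (hg : IsL1Solution K g) (hf : IsL1Solution K f)
    (hb : IsTameField (fun t => meanField K (f t)) L κ p q) (hκ : 0 ≤ κ)
    (hΓg : ∀ s ∈ Set.Icc p q, ∫ z, |g s z| ≤ Γ) (hΓf : ∀ s ∈ Set.Icc p q, ∫ z, |f s z| ≤ Γ)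
    (hp : g p =ᵐ[volume] f p) {β : ℝ} (hβ0 : 0 ≤ β)
    (hβ : ∀ s ∈ Set.Icc p q, ∀ z, ‖meanField K (g s) z - meanField K (f s) z‖ ≤ β)
    {s : ℝ} (hs : s ∈ Set.Icc p q) :
    IsDualBound (fun z => g s z - f s z) (exp (L * (q - p)) * Γ * ((q - p) * β)) := by
  intro φ hφ hφs hφ1
  obtain ⟨R, hR0, hR⟩ := hφs.exists_radius
  have hbs := hb.mono le_rfl hs.2
  have hsub : Set.Icc p s ⊆ Set.Icc p q := Set.Icc_subset_Icc_right hs.2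
  have hΓ0 : 0 ≤ Γ := (integral_nonneg fun z => abs_nonneg _).trans (hΓg s hs)
  refine le_of_forall_pos_le_add fun ε hε => ?_
  have h1 := (hg.isTransportedBy h).eventually_abs_integral_sub_eulerBack_le isOpen_univ hs.1
    (Set.subset_univ _) hbs hκ h.nonneg hφ hφ1 hR0 hR (η := fun _ => β)
    intervalIntegrable_const (fun _ => hβ0) (fun r hr z _ => hβ r (hsub hr) z)
    (fun r hr => hΓg r (hsub hr)) (half_pos hε)
  have h2 := (hf.isTransportedBy h).eventually_abs_integral_sub_eulerBack_le isOpen_univ hs.1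
    (Set.subset_univ _) hbs hκ h.nonneg hφ hφ1 hR0 hR (η := fun _ => 0)
    intervalIntegrable_const (fun _ => le_rfl) (fun r hr z _ => by simp)
    (fun r hr => hΓf r (hsub hr)) (half_pos hε)
  obtain ⟨n, hn1, hn2⟩ := (h1.and h2).exists
  have hpe : ∫ z, eulerBack (fun t => meanField K (f t)) φ s ((s - p) / n) n z * g p z =
      ∫ z, eulerBack (fun t => meanField K (f t)) φ s ((s - p) / n) n z * f p z :=
    integral_congr_ae (by filter_upwards [hp] with z hz; rw [hz])
  rw [hpe] at hn1
  obtain ⟨C, hC⟩ := (hφ.bounds_of_hasCompactSupport hφs).1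
  have hi : ∀ u : ℝ → E → ℝ, IsL1Solution K u → Integrable fun z => φ z * u s z := fun u hu =>
    (hu.integrable s).bdd_mul hφ.continuous.aestronglyMeasurable (.of_forall hC)
  have hsplit : ∫ z, φ z * (g s z - f s z) = (∫ z, φ z * g s z) - ∫ z, φ z * f s z := by
    rw [← integral_sub (hi g hg) (hi f hf)]
    simp only [mul_sub]
  rw [hsplit]
  simp only [intervalIntegral.integral_const, smul_eq_mul, mul_zero, zero_add, one_mul] at hn1 hn2
  have h3 : exp (L * (s - p)) * Γ * ((s - p) * β) ≤ exp (L * (q - p)) * Γ * ((q - p) * β) := by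
    have := hs.2
    have := hs.1
    have := h.nonneg
    have : 0 ≤ s - p := by linarith
    gcongr
  calc _ ≤ _ := abs_sub_le _ (∫ z, eulerBack (fun t => meanField K (f t)) φ s
          ((s - p) / n) n z * f p z) _
    _ ≤ _ := by rw [abs_sub_comm (∫ z, eulerBack (fun t => meanField K (f t)) φ s
          ((s - p) / n) n z * f p z)]; linarith

/-- Uniqueness forward in time among solutions with locally bounded first moments. -/
theorem IsL1Solution.ae_eq_of_moment_bound (h : IsInteractionKernel K L)
    (hg : IsL1Solution K g) (hf : IsL1Solution K f) {T : ℝ}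
    (hb : IsTameField (fun t => meanField K (f t)) L κ 0 T) (hκ : 0 ≤ κ)
    (hgm : ∀ s ∈ Set.Icc 0 T, Integrable fun z => ‖z‖ * |g s z|)
    (hfm : ∀ s ∈ Set.Icc 0 T, Integrable fun z => ‖z‖ * |f s z|)
    (hgM : ∀ s ∈ Set.Icc 0 T, ∫ z, ‖z‖ * |g s z| ≤ M)
    (hfM : ∀ s ∈ Set.Icc 0 T, ∫ z, ‖z‖ * |f s z| ≤ M)
    (h0 : g 0 =ᵐ[volume] f 0) : ∀ t ∈ Set.Icc 0 T, g t =ᵐ[volume] f t := by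
  obtain ⟨Γ₁, hΓ₁, hΓg⟩ := hg.exists_mass_bound 0 T
  obtain ⟨Γ₂, hΓ₂, hΓf⟩ := hf.exists_mass_bound 0 T
  obtain ⟨C, hC0, hC⟩ := exists_norm_meanField_sub_le_of_isDualBound E
  set Γ := Γ₁ + Γ₂
  have hL := h.nonneg
  have hmass : ∀ s, (∫ z, g s z) = ∫ z, f s z := fun s => by
    rw [hg.integral_eq, hf.integral_eq, integral_congr_ae h0]
  -- step length on which the dual distance is at least halved
  set A := exp L * Γ * (C * (L + 1)) with hA
  have hA0 : 0 ≤ A := by positivity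
  set τ := min 1 (1 / (2 * (A + 1))) with hτ
  have hτ0 : 0 < τ := lt_min one_pos (by positivity)
  have hτA : A * τ ≤ 1 / 2 := by
    have h1 : A * τ ≤ A * (1 / (2 * (A + 1))) := by gcongr; exact min_le_right _ _
    refine h1.trans ?_
    rw [mul_one_div, div_le_div_iff₀ (by positivity) (by positivity)]
    linarith
  have hstep : ∀ p q, 0 ≤ p → q ≤ T → q - p ≤ τ → g p =ᵐ[volume] f p →
      ∀ s ∈ Set.Icc p q, g s =ᵐ[volume] f s := by
    intro p q hp hq hpq hpe
    have hsub : Set.Icc p q ⊆ Set.Icc 0 T := Set.Icc_subset_Icc hp hq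
    rcases lt_or_ge q p with hlt | hle
    · simp [Set.Icc_eq_empty_of_lt hlt]
    have hM0 : 0 ≤ M := by
      refine (integral_nonneg fun z => ?_).trans (hgM p (hsub ⟨le_rfl, hle⟩))
      positivity
    have hiter : ∀ n : ℕ, ∀ s ∈ Set.Icc p q,
        IsDualBound (fun z => g s z - f s z) ((2 * M) * (1 / 2) ^ n) := by
      intro n
      induction n with
      | zero =>
        intro s hs φ hφ hφs hφ1
        refine (isDualBound_of_moment (hg.integrable s) (hgm s (hsub hs))
          (hf.integrable s) (hfm s (hsub hs)) (hmass s) φ hφ hφs hφ1).trans ?_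
        linarith [hgM s (hsub hs), hfM s (hsub hs)]
      | succ n ih =>
        intro s hs φ hφ hφs hφ1
        have hβ : ∀ r ∈ Set.Icc p q, ∀ z, ‖meanField K (g r) z - meanField K (f r) z‖ ≤
            C * (L + 1) * ((2 * M) * (1 / 2) ^ n) := fun r hr =>
          hC K L h (g r) (f r) _ (hg.integrable r) (hgm r (hsub hr)) (hf.integrable r)
            (hfm r (hsub hr)) (hmass r) (ih r hr)
        refine (hg.isDualBound_of_isDualBound (Γ := Γ) h hf (hb.mono hp hq) hκ
          (fun r hr => (hΓg r (hsub hr)).trans (by linarith))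
          (fun r hr => (hΓf r (hsub hr)).trans (by linarith)) hpe (by positivity) hβ hs
          φ hφ hφs hφ1).trans ?_
        have h1 : exp (L * (q - p)) ≤ exp L := by
          refine exp_le_exp.mpr (mul_le_of_le_one_right hL ?_)
          exact hpq.trans (min_le_left _ _)
        have hqp : 0 ≤ q - p := by linarith
        calc _ ≤ exp L * Γ * (τ * (C * (L + 1) * (2 * M * (1 / 2) ^ n))) := by gcongr
          _ = A * τ * (2 * M * (1 / 2) ^ n) := by rw [hA]; ring
          _ ≤ 1 / 2 * (2 * M * (1 / 2) ^ n) := by gcongr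
          _ = _ := by rw [pow_succ]; ring
    intro s hs
    refine ae_eq_of_isDualBound_zero (hg.integrable s) (hf.integrable s) fun β hβ => ?_
    have hlim : Tendsto (fun n : ℕ => (2 * M) * (1 / 2 : ℝ) ^ n) atTop (𝓝 (2 * M * 0)) :=
      (tendsto_pow_atTop_nhds_zero_of_lt_one (by norm_num) (by norm_num)).const_mul _
    rw [mul_zero] at hlim
    obtain ⟨n, hn⟩ := (hlim.eventually (gt_mem_nhds hβ)).exists
    exact fun φ hφ hφs hφ1 => (hiter n s hs φ hφ hφs hφ1).trans hn.le
  have hind : ∀ n : ℕ, ∀ t ∈ Set.Icc 0 T, t ≤ n * τ → g t =ᵐ[volume] f t := by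
    intro n
    induction n with
    | zero =>
      intro t ht htn
      have : t = 0 := le_antisymm (by simpa using htn) ht.1
      rwa [this]
    | succ n ih =>
      intro t ht htn
      rcases le_or_gt t (n * τ) with hle | hlt
      · exact ih t ht hle
      · refine hstep (n * τ) t (by positivity) ht.2 ?_
          (ih _ ⟨by positivity, hlt.le.trans ht.2⟩ le_rfl) t ⟨hlt.le, le_rfl⟩
        push_cast at htn
        linarith
  intro t ht
  obtain ⟨n, hn⟩ := exists_nat_ge (t / τ)
  exact hind n t ht ((div_le_iff₀ hτ0).mp hn)

end Uniqueness

section FlowField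

variable {E : Type*} [NormedAddCommGroup E] [NormedSpace ℝ E] [FiniteDimensional ℝ E]
  [MeasureSpace E] [BorelSpace E] [(volume : Measure E).IsAddHaarMeasure]
  {K : E × E → E} {L : ℝ} {μ : Measure E} [IsProbabilityMeasure μ] {Z : ℝ → E → E}

lemma IsMeanFieldFlow.meanField_flowDensity (h : IsInteractionKernel K L)
    (hμ : Integrable (fun z => ‖z‖) μ) (hμv : μ ≪ volume) (hZ : IsMeanFieldFlow K μ Z) (t : ℝ)
    (z : E) : meanField K (flowDensity μ Z t) z = ∫ ζ, K (z, Z t ζ) ∂μ :=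
  hZ.integral_flowDensity_smul h hμ hμv t
    (h.continuous.comp (Continuous.prodMk_right z)).stronglyMeasurable

/-- The mean field generated by the flow is a tame vector field on bounded time intervals. -/
lemma IsMeanFieldFlow.exists_isTameField (h : IsInteractionKernel K L)
    (hμ : Integrable (fun z => ‖z‖) μ) (hμv : μ ≪ volume) (hZ : IsMeanFieldFlow K μ Z) (T : ℝ) :
    ∃ κ, 0 ≤ κ ∧ IsTameField (fun t => meanField K (flowDensity μ Z t)) L κ 0 T := by
  have hL := h.nonneg
  obtain ⟨C, hC0, hC⟩ := hZ.bound (|T| + 1)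
  have hT : ∀ t ∈ Set.Icc 0 T, |t| < |T| + 1 := fun t ht => by
    rw [abs_of_nonneg ht.1]; linarith [ht.2, le_abs_self T]
  have hm : ∀ t, AEStronglyMeasurable (Z t) μ := fun t =>
    (hZ.measurable t).aestronglyMeasurable
  have hInt : ∀ t, |t| < |T| + 1 → ∀ z, Integrable (fun ζ => K (z, Z t ζ)) μ := fun t ht z =>
    integrable_kernel_comp h hμ (hm t) (hC t ht.le) z
  have hm1 : Integrable (fun ζ : E => 1 + ‖ζ‖) μ := (integrable_const _).add hμ
  set m := ∫ ζ, (1 + ‖ζ‖) ∂μ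
  have hm0 : 0 ≤ m := integral_nonneg fun ζ => by positivity
  have hone : Integrable (fun _ : E => (1 : ℝ)) μ := integrable_const _
  have heq : ∀ t, |t| < |T| + 1 → meanField K (flowDensity μ Z t) = fun z =>
      (∫ ζ, (1 : ℝ) • (K (z, Z t ζ) - K (0, Z t ζ)) ∂μ) + ∫ ζ, K (0, Z t ζ) ∂μ := fun t ht => by
    ext z
    rw [hZ.meanField_flowDensity h hμ hμv]
    simp only [one_smul]
    rw [integral_sub (hInt t ht z) (hInt t ht 0), sub_add_cancel]
  refine ⟨L * (1 + C * m), by positivity, fun t ht => ?_, fun t ht z => ?_, fun t ht z => ?_, ?_⟩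
  · simp only [heq t (hT t ht)]
    exact (h.contDiff_integral hone (hm t) 0).add contDiff_const
  · simp only [heq t (hT t ht)]
    rw [fderiv_add_const]
    refine (h.norm_fderiv_integral_le hone (hm t) 0 z).trans_eq ?_
    simp
  · simp only [hZ.meanField_flowDensity h hμ hμv]
    have hd : Integrable (fun ζ : E => L * ‖z‖ + L * C * (1 + ‖ζ‖)) μ :=
      (integrable_const _).add (hm1.const_mul _)
    refine (norm_integral_le_of_norm_le hd (.of_forall fun ζ => ?_)).trans ?_
    · refine (h.norm_le z _).trans ?_
      have := hC t (hT t ht).le ζ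
      nlinarith
    · rw [integral_add (integrable_const _) (hm1.const_mul _), integral_const,
        integral_const_mul, probReal_univ, one_smul]
      nlinarith [norm_nonneg z, mul_nonneg (mul_nonneg hL hC0) hm0,
        mul_nonneg (mul_nonneg (mul_nonneg hL hC0) hm0) (norm_nonneg z)]
  · simp only [hZ.meanField_flowDensity h hμ hμv]
    intro x hx
    refine ContinuousAt.continuousWithinAt ?_
    have hd : Integrable (fun ζ : E => L * (‖x.2‖ + 1) + L * C * (1 + ‖ζ‖)) μ :=
      (integrable_const _).add (hm1.const_mul _)
    refine continuousAt_of_dominated (.of_forall fun y => h.aestronglyMeasurable_comp (hm _) _)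
      ?_ hd (.of_forall fun ζ => ?_)
    · have h1 : ∀ᶠ y : ℝ × E in 𝓝 x, |y.1| < |T| + 1 :=
        (continuous_fst.abs.continuousAt.eventually_lt continuousAt_const (hT _ hx.1))
      have h2 : ∀ᶠ y : ℝ × E in 𝓝 x, ‖y.2‖ < ‖x.2‖ + 1 :=
        (continuous_snd.norm.continuousAt.eventually_lt continuousAt_const (lt_add_one _))
      filter_upwards [h1, h2] with y hy1 hy2
      refine .of_forall fun ζ => (h.norm_le y.2 _).trans ?_
      have := hC y.1 hy1.le ζ
      nlinarith
    · exact (h.continuous.comp (continuous_snd.prodMk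
        (hZ.continuous.comp (continuous_fst.prodMk continuous_const)))).continuousAt

lemma IsMeanFieldFlow.exists_moment_bound (h : IsInteractionKernel K L)
    (hμ : Integrable (fun z => ‖z‖) μ) (hμv : μ ≪ volume) (hZ : IsMeanFieldFlow K μ Z) (T : ℝ) :
    ∃ M, ∀ t ∈ Set.Icc 0 T, Integrable (fun z => ‖z‖ * |flowDensity μ Z t z|) ∧
      ∫ z, ‖z‖ * |flowDensity μ Z t z| ≤ M := by
  obtain ⟨C, hC0, hC⟩ := hZ.bound |T|
  have hm1 : Integrable (fun ζ : E => C * (1 + ‖ζ‖)) μ :=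
    ((integrable_const _).add hμ).const_mul _
  refine ⟨∫ ζ, C * (1 + ‖ζ‖) ∂μ, fun t ht => ?_⟩
  have htT : |t| ≤ |T| := by
    rw [abs_of_nonneg ht.1]; exact ht.2.trans (le_abs_self T)
  have hb := hC t htT
  have hZi : Integrable (fun ζ => ‖Z t ζ‖) μ :=
    hm1.mono' (hZ.measurable t).norm.aestronglyMeasurable
      (.of_forall fun ζ => by rw [norm_norm]; exact hb ζ)
  have heq : (fun z => ‖z‖ * |flowDensity μ Z t z|) = fun z => flowDensity μ Z t z • ‖z‖ := by
    ext z; rw [abs_of_nonneg (flowDensity_nonneg t z), smul_eq_mul, mul_comm]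
  have := Measure.isProbabilityMeasure_map (μ := μ) (hZ.measurable t).aemeasurable
  rw [heq]
  constructor
  · refine (integrable_rnDeriv_smul_iff (hZ.absolutelyContinuous h hμ hμv t)).mpr ?_
    exact (integrable_map_measure continuous_norm.aestronglyMeasurable
      (hZ.measurable t).aemeasurable).mpr hZi
  · rw [hZ.integral_flowDensity_smul h hμ hμv t continuous_norm.stronglyMeasurable]
    exact integral_mono hZi hm1 hb

end FlowField

section Approximation

lemma abs_sub_clip_le {a x : ℝ} {l u : ℝ} (hl : l ≤ a) (hu : a ≤ u) :
    |a - max l (min u x)| ≤ |a - x| := by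
  rcases le_total u x with h1 | h1 <;> rcases le_total l x with h2 | h2
  · rw [min_eq_left h1, max_eq_right (hl.trans hu), abs_of_nonpos (by linarith),
      abs_of_nonpos (by linarith)]; linarith
  · have : u = x := le_antisymm h1 (by linarith)
    rw [min_eq_left h1, max_eq_right (hl.trans hu), this]
  · rw [min_eq_right h1, max_eq_right h2]
  · rw [min_eq_right h1, max_eq_left h2, abs_of_nonneg (by linarith),
      abs_of_nonneg (by linarith)]; linarith

/-- Indicators of measurable sets of times are `L¹`-limits of continuous functions with values
in `[0, 1]`. -/
lemma exists_continuous_approx_indicator {A : Set ℝ} (hA : MeasurableSet A) {p q : ℝ}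
    (hpq : p ≤ q) {ε : ℝ} (hε : 0 < ε) :
    ∃ α : ℝ → ℝ, Continuous α ∧ (∀ t, 0 ≤ α t) ∧ (∀ t, α t ≤ 1) ∧
      ∫ t in p..q, |A.indicator 1 t - α t| ≤ ε := by
  have hi : Integrable (A.indicator (1 : ℝ → ℝ)) (volume.restrict (Set.Ioc p q)) :=
    (integrable_const (1 : ℝ)).indicator hA
  obtain ⟨φ, -, hφε, hφc, hφi⟩ := hi.exists_hasCompactSupport_integral_sub_le hε
  refine ⟨fun t => max 0 (min 1 (φ t)), by fun_prop, fun t => le_max_left _ _,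
    fun t => max_le zero_le_one (min_le_left _ _), ?_⟩
  rw [intervalIntegral.integral_of_le hpq]
  refine le_trans (integral_mono_of_nonneg (.of_forall fun t => abs_nonneg _) (hi.sub hφi).norm
    (.of_forall fun t => ?_)) hφε
  simp only [Pi.sub_apply, norm_eq_abs]
  refine abs_sub_clip_le ?_ ?_
  · exact Set.indicator_nonneg (fun _ _ => zero_le_one) t
  · exact Set.indicator_le_self' (fun _ _ => zero_le_one) t

variable {E : Type*} [NormedAddCommGroup E] [NormedSpace ℝ E] [FiniteDimensional ℝ E]
  [MeasureSpace E] [BorelSpace E] [(volume : Measure E).IsAddHaarMeasure]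

lemma measurableSet_integrable_smul {g : ℝ → E → ℝ} (hg : ∀ t, Integrable (g t))
    (hc : ∀ t₀, Tendsto (fun t => ∫ z, |g t z - g t₀ z|) (𝓝 t₀) (𝓝 0)) {w : E → E}
    (hw : Continuous w) : MeasurableSet {t | Integrable fun z => g t z • w z} := by
  have : ProperSpace E := FiniteDimensional.proper_real E
  have hbd : ∀ n : ℕ, ∃ C : ℝ, 0 ≤ C ∧ ∀ z ∈ Metric.closedBall (0 : E) n, ‖w z‖ ≤ C := fun n => by
    obtain ⟨C, hC⟩ := (isCompact_closedBall (0 : E) n).exists_bound_of_continuousOn hw.continuousOn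
    exact ⟨max C 0, le_max_right _ _, fun z hz => (hC z hz).trans (le_max_left _ _)⟩
  have hion : ∀ (n : ℕ) t, IntegrableOn (fun z => g t z • w z) (Metric.closedBall 0 n) := by
    intro n t
    obtain ⟨C, hC0, hC⟩ := hbd n
    refine Integrable.mono' ((hg t).abs.const_mul C).integrableOn
      ((hg t).aestronglyMeasurable.smul hw.aestronglyMeasurable).restrict ?_
    filter_upwards [ae_restrict_mem Metric.isClosed_closedBall.measurableSet] with z hz
    rw [norm_smul, norm_eq_abs, mul_comm]
    exact mul_le_mul_of_nonneg_right (hC z hz) (abs_nonneg _)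
  set I : ℕ → ℝ → ℝ := fun n t => ∫ z in Metric.closedBall (0 : E) n, ‖g t z • w z‖ with hI
  have hIc : ∀ n, Continuous (I n) := fun n => by
    obtain ⟨C, hC0, hC⟩ := hbd n
    rw [continuous_iff_continuousAt]
    intro t₀
    rw [ContinuousAt, tendsto_iff_norm_sub_tendsto_zero]
    have h0 : Tendsto (fun t => C * ∫ z, |g t z - g t₀ z|) (𝓝 t₀) (𝓝 0) := by
      simpa using (hc t₀).const_mul C
    refine squeeze_zero (fun t => norm_nonneg _) (fun t => ?_) h0
    have hd : Integrable fun z => C * |g t z - g t₀ z| := ((hg t).sub (hg t₀)).abs.const_mul C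
    rw [hI, ← integral_sub (hion n t).norm (hion n t₀).norm]
    refine (norm_integral_le_of_norm_le hd.integrableOn ?_).trans ?_
    · filter_upwards [ae_restrict_mem Metric.isClosed_closedBall.measurableSet] with z hz
      refine (abs_norm_sub_norm_le _ _).trans ?_
      rw [← sub_smul, norm_smul, norm_eq_abs, mul_comm]
      exact mul_le_mul_of_nonneg_right (hC z hz) (abs_nonneg _)
    · rw [← integral_const_mul]
      exact setIntegral_le_integral hd (.of_forall fun z => by positivity)
  have hset : {t | Integrable fun z => g t z • w z} = ⋃ m : ℕ, ⋂ n : ℕ, {t | I n t ≤ m} := by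
    ext t
    simp only [Set.mem_ofPred_eq, Set.mem_iUnion, Set.mem_iInter]
    constructor
    · intro ht
      obtain ⟨m, hm⟩ := exists_nat_ge (∫ z, ‖g t z • w z‖)
      exact ⟨m, fun n => (setIntegral_le_integral ht.norm
        (.of_forall fun z => norm_nonneg _)).trans hm⟩
    · rintro ⟨m, hm⟩
      exact (aecover_closedBall (x := (0 : E))
        (tendsto_natCast_atTop_atTop (R := ℝ))).integrable_of_integral_norm_bounded m (fun n => hion n t) (.of_forall hm)
  rw [hset]
  exact .iUnion fun m => .iInter fun n =>
    (isClosed_le (hIc n) continuous_const).measurableSet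

/-- A weighted `L¹` bound can be tested on `C¹` compactly supported functions. -/
lemma integrable_weight_of_forall_contDiff {ρ : E → ℝ} (hρ : Integrable ρ) {B : ℝ}
    (hB : ∀ φ : E → ℝ, ContDiff ℝ 1 φ → HasCompactSupport φ → (∀ z, |φ z| ≤ 1 + ‖z‖) →
      |∫ z, φ z * ρ z| ≤ B) :
    Integrable (fun z => (1 + ‖z‖) * |ρ z|) ∧ ∫ z, (1 + ‖z‖) * |ρ z| ≤ B := by
  have : ProperSpace E := FiniteDimensional.proper_real E
  have hcont : ∀ φ : E → ℝ, Continuous φ → HasCompactSupport φ → (∀ z, |φ z| ≤ 1 + ‖z‖) →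
      |∫ z, φ z * ρ z| ≤ B := by
    intro φ hφ hφs hφw
    obtain ⟨C, hC⟩ := hφs.exists_bound_of_continuous hφ
    have hC0 : 0 ≤ C := (norm_nonneg _).trans (hC 0)
    refine le_of_forall_pos_le_add fun ε hε => ?_
    set m := ∫ z, |ρ z|
    have hm0 : 0 ≤ m := integral_nonneg fun z => abs_nonneg _
    set δ := min 1 (ε / ((C + 1) * (m + 1)))
    have hδ0 : 0 < δ := lt_min one_pos (by positivity)
    have hδ1 : δ ≤ 1 := min_le_left _ _
    obtain ⟨ψ, hψ, hψd, hψs⟩ := (show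
      Continuous fun z => (1 - δ) * φ z by fun_prop).exists_contDiff_approx 1
      (ε := fun _ => δ) continuous_const fun _ => hδ0
    simp only [dist_eq] at hψd
    have h1 := hB ψ hψ ((hφs.mul_left (f := fun _ => 1 - δ)).mono hψs) fun z => by
      have h2 : |ψ z| ≤ |ψ z - (1 - δ) * φ z| + |(1 - δ) * φ z| := by
        simpa using abs_add_le (ψ z - (1 - δ) * φ z) ((1 - δ) * φ z)
      rw [abs_mul, abs_of_nonneg (by linarith : 0 ≤ 1 - δ)] at h2
      nlinarith [hψd z, hφw z, norm_nonneg z]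
    have hψC : ∀ z, |φ z - ψ z| ≤ δ * (C + 1) := fun z => by
      have h2 : |φ z - ψ z| ≤ |ψ z - (1 - δ) * φ z| + |δ * φ z| := by
        rw [abs_sub_comm (ψ z)]
        refine le_trans (le_of_eq ?_) (abs_add_le _ _)
        congr 1; ring
      rw [abs_mul, abs_of_pos hδ0] at h2
      have h3 : δ * |φ z| ≤ δ * C := mul_le_mul_of_nonneg_left (hC z) hδ0.le
      linarith [hψd z]
    have hi1 : Integrable fun z => φ z * ρ z :=
      hρ.bdd_mul hφ.aestronglyMeasurable (.of_forall hC)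
    have hi2 : Integrable fun z => (φ z - ψ z) * ρ z :=
      hρ.bdd_mul (hφ.sub hψ.continuous).aestronglyMeasurable (.of_forall hψC)
    have h4 : ∫ z, φ z * ρ z = (∫ z, (φ z - ψ z) * ρ z) + ∫ z, ψ z * ρ z := by
      rw [← sub_eq_iff_eq_add', ← integral_sub hi1 hi2]
      exact integral_congr_ae (.of_forall fun z => by ring)
    have h5 : |∫ z, (φ z - ψ z) * ρ z| ≤ δ * (C + 1) * m := by
      rw [← integral_const_mul]
      rw [← norm_eq_abs]
      refine norm_integral_le_of_norm_le (hρ.abs.const_mul _) (.of_forall fun z => ?_)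
      rw [norm_mul]
      exact mul_le_mul_of_nonneg_right (hψC z) (abs_nonneg _)
    have h6 : δ * (C + 1) * m ≤ ε := by
      calc δ * (C + 1) * m ≤ ε / ((C + 1) * (m + 1)) * (C + 1) * (m + 1) := by
            gcongr
            · exact min_le_right _ _
            · linarith
        _ = ε := by field_simp
    rw [h4]
    linarith [abs_add_le (∫ z, (φ z - ψ z) * ρ z) (∫ z, ψ z * ρ z)]
  -- approximation of the sign of `ρ` in `L¹(|ρ|)`
  set m : Measure E := volume.withDensity fun z => ENNReal.ofReal |ρ z|
  have hmd : AEMeasurable (fun z => ENNReal.ofReal |ρ z|) :=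
    hρ.abs.aestronglyMeasurable.aemeasurable.ennreal_ofReal
  have hmf : IsFiniteMeasure m := isFiniteMeasure_withDensity_ofReal hρ.abs.2
  have hmi : ∀ u : E → ℝ, ∫ z, u z ∂m = ∫ z, |ρ z| * u z := fun u => by
    rw [integral_withDensity_eq_integral_toReal_smul₀ hmd (.of_forall fun _ =>
      ENNReal.ofReal_lt_top)]
    simp [ENNReal.toReal_ofReal]
  set σ : E → ℝ := fun z => ρ z / |ρ z|
  have hσ1 : ∀ z, |σ z| ≤ 1 := fun z => by
    simp only [σ, abs_div, abs_abs]; exact div_self_le_one _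
  have hσρ : ∀ z, σ z * ρ z = |ρ z| := fun z => by
    by_cases hz : ρ z = 0
    · simp [hz]
    · have := abs_pos.mpr hz
      simp only [σ]; field_simp; exact (sq_abs _).symm
  have hσv : AEStronglyMeasurable σ :=
    (hρ.aestronglyMeasurable.aemeasurable.div
      hρ.abs.aestronglyMeasurable.aemeasurable).aestronglyMeasurable
  have hσm : Integrable σ m := by
    refine (integrable_const (1 : ℝ)).mono' (hσv.mono_ac (withDensity_absolutelyContinuous _ _))
      (.of_forall hσ1)
  have hball : ∀ n : ℕ, ∫ z, min (1 + ‖z‖) (n + 1) * |ρ z| ≤ B := by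
    intro n
    refine le_of_forall_pos_le_add fun ε hε => ?_
    obtain ⟨φ, hφs, hφε, hφc, hφi⟩ := hσm.exists_hasCompactSupport_integral_sub_le
      (ε := ε / (n + 1)) (by positivity)
    set ψ : E → ℝ := fun z => max (-1) (min 1 (φ z))
    have hψ1 : ∀ z, |ψ z| ≤ 1 := fun z => abs_le.mpr
      ⟨le_max_left _ _, max_le (by norm_num) (min_le_left _ _)⟩
    have hψc : Continuous ψ := by fun_prop
    have hψs : HasCompactSupport ψ := hφs.mono fun z hz => by
      contrapose! hz
      simp only [Function.mem_support, not_not] at hz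
      simp [ψ, hz]
    set w : E → ℝ := fun z => min (1 + ‖z‖) (n + 1)
    have hw0 : ∀ z, 0 ≤ w z := fun z => le_min (by positivity) (by positivity)
    have hwn : ∀ z, w z ≤ n + 1 := fun z => min_le_right _ _
    have hwc : Continuous w := by fun_prop
    have h1 := hcont (fun z => ψ z * w z) (hψc.mul hwc) hψs.mul_right fun z => by
      rw [abs_mul, abs_of_nonneg (hw0 z)]
      exact (mul_le_of_le_one_left (hw0 z) (hψ1 z)).trans (min_le_left _ _)
    have hψw : ∀ z, ‖ψ z * w z‖ ≤ n + 1 := fun z => by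
      rw [norm_mul, norm_eq_abs, norm_eq_abs, abs_of_nonneg (hw0 z)]
      exact (mul_le_of_le_one_left (hw0 z) (hψ1 z)).trans (hwn z)
    have hi1 : Integrable fun z => w z * |ρ z| :=
      hρ.abs.bdd_mul hwc.aestronglyMeasurable (.of_forall fun z => by
        rw [norm_eq_abs, abs_of_nonneg (hw0 z)]; exact hwn z)
    have hi2 : Integrable fun z => ψ z * w z * ρ z :=
      hρ.bdd_mul (hψc.mul hwc).aestronglyMeasurable (.of_forall hψw)
    have hi3 : Integrable fun z => |ρ z| * |σ z - ψ z| := by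
      refine (hρ.abs.const_mul 2).mono' (hρ.abs.aestronglyMeasurable.mul
        (hσv.sub hψc.aestronglyMeasurable).norm) (.of_forall fun z => ?_)
      rw [norm_mul, norm_eq_abs, norm_eq_abs, abs_abs, abs_abs, mul_comm]
      refine mul_le_mul_of_nonneg_right ((abs_sub _ _).trans ?_) (abs_nonneg _)
      linarith [hσ1 z, hψ1 z]
    have h2 : (∫ z, w z * |ρ z|) - ∫ z, ψ z * w z * ρ z ≤ ε := by
      rw [← integral_sub hi1 hi2]
      calc _ ≤ ∫ z, (n + 1) * (|ρ z| * |σ z - ψ z|) := by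
            refine integral_mono (hi1.sub hi2) (hi3.const_mul _) fun z => ?_
            have h3 : w z * |ρ z| - ψ z * w z * ρ z = w z * (ρ z * (σ z - ψ z)) := by
              rw [← hσρ]; ring
            simp only [h3]
            refine (le_abs_self _).trans ?_
            rw [abs_mul, abs_mul, abs_of_nonneg (hw0 z)]
            exact mul_le_mul_of_nonneg_right (hwn z) (by positivity)
        _ = (n + 1) * ∫ z, |σ z - ψ z| ∂m := by rw [integral_const_mul, hmi]
        _ ≤ (n + 1) * (ε / (n + 1)) := by
            gcongr
            refine le_trans (integral_mono_of_nonneg (.of_forall fun z => abs_nonneg _)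
              (hσm.sub hφi).norm (.of_forall fun z => ?_)) hφε
            exact abs_sub_clip_le (abs_le.mp (hσ1 z)).1 (abs_le.mp (hσ1 z)).2
        _ = ε := by field_simp
    linarith [le_abs_self (∫ z, ψ z * w z * ρ z)]
  have hcov : AECover (volume : Measure E) atTop fun n : ℕ => Metric.closedBall (0 : E) n :=
    aecover_closedBall (tendsto_natCast_atTop_atTop (R := ℝ))
  have hwi : ∀ n : ℕ, Integrable fun z => min (1 + ‖z‖) (n + 1) * |ρ z| := fun n =>
    hρ.abs.bdd_mul (c := n + 1) (by fun_prop) (.of_forall fun z => by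
      rw [norm_eq_abs, abs_of_nonneg (le_min (by positivity) (by positivity))]
      exact min_le_right _ _)
  have hEq : ∀ n : ℕ, Set.EqOn (fun z => min (1 + ‖z‖) (n + 1) * |ρ z|)
      (fun z => (1 + ‖z‖) * |ρ z|) (Metric.closedBall 0 n) := fun n z hz => by
    rw [mem_closedBall_zero_iff] at hz
    simp only [min_eq_left (by linarith : 1 + ‖z‖ ≤ n + 1)]
  have hion : ∀ n : ℕ, IntegrableOn (fun z => (1 + ‖z‖) * |ρ z|) (Metric.closedBall 0 n) :=
    fun n => (hwi n).integrableOn.congr_fun (hEq n) Metric.isClosed_closedBall.measurableSet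
  have hset : ∀ n : ℕ, ∫ z in Metric.closedBall (0 : E) n, (1 + ‖z‖) * |ρ z| ≤ B := fun n => by
    rw [← setIntegral_congr_fun Metric.isClosed_closedBall.measurableSet (hEq n)]
    exact (setIntegral_le_integral (hwi n) (.of_forall fun z => mul_nonneg
      (le_min (by positivity) (by positivity)) (abs_nonneg _))).trans (hball n)
  have hpos : ∀ z : E, |1 + ‖z‖| = 1 + ‖z‖ := fun z => abs_of_nonneg (by positivity)
  have hInt : Integrable (fun z => (1 + ‖z‖) * |ρ z|) := by
    exact hcov.integrable_of_integral_norm_bounded B hion (.of_forall fun n => by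
      simpa only [norm_mul, norm_eq_abs, abs_abs, abs_of_nonneg, hpos] using hset n)
  exact ⟨hInt, le_of_tendsto (hcov.integral_tendsto_of_countably_generated hInt)
    (.of_forall hset)⟩

end Approximation

section ImplicitCurve

variable {E : Type*} [NormedAddCommGroup E] [NormedSpace ℝ E] [CompleteSpace E]

/-- A quantitative implicit function theorem, differentiable in the parameter. -/
lemma exists_implicit_curve {G G' : ℝ → E → E} {P : ℝ → E → E →L[ℝ] E} {I : Set ℝ} {r : ℝ} {y : E}
    (hI : IsOpen I) (hr : 0 ≤ r) (hG : ∀ t x, HasFDerivAt (G t) (-(P t x)) x)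
    (hP : Continuous fun p : ℝ × E => P p.1 p.2)
    (hb : ∀ t ∈ I, ∀ x ∈ Metric.closedBall (0 : E) r, ‖1 - P t x‖ ≤ 1 / 2)
    (h0 : ∀ t ∈ I, ‖G t 0 - y‖ ≤ r / 2) (ht : ∀ t x, HasDerivAt (fun s => G s x) (G' t x) t) :
    ∃ x : ℝ → E, ∀ t ∈ I, ‖x t‖ ≤ r ∧
      HasDerivAt x (Ring.inverse (P t (x t)) (G' t (x t))) t := by
  set S := Metric.closedBall (0 : E) r
  -- `x ↦ x + G t x` is a contraction of the ball
  have hlip : ∀ t ∈ I, ∀ u ∈ S, ∀ v ∈ S, ‖(u + G t u) - (v + G t v)‖ ≤ 1 / 2 * ‖u - v‖ := by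
    intro t htI u hu v hv
    refine (convex_closedBall (0 : E) r).norm_image_sub_le_of_norm_hasFDerivWithin_le
      (f := fun x => x + G t x) (f' := fun x => 1 - P t x) (fun x hx => ?_)
      (fun x hx => hb t htI x hx) hv hu
    exact ((hasFDerivAt_id x).add (hG t x)).hasFDerivWithinAt.congr_fderiv (sub_eq_add_neg _ _).symm
  have hex : ∀ t ∈ I, ∃ x ∈ S, G t x = y := by
    intro t htI
    have hmaps : Set.MapsTo (fun x => x + G t x - y) S S := fun x hx => by
      have h1 := hlip t htI x hx 0 (by simp [S, hr])
      have h2 := h0 t htI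
      simp only [S, mem_closedBall_zero_iff] at hx ⊢
      have h3 : x + G t x - y = (x + G t x - (0 + G t 0)) + (G t 0 - y) := by abel
      rw [h3]
      refine (norm_add_le _ _).trans ?_
      rw [sub_zero] at h1
      linarith
    have hcontr : ContractingWith (1 / 2) (hmaps.restrict _ S S) := by
      refine ⟨by rw [← NNReal.coe_lt_coe]; norm_num, LipschitzWith.of_dist_le_mul fun u v => ?_⟩
      rw [Subtype.dist_eq, Subtype.dist_eq, dist_eq_norm, dist_eq_norm]
      simp only [Set.MapsTo.val_restrict_apply, sub_sub_sub_cancel_right]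
      simpa using hlip t htI u u.2 v v.2
    obtain ⟨x, hxS, hx, -⟩ := hcontr.exists_fixedPoint' Metric.isClosed_closedBall.isComplete
      hmaps (x := 0) (by simp [S, hr]) (edist_ne_top _ _)
    refine ⟨x, hxS, ?_⟩
    have h1 : x + G t x - y = x := hx
    rw [add_sub_assoc, add_eq_left, sub_eq_zero] at h1
    exact h1
  choose! x hxS hx using hex
  refine ⟨x, fun t htI => ⟨mem_closedBall_zero_iff.1 (hxS t htI), ?_⟩⟩
  have hIt : I ∈ 𝓝 t := hI.mem_nhds htI
  have hunit : IsUnit (P t (x t)) := by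
    have h1 : IsUnit (1 - (1 - P t (x t))) := isUnit_one_sub_of_norm_lt_one
      ((hb t htI (x t) (hxS t htI)).trans_lt (by norm_num))
    rwa [sub_sub_cancel] at h1
  -- the curve is Lipschitz at `t`
  have hxG : ∀ s ∈ I, ‖x s - x t‖ ≤ 2 * ‖G s (x t) - G t (x t)‖ := fun s hs => by
    have h1 := hlip s hs (x s) (hxS s hs) (x t) (hxS t htI)
    have h2 : x s - x t = (x s + G s (x s) - (x t + G s (x t))) + (G s (x t) - G t (x t)) := by
      rw [hx s hs, hx t htI]; abel
    have h3 := norm_add_le (x s + G s (x s) - (x t + G s (x t))) (G s (x t) - G t (x t))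
    rw [← h2] at h3
    linarith
  have hxO : (fun s => x s - x t) =O[𝓝 t] fun s => s - t := by
    refine Asymptotics.IsBigO.trans (.of_bound 2 ?_) (ht t (x t)).isBigO_sub
    filter_upwards [hIt] with s hs using hxG s hs
  have hxc : ContinuousAt x t := by
    rw [ContinuousAt, tendsto_iff_norm_sub_tendsto_zero]
    have h1 : Tendsto (fun s => 2 * ‖G s (x t) - G t (x t)‖) (𝓝 t) (𝓝 0) := by
      simpa using (tendsto_iff_norm_sub_tendsto_zero.1 (ht t (x t)).continuousAt).const_mul 2
    refine squeeze_zero' (.of_forall fun s => norm_nonneg _) ?_ h1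
    filter_upwards [hIt] with s hs using hxG s hs
  -- first order expansion of the implicit equation
  have hmain : (fun s => P t (x t) (x s - x t) - (s - t) • G' t (x t)) =o[𝓝 t]
      fun s => s - t := by
    have h1 : (fun s => G s (x t) - G t (x t) - (s - t) • G' t (x t)) =o[𝓝 t]
        fun s => s - t := (hasDerivAt_iff_isLittleO.1 (ht t (x t)))
    have h2 : (fun s => G s (x s) - G s (x t) + P t (x t) (x s - x t)) =o[𝓝 t]
        fun s => x s - x t := by
      rw [Asymptotics.isLittleO_iff]
      intro ε hε
      obtain ⟨δ, hδ, hδP⟩ := Metric.continuousAt_iff.1 (hP.continuousAt (x := (t, x t))) ε hε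
      filter_upwards [Metric.ball_mem_nhds t hδ, hxc.preimage_mem_nhds (Metric.ball_mem_nhds _ hδ)]
        with s hs hxs
      have h3 := (convex_ball (x t) δ).norm_image_sub_le_of_norm_hasFDerivWithin_le
        (f := fun u => G s u + P t (x t) u) (f' := fun u => -(P s u) + P t (x t)) (C := ε)
        (fun u _ => ((hG s u).add (P t (x t)).hasFDerivAt).hasFDerivWithinAt)
        (fun u hu => by
          have := hδP (x := (s, u)) (by
            rw [Prod.dist_eq]; exact max_lt hs hu)
          rw [dist_eq_norm] at this
          rw [neg_add_eq_sub, norm_sub_rev]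
          exact this.le)
        (Metric.mem_ball_self hδ) hxs
      convert h3 using 2
      rw [map_sub]; abel
    have h4 := (h2.trans_isBigO hxO).sub (f₂ := fun s => -(G s (x t) - G t (x t) -
      (s - t) • G' t (x t))) h1.neg_left
    refine h4.congr' ?_ .rfl
    filter_upwards [hIt] with s hs
    rw [hx s hs, hx t htI]
    abel
  rw [hasDerivAt_iff_isLittleO]
  have h5 := ((Ring.inverse (P t (x t))).isBigO_comp
    (fun s => P t (x t) (x s - x t) - (s - t) • G' t (x t)) (𝓝 t)).trans_isLittleO hmain
  refine h5.congr_left fun s => ?_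
  have h6 : ∀ u, Ring.inverse (P t (x t)) (P t (x t) u) = u := fun u => by
    rw [← mul_apply_eq_comp, Ring.inverse_mul_cancel _ hunit,
      one_apply_eq_self]
  rw [map_sub, h6, map_smul]

end ImplicitCurve

section DensityLimits

variable {E : Type*} [NormedAddCommGroup E] [NormedSpace ℝ E] [FiniteDimensional ℝ E]
  [MeasureSpace E] [BorelSpace E] [(volume : Measure E).IsAddHaarMeasure]

/-- Joint continuity of the pairing of an `L¹`-continuous density with bounded functions. -/
lemma tendsto_integral_smul {α F : Type*} [NormedAddCommGroup F] [NormedSpace ℝ F]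
    {l : Filter α} [l.IsCountablyGenerated] {ρ : α → E → ℝ} {ρ₀ : E → ℝ}
    {H : α → E → F} {H₀ : E → F} {C : ℝ} (hρ : ∀ a, Integrable (ρ a)) (hρ₀ : Integrable ρ₀)
    (hl : Tendsto (fun a => ∫ z, |ρ a z - ρ₀ z|) l (𝓝 0))
    (hm : ∀ a, AEStronglyMeasurable (H a)) (hC : ∀ᶠ a in l, ∀ z, ‖H a z‖ ≤ C)
    (hH : ∀ z, Tendsto (fun a => H a z) l (𝓝 (H₀ z))) :
    Tendsto (fun a => ∫ z, ρ a z • H a z) l (𝓝 (∫ z, ρ₀ z • H₀ z)) := by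
  have h1 : Tendsto (fun a => ∫ z, ρ₀ z • H a z) l (𝓝 (∫ z, ρ₀ z • H₀ z)) := by
    refine tendsto_integral_filter_of_dominated_convergence (fun z => C * |ρ₀ z|)
      (.of_forall fun a => hρ₀.aestronglyMeasurable.smul (hm a)) ?_ (hρ₀.abs.const_mul C)
      (.of_forall fun z => (hH z).const_smul _)
    filter_upwards [hC] with a ha
    refine .of_forall fun z => ?_
    rw [norm_smul, mul_comm]
    exact mul_le_mul_of_nonneg_right (ha z) (norm_nonneg _)
  have h2 : Tendsto (fun a => ∫ z, (ρ a z - ρ₀ z) • H a z) l (𝓝 0) := by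
    have h3 : Tendsto (fun a => C * ∫ z, |ρ a z - ρ₀ z|) l (𝓝 0) := by
      simpa using hl.const_mul C
    refine squeeze_zero_norm' ?_ h3
    filter_upwards [hC] with a ha
    rw [← integral_const_mul]
    refine norm_integral_le_of_norm_le (((hρ a).sub hρ₀).abs.const_mul C) (.of_forall fun z => ?_)
    rw [norm_smul, mul_comm]
    exact mul_le_mul_of_nonneg_right (ha z) (norm_nonneg _)
  have h4 := h2.add h1
  rw [zero_add] at h4
  refine h4.congr' ?_
  filter_upwards [hC] with a ha
  have hi : ∀ σ : E → ℝ, Integrable σ → Integrable fun z => σ z • H a z := fun σ hσ => by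
    refine (hσ.abs.const_mul C).mono' (hσ.aestronglyMeasurable.smul (hm a)) (.of_forall fun z => ?_)
    rw [norm_smul, mul_comm]
    exact mul_le_mul_of_nonneg_right (ha z) (norm_nonneg _)
  rw [← integral_add (hi (fun z => ρ a z - ρ₀ z) ((hρ a).sub hρ₀)) (hi _ hρ₀)]
  refine integral_congr_ae (.of_forall fun z => ?_)
  simp only [← add_smul, sub_add_cancel]

/-- Translations act continuously on `L¹`. -/
lemma tendsto_integral_abs_translate_sub {ρ : E → ℝ} (hρ : Integrable ρ) (x₀ : E) :
    Tendsto (fun x => ∫ z, |ρ (z + x) - ρ (z + x₀)|) (𝓝 x₀) (𝓝 0) := by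
  have : ProperSpace E := FiniteDimensional.proper_real E
  have hit : ∀ {σ : E → ℝ}, Integrable σ → ∀ x, Integrable fun z => σ (z + x) :=
    fun hσ x => hσ.comp_add_right x
  rw [Metric.tendsto_nhds]
  intro ε hε
  obtain ⟨φ, hφs, hφε, hφc, hφi⟩ := hρ.exists_hasCompactSupport_integral_sub_le
    (ε := ε / 4) (by positivity)
  obtain ⟨C, hC⟩ := hφs.exists_bound_of_continuous hφc
  have hC0 : 0 ≤ C := (norm_nonneg _).trans (hC 0)
  obtain ⟨R, hR0, hR⟩ := hφs.exists_radius
  have hφt : Tendsto (fun x => ∫ z, |φ (z + x) - φ (z + x₀)|) (𝓝 x₀) (𝓝 0) := by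
    have h0 : (0 : ℝ) = ∫ z, |φ (z + x₀) - φ (z + x₀)| := by simp
    rw [h0]
    set B := Metric.closedBall (0 : E) (R + ‖x₀‖ + 1)
    refine tendsto_integral_filter_of_dominated_convergence
      (B.indicator fun _ => 2 * C) (.of_forall fun x => ?_) ?_ ?_ (.of_forall fun z => ?_)
    · exact (Continuous.aestronglyMeasurable (by fun_prop))
    · filter_upwards [Metric.ball_mem_nhds x₀ one_pos] with x hx
      refine .of_forall fun z => ?_
      rw [norm_eq_abs, abs_abs]
      by_cases hz : z ∈ B
      · rw [Set.indicator_of_mem hz]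
        have := norm_sub_le (φ (z + x)) (φ (z + x₀))
        rw [norm_eq_abs (φ (z + x) - φ (z + x₀))] at this
        linarith [hC (z + x), hC (z + x₀)]
      · rw [Set.indicator_of_notMem hz]
        rw [mem_closedBall_zero_iff, not_le] at hz
        rw [Metric.mem_ball, dist_eq_norm] at hx
        have h1 : ‖x‖ ≤ ‖x₀‖ + 1 := by
          have := norm_sub_norm_le x x₀; linarith
        have h2 : ∀ y : E, ‖y‖ ≤ ‖x₀‖ + 1 → φ (z + y) = 0 := fun y hy => hR _ (by
          have := norm_sub_le (z + y) y
          rw [add_sub_cancel_right] at this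
          linarith)
        rw [h2 x h1, h2 x₀ (by linarith), sub_zero, abs_zero]
    · exact (integrable_indicator_iff Metric.isClosed_closedBall.measurableSet).2
        (integrableOn_const (measure_closedBall_lt_top.ne))
    · exact (Continuous.continuousAt (by fun_prop)).tendsto
  filter_upwards [(Metric.tendsto_nhds.1 hφt) (ε / 4) (by positivity)] with x hx
  rw [dist_zero_right, norm_eq_abs, abs_of_nonneg (integral_nonneg fun z => abs_nonneg _)] at hx ⊢
  have hd : ∀ y, ∫ z, |ρ (z + y) - φ (z + y)| ≤ ε / 4 := fun y => by
    rw [integral_add_right_eq_self (fun z => |ρ z - φ z|) y]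
    exact hφε
  have hi1 : ∀ y, Integrable fun z => |ρ (z + y) - φ (z + y)| :=
    fun y => ((hit hρ y).sub (hit hφi y)).abs
  have hi2 : Integrable fun z => |φ (z + x) - φ (z + x₀)| :=
    ((hit hφi x).sub (hit hφi x₀)).abs
  have hi3 : Integrable fun z => |ρ (z + x) - φ (z + x)| + |φ (z + x) - φ (z + x₀)| :=
    (hi1 x).add hi2
  have h1 : ∫ z, |ρ (z + x) - ρ (z + x₀)| ≤ (∫ z, |ρ (z + x) - φ (z + x)|) +
      (∫ z, |φ (z + x) - φ (z + x₀)|) + ∫ z, |ρ (z + x₀) - φ (z + x₀)| := by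
    rw [← integral_add (hi1 x) hi2, ← integral_add hi3 (hi1 x₀)]
    refine integral_mono ((hit hρ x).sub (hit hρ x₀)).abs (hi3.add (hi1 x₀))
      fun z => ?_
    beta_reduce
    rw [abs_sub_comm (ρ (z + x₀)) (φ (z + x₀))]
    have h2 := abs_add_three (ρ (z + x) - φ (z + x)) (φ (z + x) - φ (z + x₀))
      (φ (z + x₀) - ρ (z + x₀))
    refine le_trans (le_of_eq ?_) h2
    congr 1; ring
  linarith [hd x, hd x₀]

end DensityLimits

section TruncatedIdentity

/-- Compactly supported `C¹` maps which coincide with the identity on large balls and have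
uniformly bounded derivatives. -/
lemma exists_contDiff_truncated_id (E : Type*) [NormedAddCommGroup E] [NormedSpace ℝ E]
    [FiniteDimensional ℝ E] [MeasureSpace E] [BorelSpace E] [(volume : Measure E).IsAddHaarMeasure] :
    ∃ C : ℝ, 0 ≤ C ∧ ∀ R : ℝ, 0 < R → ∃ φ : E → E,
      ContDiff ℝ 1 φ ∧ HasCompactSupport φ ∧ (∀ z, ‖1 - fderiv ℝ φ z‖ ≤ C) ∧
      ∀ z, ‖z‖ < R → fderiv ℝ φ z = 1 := by
  have : ProperSpace E := FiniteDimensional.proper_real E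
  obtain ⟨χ, C, hχ, hC0, hχ1, hχ2, hχ0, hχle, hχC⟩ := exists_contDiff_cutoff E
  refine ⟨2 + 2 * C, by positivity, fun R hR => ⟨fun z => χ (R⁻¹ • z) • z, ?_, ?_, ?_, ?_⟩⟩
  · exact (hχ.comp (contDiff_const_smul _)).smul contDiff_id
  · refine HasCompactSupport.intro (isCompact_closedBall (0 : E) (2 * R)) fun z hz => ?_
    rw [mem_closedBall_zero_iff, not_le] at hz
    rw [hχ2, zero_smul]
    rw [norm_smul, norm_inv, norm_of_nonneg hR.le, inv_mul_eq_div, le_div_iff₀ hR]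
    exact hz.le
  · intro z
    have h1 : HasFDerivAt (fun z : E => χ (R⁻¹ • z))
        ((fderiv ℝ χ (R⁻¹ • z)).comp (R⁻¹ • ContinuousLinearMap.id ℝ E)) z :=
      ((hχ.differentiable one_ne_zero _).hasFDerivAt).comp z
        ((hasFDerivAt_id z).const_smul R⁻¹)
    have h2 := HasFDerivAt.fderiv (f := fun z : E => χ (R⁻¹ • z) • z) (h1.smul (hasFDerivAt_id z))
    rw [h2]
    refine ContinuousLinearMap.opNorm_le_bound _ (by positivity) fun v => ?_
    have hz : ‖R⁻¹ • (fderiv ℝ χ (R⁻¹ • z) v) • z‖ ≤ 2 * C * ‖v‖ := by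
      rw [smul_comm, norm_smul]
      rcases le_or_gt ‖R⁻¹ • z‖ 2 with h | h
      · have h3 := (fderiv ℝ χ (R⁻¹ • z)).le_of_opNorm_le (hχC _) v
        calc _ ≤ C * ‖v‖ * 2 := by gcongr
          _ = _ := by ring
      · have h3 : fderiv ℝ χ (R⁻¹ • z) = 0 := by
          have : χ =ᶠ[𝓝 (R⁻¹ • z)] fun _ => 0 := by
            filter_upwards [(isOpen_lt continuous_const continuous_norm).mem_nhds h] with u hu
              using hχ2 u (le_of_lt hu)
          rw [this.fderiv_eq, fderiv_fun_const, Pi.zero_apply]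
        rw [h3]
        simp only [zero_apply, norm_zero, zero_mul]
        positivity
    have hχv : ‖(1 - χ (R⁻¹ • z)) • v‖ ≤ 1 * ‖v‖ := by
      rw [norm_smul, norm_of_nonneg (by linarith [hχle (R⁻¹ • z)])]
      gcongr
      linarith [hχ0 (R⁻¹ • z)]
    have h4 : (1 - (χ (R⁻¹ • z) • ContinuousLinearMap.id ℝ E +
        ((fderiv ℝ χ (R⁻¹ • z)).comp (R⁻¹ • ContinuousLinearMap.id ℝ E)).smulRight z)) v =
        (1 - χ (R⁻¹ • z)) • v - R⁻¹ • (fderiv ℝ χ (R⁻¹ • z) v) • z := by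
      simp [sub_smul, smul_smul, sub_sub]
    refine le_trans (le_of_eq (congrArg norm h4)) ((norm_sub_le _ _).trans ?_)
    linarith [norm_nonneg v]
  · intro z hz
    have : (fun z : E => χ (R⁻¹ • z) • z) =ᶠ[𝓝 z] id := by
      filter_upwards [(isOpen_lt continuous_norm continuous_const).mem_nhds hz] with u hu
      rw [hχ1, one_smul, id]
      rw [norm_smul, norm_inv, norm_of_nonneg hR.le, inv_mul_eq_div, div_le_one hR]
      exact le_of_lt hu
    rw [this.fderiv_eq, fderiv_id]
    rfl

end TruncatedIdentity

section FrameIntegrals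

variable {E : Type*} [NormedAddCommGroup E] [NormedSpace ℝ E] [FiniteDimensional ℝ E]
  [MeasureSpace E] [BorelSpace E] [(volume : Measure E).IsAddHaarMeasure]
  {K : E × E → E} {L : ℝ} {g : ℝ → E → ℝ} {φ : E → E}

lemma ContDiff.exists_fderiv_bound (hφ : ContDiff ℝ 1 φ) (hs : HasCompactSupport φ) :
    ∃ C, 0 ≤ C ∧ ∀ z, ‖fderiv ℝ φ z‖ ≤ C := by
  obtain ⟨C, hC⟩ := (hs.fderiv (𝕜 := ℝ)).exists_bound_of_continuous
    (hφ.continuous_fderiv one_ne_zero)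
  exact ⟨C, (norm_nonneg _).trans (hC 0), hC⟩

lemma IsL1Solution.tendsto_fst (hg : IsL1Solution K g) (p : ℝ × E) :
    Tendsto (fun q : ℝ × E => ∫ z, |g q.1 z - g p.1 z|) (𝓝 p) (𝓝 0) :=
  (hg.tendsto p.1).comp continuous_fst.continuousAt

lemma IsL1Solution.continuous_integral_fderiv (hg : IsL1Solution K g) (hφ : ContDiff ℝ 1 φ)
    (hs : HasCompactSupport φ) :
    Continuous fun p : ℝ × E => ∫ z, g p.1 z • fderiv ℝ φ (z - p.2) := by
  have hc := hφ.continuous_fderiv one_ne_zero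
  obtain ⟨C, -, hC⟩ := hφ.exists_fderiv_bound hs
  refine continuous_iff_continuousAt.2 fun p => ?_
  exact tendsto_integral_smul (C := C) (fun q : ℝ × E => hg.integrable q.1) (hg.integrable p.1)
    (hg.tendsto_fst p)
    (fun q => (hc.comp (continuous_id.sub continuous_const)).aestronglyMeasurable)
    (.of_forall fun q z => hC _)
    (fun z => (hc.comp (continuous_const.sub continuous_snd)).continuousAt)

lemma hasFDerivAt_integral_translate {ρ : E → ℝ} (hρ : Integrable ρ) (hφ : ContDiff ℝ 1 φ)
    (hs : HasCompactSupport φ) (x : E) :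
    HasFDerivAt (fun x => ∫ z, ρ z • φ (z - x)) (-∫ z, ρ z • fderiv ℝ φ (z - x)) x := by
  have hc := hφ.continuous_fderiv one_ne_zero
  obtain ⟨C, -, hC⟩ := hφ.exists_fderiv_bound hs
  obtain ⟨B, hB⟩ := hs.exists_bound_of_continuous hφ.continuous
  have hm : ∀ y, AEStronglyMeasurable (fun z => ρ z • φ (z - y)) volume := fun y =>
    hρ.aestronglyMeasurable.smul
      (hφ.continuous.comp (continuous_id.sub continuous_const)).aestronglyMeasurable
  rw [← integral_neg]
  refine hasFDerivAt_integral_of_dominated_of_fderiv_le (bound := fun z => C * |ρ z|)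
    (F' := fun x z => -(ρ z • fderiv ℝ φ (z - x)))
    Filter.univ_mem (.of_forall hm) ?_ ?_ (.of_forall fun z y _ => ?_) (hρ.abs.const_mul C)
    (.of_forall fun z y _ => ?_)
  · refine (hρ.abs.const_mul B).mono' (hm x) (.of_forall fun z => ?_)
    rw [norm_smul, mul_comm]
    exact mul_le_mul_of_nonneg_right (hB _) (norm_nonneg _)
  · exact (hρ.aestronglyMeasurable.smul
      (hc.comp (continuous_id.sub continuous_const)).aestronglyMeasurable).neg
  · rw [norm_neg, norm_smul, mul_comm]
    exact mul_le_mul_of_nonneg_right (hC _) (norm_nonneg _)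
  · have h1 := ((hφ.differentiable one_ne_zero (z - y)).hasFDerivAt).comp y
      ((hasFDerivAt_id y).const_sub z)
    refine (h1.const_smul (ρ z)).congr_fderiv ?_
    ext v; simp

lemma IsL1Solution.hasDerivAt_integral_smul (h : IsInteractionKernel K L) (hg : IsL1Solution K g)
    (hφ : ContDiff ℝ 1 φ) (hs : HasCompactSupport φ) (t : ℝ) :
    HasDerivAt (fun s => ∫ z, g s z • φ z)
      (∫ z, g t z • fderiv ℝ φ z (meanField K (g t) z)) t := by
  have hi : ∀ (Φ : E → E), Continuous Φ → HasCompactSupport Φ → ∀ s,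
      Integrable fun z => g s z • Φ z := fun Φ hΦ hΦs s => by
    obtain ⟨B, hB⟩ := hΦs.exists_bound_of_continuous hΦ
    refine ((hg.integrable s).abs.const_mul B).mono' ((hg.integrable s).aestronglyMeasurable.smul
      hΦ.aestronglyMeasurable) (.of_forall fun z => ?_)
    rw [norm_smul, mul_comm]
    exact mul_le_mul_of_nonneg_right (hB _) (norm_nonneg _)
  have hc := hφ.continuous_fderiv one_ne_zero
  have hi' := hi (fun z => fderiv ℝ φ z (meanField K (g t) z))
    (hc.clm_apply (continuous_meanField h (hg.integrable t)))
    ((hs.fderiv (𝕜 := ℝ)).mono fun z hz => by contrapose! hz; simp_all) t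
  have hℓ : ∀ ℓ : E →L[ℝ] ℝ, HasDerivAt (fun s => ℓ (∫ z, g s z • φ z))
      (ℓ (∫ z, g t z • fderiv ℝ φ z (meanField K (g t) z))) t := fun ℓ => by
    have h1 := (hg.isTransportedBy h).hasDerivAt (fun z => ℓ (φ z)) (ℓ.contDiff.comp hφ)
      (hs.comp_left (map_zero ℓ)) t (Set.mem_univ t)
    have h2 : ∀ s, ℓ (∫ z, g s z • φ z) = ∫ z, ℓ (φ z) * g s z := fun s => by
      rw [← ℓ.integral_comp_comm (hi φ hφ.continuous hs s)]
      exact integral_congr_ae (.of_forall fun z => by simp [mul_comm])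
    simp only [h2]
    refine h1.congr_deriv ?_
    rw [← ℓ.integral_comp_comm hi']
    refine integral_congr_ae (.of_forall fun z => ?_)
    have h3 := HasFDerivAt.fderiv (f := fun z => ℓ (φ z))
      (ℓ.hasFDerivAt.comp z (hφ.differentiable one_ne_zero z).hasFDerivAt)
    simp [h3, mul_comm]
  set e := (Module.finBasis ℝ E).equivFunL
  have h4 : HasDerivAt (fun s => e (∫ z, g s z • φ z))
      (e (∫ z, g t z • fderiv ℝ φ z (meanField K (g t) z))) t :=
    hasDerivAt_pi.2 fun i => hℓ ((ContinuousLinearMap.proj (R := ℝ) (φ := fun _ => ℝ) i).comp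
      e.toContinuousLinearMap)
  have h5 := e.symm.toContinuousLinearMap.hasFDerivAt.comp_hasDerivAt t h4
  simpa [Function.comp_def] using h5

end FrameIntegrals

section FrameChoice

variable {E : Type*} [NormedAddCommGroup E] [NormedSpace ℝ E] [FiniteDimensional ℝ E]
  [MeasureSpace E] [BorelSpace E] [(volume : Measure E).IsAddHaarMeasure]
  {K : E × E → E} {L : ℝ} {g : ℝ → E → ℝ}

lemma tendsto_integral_tail {ρ : E → ℝ} (hρ : Integrable ρ) :
    Tendsto (fun n : ℕ => ∫ z, {z : E | n ≤ ‖z‖ + 1}.indicator (fun z => |ρ z|) z) atTop (𝓝 0) := by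
  have h0 : (0 : ℝ) = ∫ _ : E, (0 : ℝ) := by simp
  rw [h0]
  have hms : ∀ n : ℕ, MeasurableSet {z : E | n ≤ ‖z‖ + 1} := fun n =>
    (isClosed_le continuous_const (by fun_prop)).measurableSet
  refine tendsto_integral_of_dominated_convergence (fun z => |ρ z|)
    (fun n => (hρ.abs.indicator (hms n)).aestronglyMeasurable) hρ.abs
    (fun n => .of_forall fun z => ?_) (.of_forall fun z => ?_)
  · refine (norm_indicator_le_norm_self _ _).trans ?_
    rw [norm_eq_abs, abs_abs]
  · refine tendsto_const_nhds.congr' ?_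
    obtain ⟨m, hm⟩ := exists_nat_gt (‖z‖ + 1)
    filter_upwards [eventually_ge_atTop m] with n hn
    rw [Set.indicator_of_notMem]
    rw [Set.mem_ofPred_eq, not_le]
    exact hm.trans_le (by exact_mod_cast hn)

/-- Near a given time the truncated first moment determines a frame. -/
lemma IsL1Solution.exists_frame_data (hg : IsL1Solution K g) (h1 : ∫ z, g 0 z = 1) (t₀ : ℝ) :
    ∃ φ : E → E, ContDiff ℝ 1 φ ∧ HasCompactSupport φ ∧ ∃ δ > 0, ∀ t ∈ Metric.ball t₀ δ,
      (∀ x ∈ Metric.closedBall (0 : E) 1, ‖1 - ∫ z, g t z • fderiv ℝ φ (z - x)‖ ≤ 1 / 2) ∧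
      ‖(∫ z, g t z • φ (z - 0)) - ∫ z, g t₀ z • φ (z - 0)‖ ≤ 1 / 2 := by
  obtain ⟨C, hC0, hCφ⟩ := exists_contDiff_truncated_id E
  have htail := (tendsto_integral_tail (hg.integrable t₀)).const_mul C
  rw [mul_zero] at htail
  obtain ⟨n, hn, hn0⟩ := ((htail.eventually_lt_const (by norm_num : (0 : ℝ) < 1 / 4)).and
    (eventually_gt_atTop 0)).exists
  obtain ⟨φ, hφ, hφs, hφC, hφn⟩ := hCφ n (by exact_mod_cast hn0)
  obtain ⟨B, hB⟩ := hφs.exists_bound_of_continuous hφ.continuous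
  have hl1 := (hg.tendsto t₀).const_mul C
  have hl2 := (hg.tendsto t₀).const_mul B
  rw [mul_zero] at hl1 hl2
  obtain ⟨δ, hδ, hδb⟩ := Metric.eventually_nhds_iff.1
    ((hl1.eventually_lt_const (by norm_num : (0 : ℝ) < 1 / 4)).and
      (hl2.eventually_lt_const (by norm_num : (0 : ℝ) < 1 / 2)))
  refine ⟨φ, hφ, hφs, δ, hδ, fun t ht => ⟨fun x hx => ?_, ?_⟩⟩
  · have hc := hφ.continuous_fderiv one_ne_zero
    have hms : MeasurableSet {z : E | n ≤ ‖z‖ + 1} :=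
      (isClosed_le continuous_const (by fun_prop)).measurableSet
    have hi1 : Integrable fun z => g t z • (1 : E →L[ℝ] E) := (hg.integrable t).smul_const _
    have hm : AEStronglyMeasurable (fun z => 1 - fderiv ℝ φ (z - x)) volume :=
      (continuous_const.sub (hc.comp (continuous_id.sub continuous_const))).aestronglyMeasurable
    have hi2 : Integrable fun z => g t z • (1 - fderiv ℝ φ (z - x)) := by
      refine ((hg.integrable t).abs.const_mul C).mono'
        ((hg.integrable t).aestronglyMeasurable.smul hm) (.of_forall fun z => ?_)
      rw [norm_smul, mul_comm]
      exact mul_le_mul_of_nonneg_right (hφC _) (norm_nonneg _)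
    have hi3 : Integrable fun z => g t z • fderiv ℝ φ (z - x) := by
      refine (hi1.sub hi2).congr (.of_forall fun z => ?_)
      simp only [Pi.sub_apply, smul_sub, sub_sub_cancel]
    have h2 : 1 - ∫ z, g t z • fderiv ℝ φ (z - x) = ∫ z, g t z • (1 - fderiv ℝ φ (z - x)) := by
      simp only [smul_sub]
      rw [integral_sub hi1 hi3, integral_smul_const, hg.integral_eq, h1, one_smul]
    have hi4 : Integrable fun z => C * |g t z - g t₀ z| :=
      ((hg.integrable t).sub (hg.integrable t₀)).abs.const_mul C
    have hi5 : Integrable fun z => C * {z : E | n ≤ ‖z‖ + 1}.indicator (fun z => |g t₀ z|) z :=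
      ((hg.integrable t₀).abs.indicator hms).const_mul C
    rw [h2]
    refine (norm_integral_le_of_norm_le (hi4.add hi5) (.of_forall fun z => ?_)).trans ?_
    · rw [norm_smul, mul_comm, Pi.add_apply, ← mul_add, norm_eq_abs]
      rw [mem_closedBall_zero_iff] at hx
      by_cases hz : z ∈ {z : E | n ≤ ‖z‖ + 1}
      · rw [Set.indicator_of_mem hz]
        refine mul_le_mul (hφC _) ?_ (abs_nonneg _) hC0
        have := abs_add_le (g t z - g t₀ z) (g t₀ z)
        rwa [sub_add_cancel] at this
      · rw [Set.indicator_of_notMem hz]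
        rw [Set.mem_ofPred_eq, not_le] at hz
        rw [hφn _ (by linarith [norm_sub_le z x]), sub_self, norm_zero, zero_mul]
        positivity
    · have h3 := (hδb ht).1
      rw [integral_add' hi4 hi5, integral_const_mul, integral_const_mul]
      linarith
  · have hi : ∀ s, Integrable fun z => g s z • φ (z - 0) := fun s => by
      refine ((hg.integrable s).abs.const_mul B).mono' ((hg.integrable s).aestronglyMeasurable.smul
        (hφ.continuous.comp (continuous_id.sub continuous_const)).aestronglyMeasurable)
        (.of_forall fun z => ?_)
      rw [norm_smul, mul_comm]
      exact mul_le_mul_of_nonneg_right (hB _) (norm_nonneg _)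
    rw [← integral_sub (hi t) (hi t₀)]
    refine le_trans ?_ (hδb ht).2.le
    rw [← integral_const_mul]
    refine norm_integral_le_of_norm_le (((hg.integrable t).sub (hg.integrable t₀)).abs.const_mul B)
      (.of_forall fun z => ?_)
    rw [← sub_smul, norm_smul, mul_comm]
    exact mul_le_mul_of_nonneg_right (hB _) (norm_nonneg _)

/-- The mean field normalized to vanish at the origin. -/
def centeredField (K : E × E → E) (ρ : E → ℝ) (z : E) : E :=
  ∫ z', ρ z' • (K (z, z') - K (0, z'))

lemma norm_centeredField_le (h : IsInteractionKernel K L) {ρ : E → ℝ} (hρ : Integrable ρ) (z : E) :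
    ‖centeredField K ρ z‖ ≤ L * ‖z‖ * ∫ z', |ρ z'| := by
  simpa [centeredField] using norm_integral_smul_kernel_sub_le h hρ z 0

lemma IsL1Solution.continuous_centeredField (h : IsInteractionKernel K L)
    (hg : IsL1Solution K g) : Continuous fun p : ℝ × E => centeredField K (g p.1) p.2 := by
  have hL := h.nonneg
  refine continuous_iff_continuousAt.2 fun p => ?_
  refine tendsto_integral_smul (C := L * (‖p.2‖ + 1)) (fun q : ℝ × E => hg.integrable q.1)
    (hg.integrable p.1) (hg.tendsto_fst p) (fun q => ?_) ?_ (fun z => ?_)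
  · exact ((h.continuous.comp (Continuous.prodMk_right _)).sub
      (h.continuous.comp (Continuous.prodMk_right _))).aestronglyMeasurable
  · have : ∀ᶠ q : ℝ × E in 𝓝 p, ‖q.2‖ < ‖p.2‖ + 1 :=
      continuous_snd.norm.continuousAt.eventually_lt_const (by simp)
    filter_upwards [this] with q hq z
    refine (h.lip_fst q.2 0 z).trans ?_
    rw [sub_zero]
    gcongr
  · exact ((h.continuous.comp (continuous_snd.prodMk continuous_const)).sub
      continuous_const).continuousAt

lemma IsL1Solution.continuous_integral_fderiv_centeredField (h : IsInteractionKernel K L)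
    (hg : IsL1Solution K g) {φ : E → E} (hφ : ContDiff ℝ 1 φ) (hs : HasCompactSupport φ) :
    Continuous fun p : ℝ × E =>
      ∫ z, g p.1 z • fderiv ℝ φ (z - p.2) (centeredField K (g p.1) z) := by
  have hL := h.nonneg
  have hc := hφ.continuous_fderiv one_ne_zero
  have hU := hg.continuous_centeredField h
  obtain ⟨C, hC0, hC⟩ := hφ.exists_fderiv_bound hs
  obtain ⟨R, hR0, hR⟩ := HasCompactSupport.exists_radius (hs.fderiv (𝕜 := ℝ)).norm
  refine continuous_iff_continuousAt.2 fun p => ?_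
  set m := ∫ z, |g p.1 z|
  have hm0 : 0 ≤ m := integral_nonneg fun _ => abs_nonneg _
  refine tendsto_integral_smul (C := C * (L * (R + (‖p.2‖ + 1)) * (m + 1)))
    (fun q : ℝ × E => hg.integrable q.1) (hg.integrable p.1) (hg.tendsto_fst p)
    (fun q => ?_) ?_ (fun z => ?_)
  · exact ((hc.comp (continuous_id.sub continuous_const)).clm_apply
      (hU.comp (Continuous.prodMk_right q.1))).aestronglyMeasurable
  · have h1 : ∀ᶠ q : ℝ × E in 𝓝 p, ‖q.2‖ < ‖p.2‖ + 1 :=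
      continuous_snd.norm.continuousAt.eventually_lt_const (by simp)
    have h2 : ∀ᶠ q : ℝ × E in 𝓝 p, ∫ z, |g q.1 z| < m + 1 :=
      (hg.continuous_integral_abs.comp continuous_fst).continuousAt.eventually_lt_const (by simp [m])
    filter_upwards [h1, h2] with q hq1 hq2 z
    by_cases hz : R < 1 + ‖z - q.2‖
    · rw [norm_eq_zero.1 (hR _ hz), zero_apply, norm_zero]
      positivity
    · refine (ContinuousLinearMap.le_of_opNorm_le _ (hC _) _).trans ?_
      gcongr
      refine (norm_centeredField_le h (hg.integrable _) z).trans ?_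
      have h3 : ‖z‖ ≤ R + (‖p.2‖ + 1) := by
        have := norm_add_le (z - q.2) q.2
        rw [sub_add_cancel] at this
        linarith
      have h4 : 0 ≤ ∫ z, |g q.1 z| := integral_nonneg fun _ => abs_nonneg _
      gcongr
  · exact ((hc.comp (continuous_const.sub continuous_snd)).clm_apply
      (hU.comp (continuous_fst.prodMk continuous_const))).continuousAt

end FrameChoice

section MovingFrame

variable {E : Type*} [NormedAddCommGroup E] [NormedSpace ℝ E] [FiniteDimensional ℝ E]
  [MeasureSpace E] [BorelSpace E] [(volume : Measure E).IsAddHaarMeasure]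
  {K : E × E → E} {L : ℝ} {c : ℝ → E → E} {g : ℝ → E → ℝ} {I : Set ℝ}

/-- Transport equations are covariant under changes to a moving frame. -/
lemma IsTransportedBy.translate (hg : IsTransportedBy c g I) (hI : IsOpen I) {x x' : ℝ → E}
    (hx : ∀ t ∈ I, HasDerivAt x (x' t) t) :
    IsTransportedBy (fun t z => c t (z + x t) - x' t) (fun t z => g t (z + x t)) I where
  integrable t ht := (hg.integrable t ht).comp_add_right (x t)
  field_continuous t ht :=
    ((hg.field_continuous t ht).comp (continuous_id.add continuous_const)).sub continuous_const
  tendsto t₀ ht₀ := by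
    have h1 := (tendsto_integral_abs_translate_sub (hg.integrable t₀ ht₀) (x t₀)).comp
      ((hx t₀ ht₀).continuousAt.tendsto.mono_left (nhdsWithin_le_nhds (s := I)))
    have h2 := (hg.tendsto t₀ ht₀).add h1
    rw [add_zero] at h2
    refine squeeze_zero' (.of_forall fun t => integral_nonneg fun _ => abs_nonneg _) ?_ h2
    filter_upwards [self_mem_nhdsWithin] with t ht
    have hi1 : Integrable fun z => |g t (z + x t) - g t₀ (z + x t)| :=
      (((hg.integrable t ht).sub (hg.integrable t₀ ht₀)).comp_add_right (x t)).abs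
    have hi2 : Integrable fun z => |g t₀ (z + x t) - g t₀ (z + x t₀)| :=
      (((hg.integrable t₀ ht₀).comp_add_right (x t)).sub
        ((hg.integrable t₀ ht₀).comp_add_right (x t₀))).abs
    rw [Function.comp_apply,
      ← integral_add_right_eq_self (fun z => |g t z - g t₀ z|) (x t), ← integral_add hi1 hi2]
    exact integral_mono_of_nonneg (.of_forall fun _ => abs_nonneg _) (hi1.add hi2)
      (.of_forall fun z => abs_sub_le _ _ _)
  hasDerivAt φ hφ hs t ht := by
    obtain ⟨ℓ, hℓ⟩ := (hφ.bounds_of_hasCompactSupport hs).2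
    have hℓ0 : 0 ≤ ℓ := (norm_nonneg _).trans (hℓ 0)
    have hφd : ∀ z, HasFDerivAt φ (fderiv ℝ φ z) z := fun z =>
      (hφ.differentiable one_ne_zero z).hasFDerivAt
    have hθd : ∀ z, HasFDerivAt (fun z => φ (z - x t)) (fderiv ℝ φ (z - x t)) z := fun z =>
      ((hφd (z - x t)).comp z ((hasFDerivAt_id z).sub_const (x t))).congr_fderiv (by ext; simp)
    have hcs : HasCompactSupport fun z => φ (z - x t) := by
      simpa [sub_eq_add_neg, Function.comp_def] using hs.comp_homeomorph (Homeomorph.addRight (-x t))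
    obtain ⟨C, hC⟩ := (hx t ht).isBigO_sub.bound
    have hmain := hg.hasDerivAt_integral hI ht (θ := fun s z => φ (z - x s))
      (θ' := fun z => -(fderiv ℝ φ (z - x t) (x' t))) (C := ℓ * C)
      (hφ.comp (contDiff_id.sub contDiff_const)) hcs
      (fun s => hφ.continuous.comp (continuous_id.sub continuous_const))
      (fun z => by
        have := (hφd (z - x t)).comp_hasDerivAt t ((hx t ht).const_sub z)
        refine this.congr_deriv (map_neg _ _))
      (by
        filter_upwards [hC] with s hs z
        have h3 : ‖φ (z - x s) - φ (z - x t)‖ ≤ ℓ * ‖(z - x s) - (z - x t)‖ :=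
          convex_univ.norm_image_sub_le_of_norm_fderiv_le
            (fun x _ => hφ.differentiable one_ne_zero x) (fun x _ => hℓ x)
            (Set.mem_univ _) (Set.mem_univ _)
        rw [sub_sub_sub_cancel_left, norm_sub_rev (x t) (x s)] at h3
        refine h3.trans ?_
        rw [mul_assoc]
        exact mul_le_mul_of_nonneg_left hs hℓ0)
    have hL : ∀ s, ∫ z, φ z * g s (z + x s) = ∫ z, φ (z - x s) * g s z := fun s => by
      rw [← integral_add_right_eq_self (fun z => φ (z - x s) * g s z) (x s)]
      simp only [add_sub_cancel_right]
    simp only [hL]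
    refine hmain.congr_deriv ?_
    have hDs := hcs.fderiv (𝕜 := ℝ)
    have hDc : Continuous fun z => fderiv ℝ φ (z - x t) :=
      (hφ.continuous_fderiv one_ne_zero).comp (continuous_id.sub continuous_const)
    have hDs' : HasCompactSupport fun z => fderiv ℝ φ (z - x t) := by
      have : (fderiv ℝ fun z => φ (z - x t)) = fun z => fderiv ℝ φ (z - x t) :=
        funext fun z => (hθd z).fderiv
      rwa [this] at hDs
    have hi : ∀ u : E → E, Continuous u →
        Integrable fun z => fderiv ℝ φ (z - x t) (u z) * g t z := fun u hu =>
      integrable_mul_of_hasCompactSupport (hDc.clm_apply hu)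
        (hDs'.mono fun z hz => by contrapose! hz; simp_all) (hg.integrable t ht)
    have hi1 := hi (fun _ => -x' t) continuous_const
    simp only [map_neg] at hi1
    rw [← integral_add hi1, ← integral_add_right_eq_self _ (x t)]
    · refine integral_congr_ae (.of_forall fun z => ?_)
      simp only [(hθd _).fderiv, add_sub_cancel_right, map_sub]
      ring
    · simp only [(hθd _).fderiv]
      exact hi _ (hg.field_continuous t ht)

lemma IsTransportedBy.congr_field {c' : ℝ → E → E} (hg : IsTransportedBy c g I)
    (hc : ∀ t ∈ I, c t = c' t) : IsTransportedBy c' g I where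
  integrable := hg.integrable
  tendsto := hg.tendsto
  field_continuous t ht := hc t ht ▸ hg.field_continuous t ht
  hasDerivAt φ hφ hs t ht := hc t ht ▸ hg.hasDerivAt φ hφ hs t ht

/-- Locally in time, in a suitable moving frame, the mean field is a tame field, switched on and
off in time. -/
lemma IsL1Solution.exists_moving_frame (h : IsInteractionKernel K L) (hg : IsL1Solution K g)
    (h1 : ∫ z, g 0 z = 1) (t₀ : ℝ) :
    ∃ δ > 0, ∃ (x : ℝ → E) (W : ℝ → E → E), (∀ t ∈ Metric.ball t₀ δ, ‖x t‖ ≤ 1) ∧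
      IsTransportedBy
        (fun t z => {t | Integrable fun z => g t z • K (0, z)}.indicator (1 : ℝ → ℝ) t • W t z)
        (fun t z => g t (z + x t)) (Metric.ball t₀ δ) ∧
      ∀ p q, Set.Icc p q ⊆ Metric.ball t₀ δ →
        ∃ Λ κ, 0 ≤ Λ ∧ 0 ≤ κ ∧ IsTameField W Λ κ p q := by
  have : ProperSpace E := FiniteDimensional.proper_real E
  obtain ⟨φ, hφ, hs, δ, hδ, hδφ⟩ := hg.exists_frame_data h1 t₀
  set I := Metric.ball t₀ δ
  have hL := h.nonneg
  have hDc := hφ.continuous_fderiv one_ne_zero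
  set P : ℝ → E → E →L[ℝ] E := fun t x => ∫ z, g t z • fderiv ℝ φ (z - x) with hPdef
  set Q : ℝ → E → E := fun t x => ∫ z, g t z • fderiv ℝ φ (z - x) (centeredField K (g t) z)
    with hQdef
  have hPc : Continuous fun p : ℝ × E => P p.1 p.2 := hg.continuous_integral_fderiv hφ hs
  have hQc : Continuous fun p : ℝ × E => Q p.1 p.2 :=
    hg.continuous_integral_fderiv_centeredField h hφ hs
  have hφd : ∀ x z, HasFDerivAt (fun z => φ (z - x)) (fderiv ℝ φ (z - x)) z := fun x z =>
    (((hφ.differentiable one_ne_zero (z - x)).hasFDerivAt).comp z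
      ((hasFDerivAt_id z).sub_const x)).congr_fderiv (by ext; simp)
  have hcs : ∀ x, HasCompactSupport fun z => φ (z - x) := fun x => by
    simpa [sub_eq_add_neg, Function.comp_def] using hs.comp_homeomorph (Homeomorph.addRight (-x))
  obtain ⟨x, hx⟩ := exists_implicit_curve (G := fun t x => ∫ z, g t z • φ (z - x))
    (G' := fun t x => ∫ z, g t z • fderiv ℝ φ (z - x) (meanField K (g t) z)) (P := P) (r := 1)
    Metric.isOpen_ball zero_le_one
    (fun t x => hasFDerivAt_integral_translate (hg.integrable t) hφ hs x) hPc
    (fun t ht => (hδφ t ht).1) (fun t ht => (hδφ t ht).2) (fun t x => by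
      have := hg.hasDerivAt_integral_smul h (φ := fun z => φ (z - x))
        (hφ.comp (contDiff_id.sub contDiff_const)) (hcs x) t
      simpa only [(hφd x _).fderiv] using this)
  have hunit : ∀ t ∈ I, IsUnit (P t (x t)) := fun t ht => by
    have h2 : IsUnit (1 - (1 - P t (x t))) := isUnit_one_sub_of_norm_lt_one
      (((hδφ t ht).1 (x t) (mem_closedBall_zero_iff.2 (hx t ht).1)).trans_lt (by norm_num))
    rwa [sub_sub_cancel] at h2
  have hxc : ContinuousOn x I := fun t ht => (hx t ht).2.continuousAt.continuousWithinAt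
  have hpair : ContinuousOn (fun t => (t, x t)) I := continuousOn_id.prodMk hxc
  set y : ℝ → E := fun t => Ring.inverse (P t (x t)) (Q t (x t))
  have hyc : ContinuousOn y I := fun t ht => by
    obtain ⟨u, hu⟩ := hunit t ht
    have hi : ContinuousAt Ring.inverse (P t (x t)) := hu ▸ NormedRing.inverse_continuousAt u
    have h2 : ContinuousWithinAt (fun t => P t (x t)) I t := (hPc.comp_continuousOn hpair) t ht
    exact (ContinuousAt.comp_continuousWithinAt (f := fun t => P t (x t)) (g := Ring.inverse)
      (x := t) hi h2).clm_apply ((hQc.comp_continuousOn hpair) t ht)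
  refine ⟨δ, hδ, x, fun t z => centeredField K (g t) (z + x t) - y t, fun t ht => (hx t ht).1,
    ?_, fun p q hpq => ?_⟩
  · have hT := hg.isTransportedBy h
    have hT' : IsTransportedBy (fun t => meanField K (g t)) g I :=
      ⟨fun t _ => hg.integrable t, fun t _ => (hg.tendsto t).mono_left nhdsWithin_le_nhds,
        fun t _ => hT.field_continuous t trivial, fun φ h1 h2 t _ => hT.hasDerivAt φ h1 h2 t trivial⟩
    refine (hT'.translate Metric.isOpen_ball fun t ht => (hx t ht).2).congr_field fun t ht => ?_
    funext z
    by_cases hA : Integrable fun z => g t z • K (0, z)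
    · rw [Set.indicator_of_mem (by exact hA), Pi.one_apply, one_smul]
      have hV : ∀ z, meanField K (g t) z = meanField K (g t) 0 + centeredField K (g t) z :=
        fun z => by rw [centeredField, ← meanField_sub h (hg.integrable t) hA, add_sub_cancel]
      obtain ⟨C, hC0, hC⟩ := hφ.exists_fderiv_bound hs
      have hDxc : Continuous fun z => fderiv ℝ φ (z - x t) :=
        hDc.comp (continuous_id.sub continuous_const)
      have hi1 : Integrable fun z => g t z • fderiv ℝ φ (z - x t) := by
        refine ((hg.integrable t).abs.const_mul C).mono'
          ((hg.integrable t).aestronglyMeasurable.smul hDxc.aestronglyMeasurable)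
          (.of_forall fun z => ?_)
        rw [norm_smul, mul_comm]
        exact mul_le_mul_of_nonneg_right (hC _) (norm_nonneg _)
      have hi2 : Integrable fun z =>
          g t z • fderiv ℝ φ (z - x t) (centeredField K (g t) z) := by
        have hcont : Continuous fun z => fderiv ℝ φ (z - x t) (centeredField K (g t) z) :=
          hDxc.clm_apply ((hg.continuous_centeredField h).comp (Continuous.prodMk_right t))
        have hsupp : HasCompactSupport fun z =>
            fderiv ℝ φ (z - x t) (centeredField K (g t) z) :=
          ((hcs (x t)).fderiv (𝕜 := ℝ)).mono fun z hz => by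
            contrapose! hz; simp_all [(hφd (x t) z).fderiv]
        obtain ⟨B, hB⟩ := hsupp.exists_bound_of_continuous hcont
        refine ((hg.integrable t).abs.const_mul B).mono'
          ((hg.integrable t).aestronglyMeasurable.smul hcont.aestronglyMeasurable)
          (.of_forall fun z => ?_)
        rw [norm_smul, mul_comm]
        exact mul_le_mul_of_nonneg_right (hB _) (norm_nonneg _)
      have hG : ∫ z, g t z • fderiv ℝ φ (z - x t) (meanField K (g t) z) =
          P t (x t) (meanField K (g t) 0) + Q t (x t) := by
        rw [hPdef, hQdef, ContinuousLinearMap.integral_apply hi1, ← integral_add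
          (hi1.apply_continuousLinearMap _) hi2]
        refine integral_congr_ae (.of_forall fun z => ?_)
        simp only [hV z, map_add, smul_add, smul_apply]
      rw [hG, map_add, ← mul_apply_eq_comp, Ring.inverse_mul_cancel _ (hunit t ht),
        one_apply_eq_self, hV]
      simp only [y]
      abel
    · rw [Set.indicator_of_notMem (by exact hA), zero_smul]
      simp [meanField_eq_zero h (hg.integrable t) hA]
  · obtain ⟨Γ, hΓ0, hΓ⟩ := hg.exists_mass_bound p q
    obtain ⟨B, hB⟩ := (isCompact_Icc (a := p) (b := q)).exists_bound_of_continuousOn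
      (hyc.mono hpq)
    refine ⟨L * Γ, L * Γ + max B 0, by positivity, by positivity, fun t ht => ?_,
      fun t ht z => ?_, fun t ht z => ?_, ?_⟩
    · exact ((h.contDiff_integral (hg.integrable t) aestronglyMeasurable_id 0).comp
        (contDiff_id.add contDiff_const)).sub contDiff_const
    · have h2 := h.norm_fderiv_integral_le (hg.integrable t) aestronglyMeasurable_id 0 (z + x t)
      rw [fderiv_sub_const, fderiv_comp_add_right (f := centeredField K (g t))]
      exact h2.trans (mul_le_mul_of_nonneg_left (hΓ t ht) hL)
    · have h2 := norm_centeredField_le h (hg.integrable t) (z + x t)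
      have h3 : ‖z + x t‖ ≤ 1 + ‖z‖ := by
        linarith [norm_add_le z (x t), (hx t (hpq ht)).1]
      have h4 : ‖y t‖ ≤ max B 0 := (hB t ht).trans (le_max_left _ _)
      have h5 : 0 ≤ ∫ z', |g t z'| := integral_nonneg fun _ => abs_nonneg _
      have h6 : L * ‖z + x t‖ * ∫ z', |g t z'| ≤ L * (1 + ‖z‖) * Γ := by
        gcongr
        exact hΓ t ht
      refine (norm_sub_le _ _).trans ?_
      nlinarith [norm_nonneg z, le_max_right B 0, mul_nonneg (le_max_right B 0) (norm_nonneg z)]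
    · refine ContinuousOn.sub ?_ ((hyc.mono hpq).comp continuousOn_fst fun a ha => ha.1)
      exact (hg.continuous_centeredField h).comp_continuousOn (continuousOn_fst.prodMk
        (continuousOn_snd.add ((hxc.mono hpq).comp continuousOn_fst fun a ha => ha.1)))

end MovingFrame

section MomentBound

variable {E : Type*} [NormedAddCommGroup E] [NormedSpace ℝ E] [FiniteDimensional ℝ E]
  [MeasureSpace E] [BorelSpace E] [(volume : Measure E).IsAddHaarMeasure]
  {K : E × E → E} {L Λ κ Γ p q : ℝ} {W : ℝ → E → E} {g : ℝ → E → ℝ} {I A : Set ℝ}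

lemma IsTameField.smul (hW : IsTameField W Λ κ p q) {α : ℝ → ℝ}
    (hα : Continuous α) (hα0 : ∀ t, 0 ≤ α t) (hα1 : ∀ t, α t ≤ 1) :
    IsTameField (fun t z => α t • W t z) Λ κ p q where
  contDiff t ht := (hW.contDiff t ht).const_smul (α t)
  norm_fderiv_le t ht z := by
    rw [fderiv_fun_const_smul ((hW.contDiff t ht).differentiable one_ne_zero z), norm_smul,
      Real.norm_of_nonneg (hα0 t)]
    exact (mul_le_of_le_one_left (norm_nonneg _) (hα1 t)).trans (hW.norm_fderiv_le t ht z)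
  norm_le t ht z := by
    rw [norm_smul, Real.norm_of_nonneg (hα0 t)]
    exact (mul_le_of_le_one_left (norm_nonneg _) (hα1 t)).trans (hW.norm_le t ht z)
  continuousOn := (hα.comp continuous_fst).continuousOn.smul hW.continuousOn

/-- Transport by a tame field, switched on and off in time, propagates first moments. -/
lemma IsTransportedBy.integrable_weight (hA : MeasurableSet A)
    (hg : IsTransportedBy (fun t z => A.indicator (1 : ℝ → ℝ) t • W t z) g I) (hI : IsOpen I)
    (hle : p ≤ q) (hpq : Set.Icc p q ⊆ I) (hW : IsTameField W Λ κ p q) (hκ : 0 ≤ κ)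
    (hΛ : 0 ≤ Λ) (hΓ0 : 0 ≤ Γ) (hΓ : ∀ s ∈ Set.Icc p q, ∫ z, |g s z| ≤ Γ)
    (hm : Integrable fun z => (1 + ‖z‖) * |g p z|) :
    Integrable (fun z => (1 + ‖z‖) * |g q z|) ∧
      ∫ z, (1 + ‖z‖) * |g q z| ≤ exp (κ * (q - p)) * ∫ z, (1 + ‖z‖) * |g p z| := by
  refine integrable_weight_of_forall_contDiff (hg.integrable q (hpq ⟨hle, le_rfl⟩))
    fun φ hφ hs hφw => ?_
  obtain ⟨ℓ, hℓ⟩ := (hφ.bounds_of_hasCompactSupport hs).2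
  have hℓ0 : 0 ≤ ℓ := (norm_nonneg _).trans (hℓ 0)
  obtain ⟨R, hR0, hR⟩ := hs.exists_radius
  refine le_of_forall_pos_le_add fun ε hε => ?_
  set B := κ * (R * exp (2 * κ * (q - p))) with hBdef
  have hB0 : 0 ≤ B := by positivity
  set D := ℓ * exp (Λ * (q - p)) * Γ with hDdef
  have hD0 : 0 ≤ D := by positivity
  obtain ⟨α, hα, hα0, hα1, hαA⟩ := exists_continuous_approx_indicator hA hle
    (ε := ε / 2 / (D * B + 1)) (by positivity)
  have hi1 : IntervalIntegrable (A.indicator (1 : ℝ → ℝ)) volume p q := by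
    rw [intervalIntegrable_iff, Set.uIoc_of_le hle]
    exact (integrable_const (1 : ℝ)).indicator hA
  have hev := hg.eventually_abs_integral_sub_eulerBack_le hI hle hpq (hW.smul hα hα0 hα1) hκ hΛ hφ
    hℓ hR0 hR (η := fun s => |A.indicator (1 : ℝ → ℝ) s - α s| * B)
    ((hi1.sub (hα.intervalIntegrable p q)).abs.mul_const B) (fun s => by positivity)
    (fun s hs z hz => by
      rw [← sub_smul, norm_smul, Real.norm_eq_abs]
      refine mul_le_mul_of_nonneg_left ((hW.norm_le s hs z).trans ?_) (abs_nonneg _)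
      exact mul_le_mul_of_nonneg_left hz hκ) hΓ (half_pos hε)
  obtain ⟨n, hn⟩ := hev.exists
  have hnh : n * ((q - p) / n) ≤ q - p := by
    rcases eq_or_ne (n : ℝ) 0 with h0 | h0
    · rw [h0, zero_mul]; linarith
    · rw [mul_div_cancel₀ _ h0]
  have hψ : |∫ z, eulerBack (fun t z => α t • W t z) φ q ((q - p) / n) n z * g p z| ≤
      exp (κ * (q - p)) * ∫ z, (1 + ‖z‖) * |g p z| := by
    rw [← integral_const_mul, ← norm_eq_abs]
    refine norm_integral_le_of_norm_le (hm.const_mul _) (.of_forall fun z => ?_)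
    have h1 := (hW.smul hα hα0 hα1).abs_eulerBack_le zero_le_one (by simpa using hφw)
      (div_nonneg (sub_nonneg.2 hle) n.cast_nonneg) hnh z
    rw [norm_mul, norm_eq_abs, norm_eq_abs, ← mul_assoc]
    refine mul_le_mul_of_nonneg_right (h1.trans ?_) (abs_nonneg _)
    rw [one_mul]
    gcongr
  have hη : D * ∫ s in p..q, |A.indicator (1 : ℝ → ℝ) s - α s| * B ≤ ε / 2 := by
    rw [intervalIntegral.integral_mul_const]
    calc D * ((∫ s in p..q, |A.indicator (1 : ℝ → ℝ) s - α s|) * B)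
        = D * B * ∫ s in p..q, |A.indicator (1 : ℝ → ℝ) s - α s| := by ring
      _ ≤ D * B * (ε / 2 / (D * B + 1)) := by gcongr
      _ = ε / 2 * (D * B / (D * B + 1)) := by ring
      _ ≤ ε / 2 * 1 := by gcongr; exact (div_le_one (by positivity)).2 (by linarith)
      _ = ε / 2 := mul_one _
  have h3 := abs_sub_abs_le_abs_sub (∫ z, φ z * g q z)
    (∫ z, eulerBack (fun t z => α t • W t z) φ q ((q - p) / n) n z * g p z)
  linarith

lemma integrable_weight_translate {ρ : E → ℝ} (hρ : Integrable ρ)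
    (hm : Integrable fun z => (1 + ‖z‖) * |ρ z|) {x : E} (hx : ‖x‖ ≤ 1) :
    Integrable (fun z => (1 + ‖z‖) * |ρ (z + x)|) ∧
      ∫ z, (1 + ‖z‖) * |ρ (z + x)| ≤ 2 * ∫ z, (1 + ‖z‖) * |ρ z| := by
  have h1 : Integrable fun z => 2 * ((1 + ‖z + x‖) * |ρ (z + x)|) :=
    (hm.comp_add_right x).const_mul 2
  have h2 : ∀ z, (1 + ‖z‖) * |ρ (z + x)| ≤ 2 * ((1 + ‖z + x‖) * |ρ (z + x)|) := fun z => by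
    have h3 : ‖z‖ ≤ ‖z + x‖ + ‖x‖ := by simpa using norm_sub_le (z + x) x
    rw [← mul_assoc]
    refine mul_le_mul_of_nonneg_right ?_ (abs_nonneg _)
    linarith [norm_nonneg (z + x)]
  have h4 : Integrable fun z => (1 + ‖z‖) * |ρ (z + x)| := by
    refine h1.mono' ((continuous_const.add continuous_norm).aestronglyMeasurable.mul
      (hρ.comp_add_right x).abs.aestronglyMeasurable) (.of_forall fun z => ?_)
    rw [Real.norm_of_nonneg (by positivity)]
    exact h2 z
  refine ⟨h4, (integral_mono h4 h1 h2).trans_eq ?_⟩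
  rw [integral_const_mul, integral_add_right_eq_self (fun z => (1 + ‖z‖) * |ρ z|) x]

lemma IsL1Solution.exists_local_moment_bound (h : IsInteractionKernel K L)
    (hg : IsL1Solution K g) (h1 : ∫ z, g 0 z = 1) (t₀ : ℝ) :
    ∃ δ > 0, ∀ p q, Set.Icc p q ⊆ Metric.ball t₀ δ →
      Integrable (fun z => (1 + ‖z‖) * |g p z|) →
      ∃ M, ∀ t ∈ Set.Icc p q, Integrable (fun z => (1 + ‖z‖) * |g t z|) ∧
        ∫ z, (1 + ‖z‖) * |g t z| ≤ M := by
  obtain ⟨δ, hδ, x, W, hx, hT, hW⟩ := hg.exists_moving_frame h h1 t₀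
  refine ⟨δ, hδ, fun p q hpq hm => ?_⟩
  obtain ⟨Λ, κ, hΛ, hκ, hWpq⟩ := hW p q hpq
  obtain ⟨Γ, hΓ0, hΓ⟩ := hg.exists_mass_bound p q
  have hA := measurableSet_integrable_smul hg.integrable hg.tendsto
    (h.continuous.comp (Continuous.prodMk_right (0 : E)))
  refine ⟨2 * (exp (κ * (q - p)) * (2 * ∫ z, (1 + ‖z‖) * |g p z|)), fun t ht => ?_⟩
  have hp : p ∈ Set.Icc p q := ⟨le_rfl, ht.1.trans ht.2⟩
  obtain ⟨h2, h3⟩ := integrable_weight_translate (hg.integrable p) hm (hx p (hpq hp))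
  obtain ⟨h4, h5⟩ := IsTransportedBy.integrable_weight hA hT Metric.isOpen_ball ht.1
    ((Set.Icc_subset_Icc_right ht.2).trans hpq) (hWpq.mono le_rfl ht.2) hκ hΛ hΓ0
    (fun s hs => by
      rw [integral_add_right_eq_self (fun z => |g s z|) (x s)]
      exact hΓ s ⟨hs.1, hs.2.trans ht.2⟩) h2
  obtain ⟨h6, h7⟩ := integrable_weight_translate (x := -x t)
    ((hg.integrable t).comp_add_right (x t)) h4 (by rw [norm_neg]; exact hx t (hpq ht))
  simp only [neg_add_cancel_right] at h6 h7
  refine ⟨h6, h7.trans ?_⟩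
  gcongr
  refine h5.trans ?_
  have h8 : 0 ≤ ∫ z, (1 + ‖z‖) * |g p (z + x p)| := integral_nonneg fun z => by positivity
  gcongr
  exact ht.2

/-- An `L¹` solution whose initial datum has a first moment keeps it, locally uniformly in
time. -/
lemma IsL1Solution.exists_moment_bound (h : IsInteractionKernel K L)
    (hg : IsL1Solution K g) (h1 : ∫ z, g 0 z = 1)
    (hm : Integrable fun z => (1 + ‖z‖) * |g 0 z|) (T : ℝ) :
    ∃ M, ∀ t ∈ Set.Icc 0 T, Integrable (fun z => (1 + ‖z‖) * |g t z|) ∧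
      ∫ z, (1 + ‖z‖) * |g t z| ≤ M := by
  rcases lt_or_ge T 0 with hT | hT
  · exact ⟨0, fun t ht => absurd (ht.1.trans ht.2) (not_le.2 hT)⟩
  choose δ hδ hloc using hg.exists_local_moment_bound h h1
  obtain ⟨s, hs0, hsm, ⟨m, hsT⟩, hcov⟩ := exists_monotone_Icc_subset_open_cover_Icc hT
    (c := fun t₀ => ((↑) : Set.Icc 0 T → ℝ) ⁻¹' Metric.ball t₀ (δ t₀))
    (fun t₀ => Metric.isOpen_ball.preimage continuous_subtype_val)
    (fun t _ => Set.mem_iUnion.2 ⟨t, Metric.mem_ball_self (hδ _)⟩)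
  have hind : ∀ n, ∃ M, ∀ t ∈ Set.Icc 0 (s n : ℝ), Integrable (fun z => (1 + ‖z‖) * |g t z|) ∧
      ∫ z, (1 + ‖z‖) * |g t z| ≤ M := by
    intro n
    induction n with
    | zero =>
      refine ⟨∫ z, (1 + ‖z‖) * |g 0 z|, fun t ht => ?_⟩
      obtain rfl : t = 0 := by
        have h2 := ht.2
        rw [hs0] at h2
        exact le_antisymm h2 ht.1
      exact ⟨hm, le_rfl⟩
    | succ n ih =>
      obtain ⟨M, hM⟩ := ih
      obtain ⟨i, hi⟩ := hcov n
      obtain ⟨M', hM'⟩ := hloc i (s n) (s (n + 1)) (fun t ht => hi (a := ⟨t,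
        (s n).2.1.trans ht.1, ht.2.trans (s (n + 1)).2.2⟩) ht) (hM _ ⟨(s n).2.1, le_rfl⟩).1
      refine ⟨max M M', fun t ht => ?_⟩
      rcases le_total t (s n) with hts | hts
      · exact ⟨(hM t ⟨ht.1, hts⟩).1, (hM t ⟨ht.1, hts⟩).2.trans (le_max_left _ _)⟩
      · exact ⟨(hM' t ⟨hts, ht.2⟩).1, (hM' t ⟨hts, ht.2⟩).2.trans (le_max_right _ _)⟩
  obtain ⟨M, hM⟩ := hind m
  exact ⟨M, by rwa [hsT m le_rfl] at hM⟩

end MomentBound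

section Uniqueness

variable {d : ℕ}
  {K : EuclideanSpace ℝ (Fin d) × EuclideanSpace ℝ (Fin d) → EuclideanSpace ℝ (Fin d)}
  {L : ℝ} {f₀ : EuclideanSpace ℝ (Fin d) → ℝ} {g : ℝ → EuclideanSpace ℝ (Fin d) → ℝ}
  {Z : ℝ → EuclideanSpace ℝ (Fin d) → EuclideanSpace ℝ (Fin d)}

lemma IsL1MeanFieldSol.isL1Solution (hg : IsL1MeanFieldSol K f₀ g) : IsL1Solution K g :=
  ⟨hg.1, hg.2.1, hg.2.2.2⟩

lemma IsL1Solution.ae_eq_flowDensity_of_nonneg (h : IsInteractionKernel K L)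
    (h0 : ∀ z, 0 ≤ f₀ z) (hi : Integrable f₀) (h1 : ∫ z, f₀ z = 1)
    (hm : Integrable (fun z => ‖z‖ * f₀ z)) (hZ : IsMeanFieldFlow K (densMeasure f₀) Z)
    (hg : IsL1Solution K g) (hg0 : g 0 =ᵐ[volume] f₀) {t : ℝ} (ht : 0 ≤ t) :
    g t =ᵐ[volume] flowDensity (densMeasure f₀) Z t := by
  have := isProbabilityMeasure_densMeasure h0 hi h1
  have hμ := integrable_norm_densMeasure h0 hi hm
  have hv : densMeasure f₀ ≪ volume := withDensity_absolutelyContinuous _ _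
  have hf := (isL1MeanFieldSol_flowDensity h h0 hi h1 hm hZ).isL1Solution
  obtain ⟨κ, hκ, hb⟩ := hZ.exists_isTameField h hμ hv t
  obtain ⟨M₁, hM₁⟩ := hZ.exists_moment_bound h hμ hv t
  have hw : Integrable fun z => (1 + ‖z‖) * |g 0 z| := by
    refine (hi.add hm).congr ?_
    filter_upwards [hg0] with z hz
    rw [hz, abs_of_nonneg (h0 z), Pi.add_apply]
    ring
  obtain ⟨M₂, hM₂⟩ := hg.exists_moment_bound h ((integral_congr_ae hg0).trans h1) hw t
  have hle : ∀ s z, ‖z‖ * |g s z| ≤ (1 + ‖z‖) * |g s z| := fun s z => by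
    gcongr
    linarith
  have hgm : ∀ s ∈ Set.Icc 0 t, Integrable fun z => ‖z‖ * |g s z| := fun s hs =>
    (hM₂ s hs).1.mono' (continuous_norm.aestronglyMeasurable.mul
      (hg.integrable s).abs.aestronglyMeasurable) (.of_forall fun z => by
        rw [Real.norm_of_nonneg (by positivity)]
        exact hle s z)
  exact hg.ae_eq_of_moment_bound h hf hb hκ hgm (fun s hs => (hM₁ s hs).1) (M := max M₁ M₂)
    (fun s hs => (integral_mono (hgm s hs) (hM₂ s hs).1 (hle s)).trans
      ((hM₂ s hs).2.trans (le_max_right _ _)))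
    (fun s hs => (hM₁ s hs).2.trans (le_max_left _ _))
    (hg0.trans (flowDensity_zero_ae_eq h0 hi hZ.zero).symm) t ⟨ht, le_rfl⟩

/-- The density transported by the mean field flow is the unique `L¹` solution. -/
theorem IsL1Solution.ae_eq_flowDensity (h : IsInteractionKernel K L)
    (h0 : ∀ z, 0 ≤ f₀ z) (hi : Integrable f₀) (h1 : ∫ z, f₀ z = 1)
    (hm : Integrable (fun z => ‖z‖ * f₀ z)) (hZ : IsMeanFieldFlow K (densMeasure f₀) Z)
    (hg : IsL1Solution K g) (hg0 : g 0 =ᵐ[volume] f₀) (t : ℝ) :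
    g t =ᵐ[volume] flowDensity (densMeasure f₀) Z t := by
  rcases le_total 0 t with ht | ht
  · exact hg.ae_eq_flowDensity_of_nonneg h h0 hi h1 hm hZ hg0 ht
  · have h2 := hg.neg.ae_eq_flowDensity_of_nonneg h.neg h0 hi h1 hm hZ.neg
      (by simpa using hg0) (neg_nonneg.2 ht)
    have h3 : flowDensity (densMeasure f₀) (fun t => Z (-t)) (-t) =
        flowDensity (densMeasure f₀) Z t := by
      funext z
      simp only [flowDensity, neg_neg]
    simpa [h3] using h2

end Uniqueness

/-- mean field limit: existence and uniqueness of the weak solution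
`f ∈ C(ℝ; L¹)` of the mean field PDE with initial probability density `fin` having
finite first moment, and convergence of the empirical measures of the `N`-particle
dynamics towards `f(t,·)·Leb` with the Dobrushin rate, provided the initial
empirical measures converge to `fin·Leb` in Monge-Kantorovich distance. -/
theorem stmt6 (d : ℕ) (L : ℝ) (hL : 0 ≤ L)
    (K : EuclideanSpace ℝ (Fin d) × EuclideanSpace ℝ (Fin d) → EuclideanSpace ℝ (Fin d))
    (hK : ContDiff ℝ 1 K)
    (hK1 : ∀ z z' : EuclideanSpace ℝ (Fin d), K (z, z') = - K (z', z))
    (hK2 : (∀ z z' : EuclideanSpace ℝ (Fin d), ‖fderiv ℝ (fun w => K (w, z')) z‖ ≤ L) ∧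
           (∀ z z' : EuclideanSpace ℝ (Fin d), ‖fderiv ℝ (fun w => K (z, w)) z'‖ ≤ L))
    (fin : EuclideanSpace ℝ (Fin d) → ℝ)
    (hfin_nonneg : ∀ z, 0 ≤ fin z) (hfin_int : Integrable fin)
    (hfin_prob : ∫ z, fin z = 1)
    (hfin_mom : Integrable (fun z => ‖z‖ * fin z))
    -- the chosen initial configurations and the associated N-particle dynamics
    (𝔍 : (N : ℕ) → Fin N → EuclideanSpace ℝ (Fin d))
    (ZN : (N : ℕ) → ℝ → Fin N → EuclideanSpace ℝ (Fin d))
    (hZN0 : ∀ N, ZN N 0 = 𝔍 N)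
    (hZNode : ∀ N : ℕ, 1 ≤ N → ∀ t : ℝ,
      HasDerivAt (ZN N) (fun i => (N : ℝ)⁻¹ • ∑ j : Fin N, K (ZN N t i, ZN N t j)) t)
    (h𝔍 : Tendsto (fun N : ℕ => distMK1 (empiricalMeasure (𝔍 N)) (densMeasure fin))
      atTop (𝓝 0)) :
    ∃ f : ℝ → EuclideanSpace ℝ (Fin d) → ℝ,
      -- (i) existence and uniqueness of the weak solution in C(ℝ; L¹)
      IsL1MeanFieldSol K fin f ∧
      (∀ g : ℝ → EuclideanSpace ℝ (Fin d) → ℝ, IsL1MeanFieldSol K fin g →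
        ∀ t : ℝ, g t =ᵐ[(volume : Measure (EuclideanSpace ℝ (Fin d)))] f t) ∧
      -- (ii) the quantitative mean field limit
      (∀ t : ℝ, ∀ N : ℕ, 1 ≤ N →
        distMK1 (empiricalMeasure (ZN N t)) (densMeasure (f t)) ≤
          ENNReal.ofReal (Real.exp (2 * L * |t|)) *
            distMK1 (empiricalMeasure (𝔍 N)) (densMeasure fin)) ∧
      (∀ t : ℝ,
        Tendsto (fun N : ℕ => distMK1 (empiricalMeasure (ZN N t)) (densMeasure (f t)))
          atTop (𝓝 0)) ∧
      (∀ t : ℝ, ∀ φ : EuclideanSpace ℝ (Fin d) → ℝ, Continuous φ →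
        (∃ C : ℝ, ∀ z, |φ z| ≤ C) →
        Tendsto (fun N : ℕ => ∫ z, φ z ∂(empiricalMeasure (ZN N t)))
          atTop (𝓝 (∫ z, φ z * f t z))) := by
  have h := isInteractionKernel_of_fderiv hL hK hK1 hK2.1
  have hp := isProbabilityMeasure_densMeasure hfin_nonneg hfin_int hfin_prob
  obtain ⟨Z, hZ⟩ := exists_meanFieldFlow h
    (integrable_norm_densMeasure hfin_nonneg hfin_int hfin_mom)
  have hle : ∀ t : ℝ, ∀ N : ℕ, 1 ≤ N →
      distMK1 (empiricalMeasure (ZN N t)) (densMeasure (flowDensity (densMeasure fin) Z t)) ≤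
        ENNReal.ofReal (Real.exp (2 * L * |t|)) *
          distMK1 (empiricalMeasure (𝔍 N)) (densMeasure fin) := fun t N hN =>
    distMK1_particles_le h hfin_nonneg hfin_int hfin_prob hfin_mom hZ hN (hZN0 N) (hZNode N hN) t
  have hlim : ∀ t : ℝ, Tendsto (fun N : ℕ => distMK1 (empiricalMeasure (ZN N t))
      (densMeasure (flowDensity (densMeasure fin) Z t))) atTop (𝓝 0) := fun t => by
    have h2 := ENNReal.Tendsto.const_mul (a := ENNReal.ofReal (Real.exp (2 * L * |t|))) h𝔍
      (Or.inr ENNReal.ofReal_ne_top)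
    rw [mul_zero] at h2
    exact tendsto_of_tendsto_of_tendsto_of_le_of_le' tendsto_const_nhds h2
      (.of_forall fun _ => zero_le) ((eventually_ge_atTop 1).mono fun N hN => hle t N hN)
  refine ⟨flowDensity (densMeasure fin) Z,
    isL1MeanFieldSol_flowDensity h hfin_nonneg hfin_int hfin_prob hfin_mom hZ,
    fun g hg t => hg.isL1Solution.ae_eq_flowDensity h hfin_nonneg hfin_int hfin_prob hfin_mom hZ
      hg.2.2.1 t, hle, hlim, fun t φ hφ hb => ?_⟩
  have := isProbabilityMeasure_densMeasure_flowDensity h hfin_nonneg hfin_int hfin_prob hfin_mom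
    hZ t
  rw [← integral_densMeasure (flowDensity_nonneg t) (integrable_flowDensity t)]
  exact tendsto_integral_of_tendsto_distMK1
    (fun N hN => isProbabilityMeasure_empiricalMeasure hN (ZN N t)) (hlim t) hφ hb
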